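/- arXiv:1312.1330 — 2 statements merged into one kernel-verified Lean document; each statement's English description precedes it below -/
import Mathlib

section
/- Let (R, 𝔪) be a local Noetherian ring of dimension d and 𝔞 an ideal with H^d_𝔞(R) ≠ 0. If 0 = ∩_{j=1}^n 𝔮_j is a reduced primary decomposition of the zero ideal with 𝔮_j 𝔭_j-primary, then Ann_R(H^d_𝔞(R)) = ∩_{cd(𝔞, R/𝔭_j) = d} 𝔮_j. -/
open CategoryTheory

universe u

/-- `H^i_I(M) ≠ 0`: the `i`-th local cohomology of `M` with respect to `I` is nonzero. -/
abbrev LCNonzero {R : Type u} [CommRing R] (I : Ideal R) (i : ℕ)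
    (M : Type u) [AddCommGroup M] [Module R M] : Prop :=
  Nontrivial ((localCohomology I i).obj (ModuleCat.of R M))

/-- Cohomological dimension `cd(I, M) = sup {i : H^i_I(M) ≠ 0}`, as an element of
`WithBot ℕ∞` (it is `⊥` if all local cohomology of `M` vanishes). -/
noncomputable def cohDim {R : Type u} [CommRing R] (I : Ideal R)
    (M : Type u) [AddCommGroup M] [Module R M] : WithBot ℕ∞ :=
  sSup {n : WithBot ℕ∞ | ∃ i : ℕ, n = (i : ℕ∞) ∧ LCNonzero I i M}

/-- Krull dimension of a module, i.e. the Krull dimension of `R ⧸ Ann_R M`. -/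
noncomputable def modDim (R : Type u) [CommRing R]
    (M : Type u) [AddCommGroup M] [Module R M] : WithBot ℕ∞ :=
  ringKrullDim (R ⧸ Module.annihilator R M)

/-- A submodule `N ≤ M` is `p`-primary if `Ass_R (M ⧸ N) = {p}`. -/
def IsPrimarySubmodule {R : Type u} [CommRing R] {M : Type u} [AddCommGroup M] [Module R M]
    (N : Submodule R M) (p : Ideal R) : Prop :=
  associatedPrimes R (M ⧸ N) = {p}


namespace LCx

noncomputable section

section defs

variable {R : Type u} [CommRing R] (a : Ideal R)

/-- the module `R/a^n` -/
abbrev Qm (n : ℕ) : ModuleCat.{u} R := ModuleCat.of R (R ⧸ a ^ n)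

/-- transition -/
def tr {m n : ℕ} (h : m ≤ n) : Qm a n ⟶ Qm a m :=
  ModuleCat.ofHom (Submodule.mapQ (a ^ n) (a ^ m) LinearMap.id (Ideal.pow_le_pow_right h))

lemma tr_id (n : ℕ) : tr a (le_refl n) = 𝟙 _ := by
  ext; rfl

lemma tr_comp {l m n : ℕ} (h : l ≤ m) (h' : m ≤ n) :
    tr a h' ≫ tr a h = tr a (h.trans h') := by
  ext; rfl

/-- Ext groups -/
abbrev EE (i : ℕ) (M : Type u) [AddCommGroup M] [Module R M] (n : ℕ) : Type u :=
  Abelian.Ext.{u} (Qm a n) (ModuleCat.of R M) i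

variable (i : ℕ) (M : Type u) [AddCommGroup M] [Module R M]

/-- transition on Ext -/
def trE {m n : ℕ} (h : m ≤ n) : EE a i M m →ₗ[R] EE a i M n :=
  Abelian.Ext.bilinearCompOfLinear R _ _ _ 0 i i (zero_add i) (Abelian.Ext.mk₀ (tr a h))

lemma trE_apply {m n : ℕ} (h : m ≤ n) (x : EE a i M m) :
    trE a i M h x = (Abelian.Ext.mk₀ (tr a h)).comp x (zero_add i) := rfl

instance : DirectedSystem (EE a i M) (fun _ _ h => trE a i M h) where
  map_self := by
    intro n x
    rw [trE_apply, tr_id, Abelian.Ext.mk₀_id_comp]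
  map_map := by
    intro l m n h h' x
    rw [trE_apply, trE_apply, trE_apply, Abelian.Ext.mk₀_comp_mk₀_assoc, tr_comp]

/-- local cohomology, as a direct limit of the new Ext -/
def H : Type u := Module.DirectLimit (EE a i M) (fun _ _ h => trE a i M h)

instance : AddCommGroup (H a i M) :=
  inferInstanceAs (AddCommGroup (Module.DirectLimit (EE a i M) (fun _ _ h => trE a i M h)))

instance : Module R (H a i M) :=
  inferInstanceAs (Module R (Module.DirectLimit (EE a i M) (fun _ _ h => trE a i M h)))

/-- structure maps -/
def ofE (n : ℕ) : EE a i M n →ₗ[R] H a i M :=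
  Module.DirectLimit.of R ℕ (EE a i M) (fun _ _ h => trE a i M h) n

variable {M}

lemma ofE_surj (x : H a i M) : ∃ n y, ofE a i M n y = x :=
  Module.DirectLimit.exists_of x

lemma ofE_trE {m n : ℕ} (h : m ≤ n) (x : EE a i M m) :
    ofE a i M n (trE a i M h x) = ofE a i M m x :=
  Module.DirectLimit.of_f

lemma ofE_zero {m : ℕ} (x : EE a i M m) (hx : ofE a i M m x = 0) :
    ∃ n, ∃ h : m ≤ n, trE a i M h x = 0 :=
  Module.DirectLimit.of.zero_exact hx

/-- lift -/
def liftE {P : Type*} [AddCommGroup P] [Module R P] (g : ∀ n, EE a i M n →ₗ[R] P)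
    (hg : ∀ m n (h : m ≤ n) x, g n (trE a i M h x) = g m x) : H a i M →ₗ[R] P :=
  Module.DirectLimit.lift R ℕ (EE a i M) _ g hg

@[simp] lemma liftE_ofE {P : Type*} [AddCommGroup P] [Module R P] (g : ∀ n, EE a i M n →ₗ[R] P)
    (hg : ∀ m n (h : m ≤ n) x, g n (trE a i M h x) = g m x) (n : ℕ) (x : EE a i M n) :
    liftE a i g hg (ofE a i M n x) = g n x :=
  Module.DirectLimit.lift_of ..

variable {N P : Type u} [AddCommGroup N] [Module R N] [AddCommGroup P] [Module R P]

/-- postcomposition with an ext class -/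
def postE {j k : ℕ} (e : Abelian.Ext.{u} (ModuleCat.of R M) (ModuleCat.of R N) j)
    (h : i + j = k) (n : ℕ) : EE a i M n →ₗ[R] EE a k N n :=
  (Abelian.Ext.bilinearCompOfLinear R _ _ _ i j k h).flip e

lemma postE_apply {j k : ℕ} (e : Abelian.Ext.{u} (ModuleCat.of R M) (ModuleCat.of R N) j)
    (h : i + j = k) (n : ℕ) (x : EE a i M n) : postE a i e h n x = x.comp e h := rfl

lemma postE_trE {j k : ℕ} (e : Abelian.Ext.{u} (ModuleCat.of R M) (ModuleCat.of R N) j)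
    (h : i + j = k) {m n : ℕ} (hmn : m ≤ n) (x : EE a i M m) :
    postE a i e h n (trE a i M hmn x) = trE a k N hmn (postE a i e h m x) := by
  simp only [postE_apply, trE_apply]
  rw [Abelian.Ext.comp_assoc _ _ _ (zero_add i) h (by omega)]

/-- action of an ext class -/
def act {j k : ℕ} (e : Abelian.Ext.{u} (ModuleCat.of R M) (ModuleCat.of R N) j)
    (h : i + j = k) : H a i M →ₗ[R] H a k N :=
  liftE a i (fun n => ofE a k N n ∘ₗ postE a i e h n) (by
    intro m n hmn x
    simp only [LinearMap.comp_apply]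
    rw [postE_trE, ofE_trE])

lemma act_ofE {j k : ℕ} (e : Abelian.Ext.{u} (ModuleCat.of R M) (ModuleCat.of R N) j)
    (h : i + j = k) (n : ℕ) (x : EE a i M n) :
    act a i e h (ofE a i M n x) = ofE a k N n (x.comp e h) := by
  simp [act, postE_apply]

/-- functoriality -/
def map (f : M →ₗ[R] N) : H a i M →ₗ[R] H a i N :=
  act a i (Abelian.Ext.mk₀ (ModuleCat.ofHom f)) (add_zero i)

lemma map_ofE (f : M →ₗ[R] N) (n : ℕ) (x : EE a i M n) :
    map a i f (ofE a i M n x) =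
      ofE a i N n (x.comp (Abelian.Ext.mk₀ (ModuleCat.ofHom f)) (add_zero i)) :=
  act_ofE ..

lemma map_id : map a i (LinearMap.id : M →ₗ[R] M) = LinearMap.id := by
  ext x
  obtain ⟨n, y, rfl⟩ := ofE_surj a i x
  rw [map_ofE, ModuleCat.ofHom_id, Abelian.Ext.comp_mk₀_id]
  rfl

lemma map_comp (g : N →ₗ[R] P) (f : M →ₗ[R] N) :
    map a i (g ∘ₗ f) = map a i g ∘ₗ map a i f := by
  ext x
  obtain ⟨n, y, rfl⟩ := ofE_surj a i x
  rw [LinearMap.comp_apply, map_ofE, map_ofE, map_ofE, ModuleCat.ofHom_comp,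
    ← Abelian.Ext.mk₀_comp_mk₀, Abelian.Ext.comp_assoc _ _ _ (add_zero i) (add_zero 0) (by omega)]

lemma map_add (f g : M →ₗ[R] N) : map a i (f + g) = map a i f + map a i g := by
  ext x
  obtain ⟨n, y, rfl⟩ := ofE_surj a i x
  rw [LinearMap.add_apply, map_ofE, map_ofE, map_ofE, ModuleCat.ofHom_add,
    Abelian.Ext.mk₀_add, Abelian.Ext.comp_add, LinearMap.map_add]

lemma map_smul (r : R) (f : M →ₗ[R] N) : map a i (r • f) = r • map a i f := by
  ext x
  obtain ⟨n, y, rfl⟩ := ofE_surj a i x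
  rw [LinearMap.smul_apply, map_ofE, map_ofE,
    show ModuleCat.ofHom (r • f) = r • ModuleCat.ofHom f from rfl,
    Abelian.Ext.mk₀_smul, Abelian.Ext.comp_smul, LinearMap.map_smul]

/-- associated short complex -/
abbrev SC {f : M →ₗ[R] N} {g : N →ₗ[R] P} (hfg : Function.Exact f g) :
    ShortComplex (ModuleCat.{u} R) :=
  ShortComplex.mk (ModuleCat.ofHom f) (ModuleCat.ofHom g) (by
    ext x; simpa using hfg.apply_apply_eq_zero x)

lemma SC_exact {f : M →ₗ[R] N} {g : N →ₗ[R] P} (hf : Function.Injective f)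
    (hfg : Function.Exact f g) (hg : Function.Surjective g) : (SC hfg).ShortExact where
  exact := (ShortComplex.ShortExact.moduleCat_exact_iff_function_exact (SC hfg)).2 hfg
  mono_f := (ModuleCat.mono_iff_injective _).2 hf
  epi_g := (ModuleCat.epi_iff_surjective _).2 hg

/-- connecting map -/
def del {f : M →ₗ[R] N} {g : N →ₗ[R] P} (hf : Function.Injective f)
    (hfg : Function.Exact f g) (hg : Function.Surjective g) : H a i P →ₗ[R] H a (i + 1) M :=
  act a i (SC_exact hf hfg hg).extClass rfl

lemma del_ofE {f : M →ₗ[R] N} {g : N →ₗ[R] P} (hf : Function.Injective f)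
    (hfg : Function.Exact f g) (hg : Function.Surjective g) (n : ℕ) (x : EE a i P n) :
    del a i hf hfg hg (ofE a i P n x) =
      ofE a (i+1) M n (x.comp (SC_exact hf hfg hg).extClass rfl) :=
  act_ofE ..

lemma exact_mid {f : M →ₗ[R] N} {g : N →ₗ[R] P} (hf : Function.Injective f)
    (hfg : Function.Exact f g) (hg : Function.Surjective g) :
    Function.Exact (map a i f) (map a i g) := by
  intro x
  constructor
  · intro hx
    obtain ⟨n, y, rfl⟩ := ofE_surj a i x
    rw [map_ofE] at hx
    obtain ⟨m, hnm, hm⟩ := ofE_zero a i _ hx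
    have : (trE a i N hnm y).comp (Abelian.Ext.mk₀ (SC hfg).g) (add_zero i) = 0 := by
      refine Eq.trans ?_ hm
      exact postE_trE a i _ (add_zero i) hnm y
    obtain ⟨z, hz⟩ := Abelian.Ext.covariant_sequence_exact₂ _ (SC_exact hf hfg hg) _ this
    refine ⟨ofE a i M m z, ?_⟩
    rw [map_ofE, ← ofE_trE a i hnm y]
    exact congrArg _ hz
  · rintro ⟨y, rfl⟩
    rw [← LinearMap.comp_apply, ← map_comp]
    have : g ∘ₗ f = (0 : R) • (0 : M →ₗ[R] P) := by
      rw [zero_smul]; exact hfg.linearMap_comp_eq_zero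
    rw [this, map_smul, zero_smul]; rfl

lemma exact_del {f : M →ₗ[R] N} {g : N →ₗ[R] P} (hf : Function.Injective f)
    (hfg : Function.Exact f g) (hg : Function.Surjective g) :
    Function.Exact (map a i g) (del a i hf hfg hg) := by
  intro x
  constructor
  · intro hx
    obtain ⟨n, y, rfl⟩ := ofE_surj a i x
    rw [del_ofE] at hx
    obtain ⟨m, hnm, hm⟩ := ofE_zero a (i+1) _ hx
    have : (trE a i P hnm y).comp (SC_exact hf hfg hg).extClass rfl = 0 := by
      refine Eq.trans ?_ hm
      exact postE_trE a i _ rfl hnm y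
    obtain ⟨z, hz⟩ := Abelian.Ext.covariant_sequence_exact₃ _ (SC_exact hf hfg hg) _ rfl this
    refine ⟨ofE a i N m z, ?_⟩
    rw [map_ofE, ← ofE_trE a i hnm y]
    exact congrArg _ hz
  · rintro ⟨y, rfl⟩
    obtain ⟨n, y, rfl⟩ := ofE_surj a i y
    rw [map_ofE, del_ofE]
    have := (SC_exact hf hfg hg).comp_extClass
    rw [Abelian.Ext.comp_assoc _ _ _ (add_zero i) (zero_add 1) (by omega)]
    erw [this]
    simp

lemma exact_del' {f : M →ₗ[R] N} {g : N →ₗ[R] P} (hf : Function.Injective f)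
    (hfg : Function.Exact f g) (hg : Function.Surjective g) :
    Function.Exact (del a i hf hfg hg) (map a (i+1) f) := by
  intro x
  constructor
  · intro hx
    obtain ⟨n, y, rfl⟩ := ofE_surj a (i+1) x
    rw [map_ofE] at hx
    obtain ⟨m, hnm, hm⟩ := ofE_zero a (i+1) _ hx
    have : (trE a (i+1) M hnm y).comp (Abelian.Ext.mk₀ (SC hfg).f) (add_zero _) = 0 := by
      refine Eq.trans ?_ hm
      exact postE_trE a (i+1) (Abelian.Ext.mk₀ (ModuleCat.ofHom f)) (add_zero (i+1)) hnm y
    obtain ⟨z, hz⟩ := Abelian.Ext.covariant_sequence_exact₁ _ (SC_exact hf hfg hg) _ this rfl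
    refine ⟨ofE a i P m z, ?_⟩
    rw [del_ofE, ← ofE_trE a (i+1) hnm y]
    exact congrArg _ hz
  · rintro ⟨y, rfl⟩
    obtain ⟨n, y, rfl⟩ := ofE_surj a i y
    rw [del_ofE, map_ofE]
    have := (SC_exact hf hfg hg).extClass_comp
    rw [Abelian.Ext.comp_assoc _ _ _ rfl (add_zero 1) (by omega)]
    erw [this]
    simp

lemma map_zero_injective {f : M →ₗ[R] N} (hf : Function.Injective f) :
    Function.Injective (map a 0 f) := by
  rw [injective_iff_map_eq_zero]
  intro x hx
  obtain ⟨n, y, rfl⟩ := ofE_surj a 0 x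
  rw [map_ofE] at hx
  obtain ⟨m, hnm, hm⟩ := ofE_zero a 0 _ hx
  have h1 : (trE a 0 M hnm y).comp (Abelian.Ext.mk₀ (ModuleCat.ofHom f)) (add_zero _) = 0 := by
    refine Eq.trans ?_ hm
    exact postE_trE a 0 (Abelian.Ext.mk₀ (ModuleCat.ofHom f)) (add_zero 0) hnm y
  have : Mono (ModuleCat.ofHom f) := (ModuleCat.mono_iff_injective _).2 hf
  have h2 := (injective_iff_map_eq_zero _).1
    (Abelian.Ext.postcomp_mk₀_injective_of_mono (Qm a m) (ModuleCat.ofHom f)) _ h1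
  rw [← ofE_trE a 0 hnm y, h2, LinearMap.map_zero]

variable {M' N' P' : Type u} [AddCommGroup M'] [Module R M'] [AddCommGroup N'] [Module R N']
  [AddCommGroup P'] [Module R P']

lemma del_natural {f : M →ₗ[R] N} {g : N →ₗ[R] P} (hf : Function.Injective f)
    (hfg : Function.Exact f g) (hg : Function.Surjective g)
    {f' : M' →ₗ[R] N'} {g' : N' →ₗ[R] P'} (hf' : Function.Injective f')
    (hfg' : Function.Exact f' g') (hg' : Function.Surjective g')
    (u : M →ₗ[R] M') (v : N →ₗ[R] N') (w : P →ₗ[R] P') (h1 : v ∘ₗ f = f' ∘ₗ u)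
    (h2 : w ∘ₗ g = g' ∘ₗ v) (x : H a i P) :
    map a (i+1) u (del a i hf hfg hg x) = del a i hf' hfg' hg' (map a i w x) := by
  obtain ⟨n, y, rfl⟩ := ofE_surj a i x
  rw [del_ofE, map_ofE, map_ofE, del_ofE]
  let φ : SC hfg ⟶ SC hfg' :=
    { τ₁ := ModuleCat.ofHom u
      τ₂ := ModuleCat.ofHom v
      τ₃ := ModuleCat.ofHom w
      comm₁₂ := by
        change ModuleCat.ofHom u ≫ ModuleCat.ofHom f' = ModuleCat.ofHom f ≫ ModuleCat.ofHom v
        rw [← ModuleCat.ofHom_comp, ← ModuleCat.ofHom_comp, h1]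
      comm₂₃ := by
        change ModuleCat.ofHom v ≫ ModuleCat.ofHom g' = ModuleCat.ofHom g ≫ ModuleCat.ofHom w
        rw [← ModuleCat.ofHom_comp, ← ModuleCat.ofHom_comp, h2] }
  have := ShortComplex.ShortExact.extClass_naturality (SC_exact hf hfg hg)
    (SC_exact hf' hfg' hg') φ
  rw [Abelian.Ext.comp_assoc _ _ _ rfl (add_zero 1) (by omega),
    Abelian.Ext.comp_assoc _ _ _ (add_zero i) (zero_add 1) (by omega)]
  exact congrArg (fun t => ofE a (i+1) M' n (y.comp t rfl)) this

end defs

end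

end LCx


namespace LCx

noncomputable section

section gam

variable {R : Type u} [CommRing R] (a : Ideal R)

/-- the `a`-torsion submodule -/
def gam (M : Type*) [AddCommGroup M] [Module R M] : Submodule R M where
  carrier := {m | ∃ n, ∀ r ∈ a ^ n, r • m = 0}
  add_mem' := by
    rintro x y ⟨n, hn⟩ ⟨k, hk⟩
    refine ⟨max n k, fun r hr => ?_⟩
    rw [smul_add, hn r (Ideal.pow_le_pow_right (le_max_left _ _) hr),
      hk r (Ideal.pow_le_pow_right (le_max_right _ _) hr), add_zero]
  zero_mem' := ⟨0, fun r _ => smul_zero r⟩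
  smul_mem' := by
    rintro c x ⟨n, hn⟩
    exact ⟨n, fun r hr => by rw [smul_comm, hn r hr, smul_zero]⟩

lemma mem_gam {M : Type*} [AddCommGroup M] [Module R M] {m : M} :
    m ∈ gam a M ↔ ∃ n, ∀ r ∈ a ^ n, r • m = 0 := Iff.rfl

variable {M : Type u} [AddCommGroup M] [Module R M]
  {N : Type u} [AddCommGroup N] [Module R N]

variable (M) in
/-- evaluation at level n -/
def ev0n (n : ℕ) : EE a 0 M n →ₗ[R] M where
  toFun y := (Abelian.Ext.linearEquiv₀ (R := R) y).hom (Submodule.Quotient.mk 1)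
  map_add' x y := by rw [_root_.map_add]; rfl
  map_smul' r y := by rw [_root_.map_smul]; rfl

lemma ev0n_mk (n : ℕ) (f : Qm a n ⟶ ModuleCat.of R M) :
    ev0n a M n (Abelian.Ext.mk₀ f) = f.hom (Submodule.Quotient.mk 1) := by
  have : Abelian.Ext.linearEquiv₀ (R := R) (Abelian.Ext.mk₀ f) = f := by
    rw [← Abelian.Ext.linearEquiv₀_symm_apply (R := R), LinearEquiv.apply_symm_apply]
  change (Abelian.Ext.linearEquiv₀ (R := R) (Abelian.Ext.mk₀ f)).hom _ = _
  rw [this]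

lemma EE0_surj (n : ℕ) (y : EE a 0 M n) : ∃ f : Qm a n ⟶ ModuleCat.of R M,
    Abelian.Ext.mk₀ f = y :=
  ⟨_, Abelian.Ext.mk₀_linearEquiv₀_apply (R := R) y⟩

variable (M) in
/-- `H^0 → M` -/
def ev0 : H a 0 M →ₗ[R] M :=
  liftE a 0 (ev0n a M) (by
    intro m n h x
    obtain ⟨f, rfl⟩ := EE0_surj a m x
    rw [trE_apply, Abelian.Ext.mk₀_comp_mk₀, ev0n_mk, ev0n_mk]
    rfl)

lemma ev0_ofE (n : ℕ) (f : Qm a n ⟶ ModuleCat.of R M) :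
    ev0 a M (ofE a 0 M n (Abelian.Ext.mk₀ f)) = f.hom (Submodule.Quotient.mk 1) := by
  rw [ev0, liftE_ofE, ev0n_mk]

lemma ev0_injective : Function.Injective (ev0 a M) := by
  rw [injective_iff_map_eq_zero]
  intro x hx
  obtain ⟨n, y, rfl⟩ := ofE_surj a 0 x
  obtain ⟨f, rfl⟩ := EE0_surj a n y
  rw [ev0_ofE] at hx
  have : f = 0 := by
    ext
    exact hx
  rw [this, Abelian.Ext.mk₀_zero, LinearMap.map_zero]

lemma ev0_range : LinearMap.range (ev0 a M) = gam a M := by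
  apply le_antisymm
  · rintro _ ⟨x, rfl⟩
    obtain ⟨n, y, rfl⟩ := ofE_surj a 0 x
    obtain ⟨f, rfl⟩ := EE0_surj a n y
    rw [ev0_ofE]
    refine ⟨n, fun r hr => ?_⟩
    erw [← LinearMap.map_smul]
    have : r • (Submodule.Quotient.mk 1 : R ⧸ a ^ n) = 0 := by
      rw [← Submodule.Quotient.mk_smul, Submodule.Quotient.mk_eq_zero]
      simpa using hr
    erw [this, LinearMap.map_zero]
  · rintro m ⟨n, hn⟩
    refine ⟨ofE a 0 M n (Abelian.Ext.mk₀ (ModuleCat.ofHom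
      (Submodule.liftQ (a ^ n) (LinearMap.toSpanSingleton R M m) (fun r hr => ?_)))), ?_⟩
    · simpa using hn r hr
    · rw [ev0_ofE]
      change Submodule.liftQ (a ^ n) (LinearMap.toSpanSingleton R M m) _
        (Submodule.Quotient.mk 1) = m
      exact (Submodule.liftQ_apply _ _ _).trans (one_smul R m)

lemma ev0_map (f : M →ₗ[R] N) (x : H a 0 M) : ev0 a N (map a 0 f x) = f (ev0 a M x) := by
  obtain ⟨n, y, rfl⟩ := ofE_surj a 0 x
  obtain ⟨g, rfl⟩ := EE0_surj a n y
  rw [map_ofE, Abelian.Ext.mk₀_comp_mk₀, ev0_ofE, ev0_ofE]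
  rfl

lemma H_injective [Module.Injective R M] (i : ℕ) : Subsingleton (H a (i+1) M) := by
  refine ⟨fun x y => ?_⟩
  suffices h : ∀ x : H a (i+1) M, x = 0 by rw [h x, h y]
  intro x
  obtain ⟨n, y, rfl⟩ := ofE_surj a _ x
  have : Injective (ModuleCat.of R M) := Module.injective_object_of_injective_module R M
  rw [Abelian.Ext.eq_zero_of_injective y, LinearMap.map_zero]

end gam

end

end LCx


namespace LCx

noncomputable section

section cmp

open Opposite

variable {R : Type u} [CommRing R]

lemma op_ker (K : ChainComplex (ModuleCat.{u} R)ᵒᵖ ℕ) (i : ℕ) :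
    Function.Exact (K.pOpcycles i).unop.hom (K.d (i+1) i).unop.hom := by
  have h := ShortComplex.exact_of_g_is_cokernel
    (ShortComplex.mk (K.d (i+1) i) (K.pOpcycles i) (by simp))
    (K.opcyclesIsCokernel (i+1) i (by simp))
  exact (ShortComplex.ShortExact.moduleCat_exact_iff_function_exact _).1 h.unop

lemma op_inj (K : ChainComplex (ModuleCat.{u} R)ᵒᵖ ℕ) (i : ℕ) :
    Function.Injective (K.pOpcycles i).unop.hom :=
  (ModuleCat.mono_iff_injective _).1 inferInstance

lemma op_surj (K : ChainComplex (ModuleCat.{u} R)ᵒᵖ ℕ) (i : ℕ) :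
    Function.Surjective (K.homologyι i).unop.hom :=
  (ModuleCat.epi_iff_surjective _).1 inferInstance

lemma op_ker' (K : ChainComplex (ModuleCat.{u} R)ᵒᵖ ℕ) (i j : ℕ)
    (h : (ComplexShape.down ℕ).next i = j) :
    Function.Exact (K.fromOpcycles i j).unop.hom (K.homologyι i).unop.hom := by
  have h := ShortComplex.exact_of_f_is_kernel
    (ShortComplex.mk (K.homologyι i) (K.fromOpcycles i j) (by simp))
    (K.homologyIsKernel i j h)
  exact (ShortComplex.ShortExact.moduleCat_exact_iff_function_exact _).1 h.unop

/-- The functor to be derived. -/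
abbrev FF (Y : ModuleCat.{u} R) : ModuleCat.{u} R ⥤ (ModuleCat.{u} R)ᵒᵖ :=
  ((linearYoneda R (ModuleCat.{u} R)).obj Y).rightOp

/-- complex -/
abbrev KK {X : ModuleCat.{u} R} (P : ProjectiveResolution X) (Y : ModuleCat.{u} R) :
    ChainComplex (ModuleCat.{u} R)ᵒᵖ ℕ :=
  ((FF Y).mapHomologicalComplex _).obj P.complex

/-- underlying morphism of a cocycle -/
def zf {X : ModuleCat.{u} R} (P : ProjectiveResolution X) (Y : ModuleCat.{u} R) (i : ℕ)
    (z : ((KK P Y).opcycles i).unop) : P.complex.X i ⟶ Y :=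
  ((KK P Y).pOpcycles i).unop.hom z

lemma zf_d {X : ModuleCat.{u} R} (P : ProjectiveResolution X) (Y : ModuleCat.{u} R) (i : ℕ)
    (z : ((KK P Y).opcycles i).unop) : P.complex.d (i+1) i ≫ zf P Y i z = 0 :=
  (op_ker (KK P Y) i).apply_apply_eq_zero z

lemma zf_surj {X : ModuleCat.{u} R} (P : ProjectiveResolution X) (Y : ModuleCat.{u} R) (i : ℕ)
    (f : P.complex.X i ⟶ Y) (hf : P.complex.d (i+1) i ≫ f = 0) : ∃ z, zf P Y i z = f :=
  (op_ker (KK P Y) i f).1 hf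

lemma zf_ker {X : ModuleCat.{u} R} (P : ProjectiveResolution X) (Y : ModuleCat.{u} R) (i : ℕ)
    (z : ((KK P Y).opcycles i).unop) : ((KK P Y).homologyι i).unop.hom z = 0 ↔
      P.extMk (zf P Y i z) (i+1) rfl (zf_d P Y i z) = 0 := by
  rw [op_ker' (KK P Y) i _ rfl z]
  have key : ∀ j (w : P.complex.X j ⟶ Y), zf P Y i (((KK P Y).fromOpcycles i j).unop.hom w) = P.complex.d i j ≫ w := by
    intro j w
    have := (KK P Y).p_fromOpcycles i j
    exact congrArg (fun f => f.unop.hom w) this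
  have hinj : Function.Injective (zf P Y i) := op_inj (KK P Y) i
  cases i with
  | zero =>
    rw [← P.extEquivCohomologyClass.apply_eq_iff_eq,
      P.extEquivCohomologyClass_extMk, P.extEquivCohomologyClass_zero,
      CochainComplex.HomComplex.CohomologyClass.mk_eq_zero_iff]
    rw [CochainComplex.HomComplex.Cocycle.toSingleMk_mem_coboundaries_iff _ _ _ _ _ 1 (by simp)]
    have h0 : ∀ g : P.cochainComplex.X 1 ⟶ Y, g = 0 := fun g =>
      (P.cochainComplex.isZero_of_isStrictlyLE 0 1 (by simp)).eq_of_src _ _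
    constructor
    · rintro ⟨w, rfl⟩
      have hz := key _ w
      rw [P.complex.shape _ _ (by simp)] at hz
      replace hz := hz.trans Limits.zero_comp
      refine ⟨0, ?_⟩
      rw [Limits.comp_zero, hz, Limits.comp_zero]
    · rintro ⟨g, hg⟩
      rw [h0 g, Limits.comp_zero] at hg
      have h2 : zf P Y 0 z = 0 := by
        rw [← cancel_epi (P.cochainComplexXIso (-(0:ℕ)) 0 (by simp)).hom, Limits.comp_zero]
        exact hg.symm
      have h3 : z = 0 := hinj (h2.trans ((((KK P Y).pOpcycles 0).unop.hom).map_zero.symm))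
      rw [h3]
      exact ⟨0, LinearMap.map_zero _⟩
  | succ j =>
    rw [P.extMk_eq_zero_iff _ _ _ _ j rfl]
    have hj : (ComplexShape.down ℕ).next (j+1) = j := by simp
    rw [hj]
    constructor
    · rintro ⟨w, rfl⟩
      exact ⟨w, (key _ _).symm⟩
    · rintro ⟨w, hw⟩
      exact ⟨w, hinj ((key _ _).trans hw)⟩

lemma smul_extMk {X : ModuleCat.{u} R} (P : ProjectiveResolution X) (Y : ModuleCat.{u} R) (i : ℕ)
    (f : P.complex.X i ⟶ Y) (hf : P.complex.d (i+1) i ≫ f = 0) (r : R)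
    (hf' : P.complex.d (i+1) i ≫ (r • f) = 0) :
    P.extMk (r • f) (i+1) rfl hf' = r • P.extMk f (i+1) rfl hf := by
  rw [Abelian.Ext.smul_eq_comp_mk₀, P.extMk_comp_mk₀]
  congr 1

/-- the map from cocycles to the new Ext -/
def zE {X : ModuleCat.{u} R} (P : ProjectiveResolution X) (Y : ModuleCat.{u} R) (i : ℕ) :
    ((KK P Y).opcycles i).unop →ₗ[R] Abelian.Ext.{u} X Y i where
  toFun z := P.extMk (zf P Y i z) (i+1) rfl (zf_d P Y i z)
  map_add' x y := by
    rw [P.add_extMk]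
    congr 1
    exact (((KK P Y).pOpcycles i).unop.hom).map_add x y
  map_smul' r x := by
    have h : zf P Y i (r • x) = r • zf P Y i x := (((KK P Y).pOpcycles i).unop.hom).map_smul r x
    have h' : P.complex.d (i+1) i ≫ (r • zf P Y i x) = 0 := by
      rw [← h]; exact zf_d P Y i _
    refine Eq.trans ?_ (smul_extMk P Y i _ (zf_d P Y i x) r h')
    congr 1

/-- homology to new Ext -/
def hE {X : ModuleCat.{u} R} (P : ProjectiveResolution X) (Y : ModuleCat.{u} R) (i : ℕ) :
    ((KK P Y).homology i).unop ≃ₗ[R] Abelian.Ext.{u} X Y i :=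
  (((KK P Y).homologyι i).unop.hom.quotKerEquivOfSurjective (op_surj (KK P Y) i)).symm ≪≫ₗ
    Submodule.quotEquivOfEq _ _ (by
      ext z
      rw [LinearMap.mem_ker, LinearMap.mem_ker]
      exact zf_ker P Y i z) ≪≫ₗ
    (zE P Y i).quotKerEquivOfSurjective (by
      intro e
      obtain ⟨f, hf, rfl⟩ := P.extMk_surjective e (i+1) rfl
      obtain ⟨z, rfl⟩ := zf_surj P Y i f hf
      exact ⟨z, rfl⟩)

lemma hE_apply {X : ModuleCat.{u} R} (P : ProjectiveResolution X) (Y : ModuleCat.{u} R) (i : ℕ)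
    (z : ((KK P Y).opcycles i).unop) :
    hE P Y i (((KK P Y).homologyι i).unop.hom z) =
      P.extMk (zf P Y i z) (i+1) rfl (zf_d P Y i z) := by
  have : (((KK P Y).homologyι i).unop.hom.quotKerEquivOfSurjective (op_surj (KK P Y) i)).symm
      (((KK P Y).homologyι i).unop.hom z) = Submodule.Quotient.mk z := by
    rw [LinearEquiv.symm_apply_eq]; rfl
  rw [hE, LinearEquiv.trans_apply, LinearEquiv.trans_apply, this]
  rfl

/-- old Ext -/
abbrev oldE (X Y : ModuleCat.{u} R) (i : ℕ) : ModuleCat.{u} R :=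
  ((_root_.Ext R (ModuleCat.{u} R) i).obj (op X)).obj Y

/-- comparison -/
def oldNew (X Y : ModuleCat.{u} R) (i : ℕ) : oldE X Y i ≃ₗ[R] Abelian.Ext.{u} X Y i :=
  ((projectiveResolution X).isoLeftDerivedObj (FF Y) i).unop.symm.toLinearEquiv ≪≫ₗ
    hE (projectiveResolution X) Y i

lemma oldNew_natural {X X' : ModuleCat.{u} R} (Y : ModuleCat.{u} R) (i : ℕ) (g : X' ⟶ X)
    (x : oldE X Y i) :
    oldNew X' Y i ((((_root_.Ext R (ModuleCat.{u} R) i).map g.op).app Y).hom x) =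
      (Abelian.Ext.mk₀ g).comp (oldNew X Y i x) (zero_add i) := by
  let P := projectiveResolution X
  let P' := projectiveResolution X'
  obtain ⟨y, rfl⟩ :=
    ((P.isoLeftDerivedObj (FF Y) i).unop.symm.toLinearEquiv).symm.surjective x
  obtain ⟨z, rfl⟩ := op_surj (KK P Y) i y
  let φ : P'.complex ⟶ P.complex := ProjectiveResolution.lift g P' P
  have hφ : φ.f 0 ≫ P.π.f 0 = P'.π.f 0 ≫ g :=
    ProjectiveResolution.lift_commutes_zero g P' P
  let z' : ((KK P' Y).opcycles i).unop := (HomologicalComplex.opcyclesMap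
    (((FF Y).mapHomologicalComplex _).map φ) i).unop.hom z
  have h1 : zf P' Y i z' = φ.f i ≫ zf P Y i z := by
    have := HomologicalComplex.p_opcyclesMap (((FF Y).mapHomologicalComplex _).map φ) i
    exact congrArg (fun f => f.unop.hom z) this
  have h2 : (HomologicalComplex.homologyMap
      (((FF Y).mapHomologicalComplex _).map φ) i).unop.hom (((KK P Y).homologyι i).unop.hom z) =
      ((KK P' Y).homologyι i).unop.hom z' := by
    have := HomologicalComplex.homologyι_naturality (((FF Y).mapHomologicalComplex _).map φ) i
    exact congrArg (fun f => f.unop.hom z) this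
  have h3 := ProjectiveResolution.isoLeftDerivedObj_inv_naturality g P' P φ hφ (FF Y) i
  have h4 : (P'.isoLeftDerivedObj (FF Y) i).inv.unop.hom
      ((((FF Y).leftDerived i).map g).unop.hom
        ((P.isoLeftDerivedObj (FF Y) i).hom.unop.hom (((KK P Y).homologyι i).unop.hom z))) =
      ((KK P' Y).homologyι i).unop.hom z' := by
    rw [← h2]
    have h5 := congrArg (fun f => f.unop.hom ((P.isoLeftDerivedObj (FF Y) i).hom.unop.hom
      (((KK P Y).homologyι i).unop.hom z))) h3
    refine Eq.trans h5 ?_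
    have h6 := congrArg (fun f => f.unop.hom (((KK P Y).homologyι i).unop.hom z))
      (P.isoLeftDerivedObj (FF Y) i).inv_hom_id
    exact congrArg (HomologicalComplex.homologyMap
      (((FF Y).mapHomologicalComplex _).map φ) i).unop.hom h6
  have h7 : oldNew X' Y i ((((FF Y).leftDerived i).map g).unop.hom
        ((P.isoLeftDerivedObj (FF Y) i).hom.unop.hom (((KK P Y).homologyι i).unop.hom z))) =
      hE P' Y i (((KK P' Y).homologyι i).unop.hom z') := congrArg (hE P' Y i) h4
  refine Eq.trans h7 ?_
  have h8 : oldNew X Y i (((P.isoLeftDerivedObj (FF Y) i).unop.symm.toLinearEquiv).symm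
      (((KK P Y).homologyι i).unop.hom z)) = hE P Y i (((KK P Y).homologyι i).unop.hom z) :=
    congrArg (hE P Y i) (LinearEquiv.apply_symm_apply _ _)
  rw [h8, hE_apply, hE_apply]
  let Φ : ProjectiveResolution.Hom P' P g := ⟨φ, by
    rw [hφ]
    simp⟩
  refine Eq.trans ?_ (ProjectiveResolution.mk₀_comp_extMk (zf P Y i z) (i+1) rfl
    (zf_d P Y i z) Φ).symm
  congr 1

end cmp

end

end LCx


namespace LCx

noncomputable section

section cmp2

open Opposite Limits

variable {R : Type u} [CommRing R] (a : Ideal R) (i : ℕ)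

/-- the diagram -/
abbrev Dg : (ℕᵒᵖ)ᵒᵖ ⥤ ModuleCat.{u} R ⥤ ModuleCat.{u} R :=
  localCohomology.diagram (localCohomology.idealPowersDiagram a) i

/-- legs -/
def leg (Y : ModuleCat.{u} R) (n : ℕ) :
    oldE (Qm a n) Y i →ₗ[R] (localCohomology a i).obj Y :=
  ((colimit.ι (Dg a i) (op (op n))).app Y).hom

lemma leg_tr (Y : ModuleCat.{u} R) {m n : ℕ} (h : m ≤ n) (x : oldE (Qm a m) Y i) :
    leg a i Y n ((((_root_.Ext R (ModuleCat.{u} R) i).map (tr a h).op).app Y).hom x) =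
      leg a i Y m x := by
  have := colimit.w (Dg a i) (homOfLE h).op.op
  exact congrArg (fun f => (f.app Y).hom x) this

/-- The colimit cocone. -/
def legColim (Y : ModuleCat.{u} R) : IsColimit (((evaluation _ _).obj Y).mapCocone
    (colimit.cocone (Dg a i))) :=
  isColimitOfPreserves ((evaluation _ _).obj Y) (colimit.isColimit (Dg a i))

/-- preservation -/
lemma presForget (R : Type u) [CommRing R] :
    PreservesFilteredColimitsOfSize.{0,0} (forget (ModuleCat.{u} R)) :=
  preservesFilteredColimitsOfSize_shrink.{0,u,0,u} _

lemma leg_surj (Y : ModuleCat.{u} R) (x : (localCohomology a i).obj Y) :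
    ∃ n y, leg a i Y n y = x := by
  haveI := presForget R
  obtain ⟨j, y, hy⟩ := Concrete.isColimit_exists_rep _ (legColim a i Y) x
  exact ⟨j.unop.unop, y, hy⟩

lemma leg_zero (Y : ModuleCat.{u} R) {m : ℕ} (x : oldE (Qm a m) Y i) (hx : leg a i Y m x = 0) :
    ∃ n, ∃ h : m ≤ n,
      (((_root_.Ext R (ModuleCat.{u} R) i).map (tr a h).op).app Y).hom x = 0 := by
  haveI := presForget R
  obtain ⟨k, f, g, hfg⟩ := Concrete.isColimit_exists_of_rep_eq _ (legColim a i Y)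
    (i := op (op m)) (j := op (op m)) x (0 : oldE (Qm a m) Y i)
    (hx.trans (LinearMap.map_zero (leg a i Y m)).symm)
  refine ⟨k.unop.unop, leOfHom f.unop.unop, ?_⟩
  refine Eq.trans hfg ?_
  exact LinearMap.map_zero (((Dg a i).map g).app Y).hom

/-- comparison -/
def toLC (M : Type u) [AddCommGroup M] [Module R M] :
    H a i M →ₗ[R] (localCohomology a i).obj (ModuleCat.of R M) :=
  liftE a i (fun n => leg a i _ n ∘ₗ (oldNew (Qm a n) (ModuleCat.of R M) i).symm.toLinearMap) (by
    intro m n h x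
    obtain ⟨y, rfl⟩ := (oldNew (Qm a m) (ModuleCat.of R M) i).surjective x
    rw [trE_apply, ← oldNew_natural]
    simp only [LinearMap.comp_apply, LinearEquiv.coe_coe, LinearEquiv.symm_apply_apply]
    exact leg_tr a i _ h y)

lemma toLC_bij (M : Type u) [AddCommGroup M] [Module R M] :
    Function.Bijective (toLC a i M) := by
  constructor
  · rw [injective_iff_map_eq_zero]
    intro x hx
    obtain ⟨n, y, rfl⟩ := ofE_surj a i x
    obtain ⟨y, rfl⟩ := (oldNew (Qm a n) (ModuleCat.of R M) i).surjective y
    rw [toLC, liftE_ofE] at hx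
    simp only [LinearMap.comp_apply, LinearEquiv.coe_coe, LinearEquiv.symm_apply_apply] at hx
    obtain ⟨m, h, hm⟩ := leg_zero a i _ y hx
    rw [← ofE_trE a i h, trE_apply, ← oldNew_natural, hm, LinearEquiv.map_zero,
      LinearMap.map_zero]
  · intro x
    obtain ⟨n, y, rfl⟩ := leg_surj a i _ x
    refine ⟨ofE a i M n (oldNew (Qm a n) (ModuleCat.of R M) i y), ?_⟩
    rw [toLC, liftE_ofE]
    simp only [LinearMap.comp_apply, LinearEquiv.coe_coe, LinearEquiv.symm_apply_apply]

/-- local cohomology equivalence -/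
def eqLC (M : Type u) [AddCommGroup M] [Module R M] :
    H a i M ≃ₗ[R] (localCohomology a i).obj (ModuleCat.of R M) :=
  LinearEquiv.ofBijective (toLC a i M) (toLC_bij a i M)

end cmp2

end

end LCx


namespace LCx

noncomputable section

section B1

variable {R : Type u} [CommRing R] (a : Ideal R) (i : ℕ)
variable {M : Type u} [AddCommGroup M] [Module R M]
  {N : Type u} [AddCommGroup N] [Module R N]
  {P : Type u} [AddCommGroup P] [Module R P]

lemma H_tors (x : H a i M) : x ∈ gam a (H a i M) := by
  obtain ⟨n, y, rfl⟩ := ofE_surj a i x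
  refine ⟨n, fun r hr => ?_⟩
  rw [← LinearMap.map_smul]
  have h : r • 𝟙 (Qm a n) = 0 := by
    ext
    change r • (Submodule.Quotient.mk 1 : R ⧸ a ^ n) = 0
    rw [← Submodule.Quotient.mk_smul, Submodule.Quotient.mk_eq_zero]
    simpa using hr
  have h2 : r • y = 0 := by
    have := Abelian.Ext.mk₀_id_comp y
    rw [← this, ← Abelian.Ext.smul_comp, ← Abelian.Ext.mk₀_smul, h, Abelian.Ext.mk₀_zero,
      Abelian.Ext.zero_comp]
  rw [h2, LinearMap.map_zero]

lemma map_bij_of_equiv (e : M ≃ₗ[R] N) : Function.Bijective (map a i e.toLinearMap) := by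
  have h1 : (map a i e.symm.toLinearMap) ∘ₗ (map a i e.toLinearMap) = LinearMap.id := by
    rw [← map_comp, ← map_id]; congr 1; ext; simp
  have h2 : (map a i e.toLinearMap) ∘ₗ (map a i e.symm.toLinearMap) = LinearMap.id := by
    rw [← map_comp, ← map_id]; congr 1; ext; simp
  exact Function.bijective_iff_has_inverse.2 ⟨map a i e.symm.toLinearMap,
    fun x => LinearMap.congr_fun h1 x, fun x => LinearMap.congr_fun h2 x⟩

/-- functoriality on equivalences -/
def mapEquiv (e : M ≃ₗ[R] N) : H a i M ≃ₗ[R] H a i N :=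
  LinearEquiv.ofBijective _ (map_bij_of_equiv a i e)

lemma map_zero' : map a i (0 : M →ₗ[R] N) = 0 := by
  have := map_smul a i (0 : R) (0 : M →ₗ[R] N)
  simpa using this

lemma H_sub_of_sub [Subsingleton M] : Subsingleton (H a i M) := by
  have h : (LinearMap.id : M →ₗ[R] M) = 0 := by ext x; exact Subsingleton.elim _ _
  have h2 := map_id a i (M := M)
  rw [h, map_zero'] at h2
  refine ⟨fun x y => ?_⟩
  have hx := LinearMap.congr_fun h2 x
  have hy := LinearMap.congr_fun h2 y
  simp only [LinearMap.zero_apply, LinearMap.id_apply] at hx hy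
  rw [← hx, ← hy]

section ses
variable {f : M →ₗ[R] N} {g : N →ₗ[R] P}

lemma ses_mid (hf : Function.Injective f) (hfg : Function.Exact f g)
    (hg : Function.Surjective g) (h1 : Subsingleton (H a i M)) (h2 : Subsingleton (H a i P)) :
    Subsingleton (H a i N) := by
  refine subsingleton_of_forall_eq 0 fun x => ?_
  obtain ⟨y, rfl⟩ := (exact_mid a i hf hfg hg x).1 (Subsingleton.elim _ _)
  rw [Subsingleton.elim y 0, LinearMap.map_zero]

lemma ses_surj (hf : Function.Injective f) (hfg : Function.Exact f g)
    (hg : Function.Surjective g) (h : Subsingleton (H a (i+1) M)) : Function.Surjective (map a i g) := by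
  intro x
  exact (exact_del a i hf hfg hg x).1 (Subsingleton.elim _ _)

lemma ses_right (hf : Function.Injective f) (hfg : Function.Exact f g)
    (hg : Function.Surjective g) (h : Subsingleton (H a (i+1) M)) (h2 : Subsingleton (H a i N)) :
    Subsingleton (H a i P) :=
  (ses_surj a i hf hfg hg h).subsingleton

lemma ses_inj (hf : Function.Injective f) (hfg : Function.Exact f g)
    (hg : Function.Surjective g) (h : Subsingleton (H a i P)) : Function.Injective (map a (i+1) f) := by
  rw [injective_iff_map_eq_zero]
  intro x hx
  obtain ⟨y, rfl⟩ := (exact_del' a i hf hfg hg x).1 hx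
  rw [Subsingleton.elim y 0, LinearMap.map_zero]

lemma ses_del_surj (hf : Function.Injective f) (hfg : Function.Exact f g)
    (hg : Function.Surjective g) (h : Subsingleton (H a (i+1) N)) : Function.Surjective (del a i hf hfg hg) := by
  intro x
  exact (exact_del' a i hf hfg hg x).1 (Subsingleton.elim _ _)

lemma ses_del_inj (hf : Function.Injective f) (hfg : Function.Exact f g)
    (hg : Function.Surjective g) (h : Subsingleton (H a i N)) : Function.Injective (del a i hf hfg hg) := by
  rw [injective_iff_map_eq_zero]
  intro x hx
  obtain ⟨y, rfl⟩ := (exact_del a i hf hfg hg x).1 hx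
  rw [Subsingleton.elim y 0, LinearMap.map_zero]

lemma ses_map_surj_mid (hf : Function.Injective f) (hfg : Function.Exact f g)
    (hg : Function.Surjective g) (h : Subsingleton (H a i P)) : Function.Surjective (map a i f) := by
  intro x
  exact (exact_mid a i hf hfg hg x).1 (Subsingleton.elim _ _)

end ses

lemma exact_sub_mkQ (K : Submodule R M) : Function.Exact K.subtype K.mkQ := by
  intro x
  simp

variable (R M) in
lemma exists_inj : ∃ (I : Type u) (_ : AddCommGroup I) (_ : Module R I),
    Module.Injective R I ∧ ∃ f : M →ₗ[R] I, Function.Injective f := by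
  obtain ⟨⟨J⟩⟩ := EnoughInjectives.presentation (ModuleCat.of R M)
  rename_i hJ f hf
  have : Injective (ModuleCat.of R J) := hJ
  exact ⟨J, _, _, Module.injective_module_of_injective_object R J, f.hom,
    (ModuleCat.mono_iff_injective f).1 hf⟩

lemma gam_eq_top_iff : gam a M = ⊤ ↔ ∀ m : M, ∃ n, ∀ r ∈ a ^ n, r • m = 0 := by
  rw [Submodule.eq_top_iff']; rfl

lemma gam_gam : gam a (gam a M) = ⊤ := by
  rw [gam_eq_top_iff]
  rintro ⟨m, n, hn⟩
  exact ⟨n, fun r hr => Subtype.ext (hn r hr)⟩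

lemma gam_top_of_surj (g : M →ₗ[R] N) (hg : Function.Surjective g) (h : gam a M = ⊤) :
    gam a N = ⊤ := by
  rw [gam_eq_top_iff] at h ⊢
  intro m
  obtain ⟨m, rfl⟩ := hg m
  obtain ⟨n, hn⟩ := h m
  exact ⟨n, fun r hr => by rw [← g.map_smul, hn r hr, g.map_zero]⟩

lemma ev0_surj_of_gam (h : gam a M = ⊤) : Function.Surjective (ev0 a M) := by
  rw [← LinearMap.range_eq_top, ev0_range, h]

variable [IsNoetherianRing R]

lemma gam_killed_of_fg [Module.Finite R M] (h : gam a M = ⊤) : ∃ n, ∀ r ∈ a ^ n, ∀ m : M,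
    r • m = 0 := by
  obtain ⟨s, hs⟩ := Module.Finite.fg_top (R := R) (M := M)
  rw [gam_eq_top_iff] at h
  choose n hn using h
  refine ⟨s.sup n, fun r hr => ?_⟩
  intro m
  have hm : m ∈ Submodule.span R (s : Set M) := by rw [hs]; trivial
  induction hm using Submodule.span_induction with
  | mem x hx => exact hn x r (Ideal.pow_le_pow_right (Finset.le_sup hx) hr)
  | zero => simp
  | add x y _ _ hx hy => rw [smul_add, hx, hy, add_zero]
  | smul c x _ hx => rw [smul_comm, hx, smul_zero]

lemma gam_injective (I : Type u) [AddCommGroup I] [Module R I] [Module.Injective R I] :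
    Module.Injective R (gam a I) := by
  apply Module.Baer.injective
  intro J g
  have hJ : Module.Finite R J := inferInstance
  have hr : gam a (LinearMap.range g) = ⊤ := by
    rw [gam_eq_top_iff]
    rintro ⟨⟨m, n, hn⟩, h⟩
    exact ⟨n, fun r hr => Subtype.ext (Subtype.ext (hn r hr))⟩
  obtain ⟨k, hk⟩ := gam_killed_of_fg a hr
  obtain ⟨c, hc⟩ := Ideal.exists_pow_inf_eq_pow_smul a J
  have hc' := hc (c + k) (by omega)
  rw [Nat.add_sub_cancel_left] at hc'
  let n := c + k
  let φ : J →ₗ[R] (R ⧸ a ^ n) := (a ^ n).mkQ ∘ₗ J.subtype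
  have key : LinearMap.ker φ ≤ LinearMap.ker g := by
    rintro ⟨x, hx⟩ hxk
    have h1 : x ∈ a ^ n := by
      simpa [φ, Submodule.Quotient.mk_eq_zero, Ideal.Quotient.eq_zero_iff_mem] using hxk
    have h2 : x ∈ a ^ (c + k) • (⊤ : Submodule R R) ⊓ J := by
      refine ⟨?_, hx⟩
      simpa using h1
    rw [hc'] at h2
    have h3 : x ∈ a ^ k • J := Submodule.smul_mono le_rfl inf_le_right h2
    have h4 : ∀ y ∈ a ^ k • J, ∃ hy : y ∈ J, g ⟨y, hy⟩ = 0 := by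
      intro y hy
      refine Submodule.smul_induction_on hy ?_ ?_
      · intro r hr m hm
        refine ⟨J.smul_mem r hm, ?_⟩
        have := hk r hr ⟨g ⟨m, hm⟩, ⟨_, rfl⟩⟩
        have h5 := congrArg Subtype.val this
        simp only [Submodule.coe_smul, Submodule.coe_zero] at h5
        rw [← g.map_smul] at h5
        exact h5
      · rintro y z ⟨h1, h1'⟩ ⟨h2, h2'⟩
        refine ⟨J.add_mem h1 h2, ?_⟩
        have := g.map_add ⟨y, h1⟩ ⟨z, h2⟩
        rw [h1', h2', add_zero] at this
        exact this
    exact (h4 x h3).2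
  let f' : (J ⧸ LinearMap.ker φ) →ₗ[R] (R ⧸ a ^ n) := (LinearMap.ker φ).liftQ φ le_rfl
  let g' : (J ⧸ LinearMap.ker φ) →ₗ[R] I := (gam a I).subtype ∘ₗ (LinearMap.ker φ).liftQ g key
  have hf' : Function.Injective f' := by
    rw [← LinearMap.ker_eq_bot]; exact Submodule.ker_liftQ_eq_bot _ _ _ le_rfl
  obtain ⟨h, hh⟩ := Module.Injective.out f' hf' g'
  refine ⟨LinearMap.codRestrict (gam a I) (h ∘ₗ (a ^ n).mkQ) ?_, ?_⟩
  · intro x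
    refine ⟨n, fun r hr => ?_⟩
    rw [← LinearMap.map_smul]
    have : (a ^ n).mkQ (r • x) = 0 := by
      rw [Submodule.mkQ_apply, Submodule.Quotient.mk_eq_zero]
      exact Ideal.mul_mem_right x _ hr
    rw [LinearMap.comp_apply, this, LinearMap.map_zero]
  · intro x hx
    apply Subtype.ext
    exact hh (Submodule.Quotient.mk ⟨x, hx⟩)

lemma H_of_tors (h : gam a M = ⊤) : Subsingleton (H a (i+1) M) := by
  induction i generalizing M with
  | zero =>
    obtain ⟨I, _, _, _, f, hf⟩ := exists_inj R M
    have := gam_injective a I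
    let f' : M →ₗ[R] gam a I := f.codRestrict _ (by
      intro m
      obtain ⟨n, hn⟩ := (gam_eq_top_iff a).1 h m
      exact ⟨n, fun r hr => by rw [← f.map_smul, hn r hr, f.map_zero]⟩)
    have hf' : Function.Injective f' := fun x y hxy => hf (congrArg Subtype.val hxy)
    let g := (LinearMap.range f').mkQ
    have hg : Function.Surjective g := Submodule.mkQ_surjective _
    have hfg : Function.Exact f' g := LinearMap.exact_map_mkQ_range f'
    have h1 : Subsingleton (H a (0+1) (gam a I)) := H_injective a 0
    refine subsingleton_of_forall_eq 0 fun x => ?_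
    obtain ⟨y, rfl⟩ := (exact_del' a 0 hf' hfg hg x).1 (Subsingleton.elim _ _)
    apply (exact_del a 0 hf' hfg hg y).2
    obtain ⟨z, hz⟩ := hg (ev0 a _ y)
    obtain ⟨w, hw⟩ := ev0_surj_of_gam a (gam_gam a (M := I)) z
    refine ⟨w, ev0_injective a ?_⟩
    rw [ev0_map, hw, hz]
  | succ i ih =>
    obtain ⟨I, _, _, _, f, hf⟩ := exists_inj R M
    have := gam_injective a I
    let f' : M →ₗ[R] gam a I := f.codRestrict _ (by
      intro m
      obtain ⟨n, hn⟩ := (gam_eq_top_iff a).1 h m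
      exact ⟨n, fun r hr => by rw [← f.map_smul, hn r hr, f.map_zero]⟩)
    have hf' : Function.Injective f' := fun x y hxy => hf (congrArg Subtype.val hxy)
    let g := (LinearMap.range f').mkQ
    have hg : Function.Surjective g := Submodule.mkQ_surjective _
    have hfg : Function.Exact f' g := LinearMap.exact_map_mkQ_range f'
    have h1 : Subsingleton (H a (i+1+1) (gam a I)) := H_injective a _
    have := ih (gam_top_of_surj a g hg (gam_gam a))
    exact (ses_del_surj a (i+1) hf' hfg hg h1).subsingleton

lemma map_mkQ_gam_bij :
    Function.Bijective (map a (i+1) (gam a M).mkQ) := by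
  have hf := (gam a M).injective_subtype
  have hg := (gam a M).mkQ_surjective
  have hfg := exact_sub_mkQ (gam a M)
  have h1 := H_of_tors a i (gam_gam a (M := M))
  have h2 := H_of_tors a (i+1) (gam_gam a (M := M))
  refine ⟨?_, ses_surj a _ hf hfg hg h2⟩
  rw [injective_iff_map_eq_zero]
  intro x hx
  obtain ⟨y, rfl⟩ := (exact_mid a (i+1) hf hfg hg x).1 hx
  rw [Subsingleton.elim y 0, LinearMap.map_zero]

lemma gam_quot : gam a (M ⧸ gam a M) = ⊥ := by
  rw [eq_bot_iff]
  rintro x ⟨n, hn⟩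
  obtain ⟨x, rfl⟩ := Submodule.mkQ_surjective _ x
  have hfg : (a ^ n).FG := IsNoetherian.noetherian _
  obtain ⟨s, hs⟩ := hfg
  have h1 : ∀ r ∈ a ^ n, ∃ k, ∀ t ∈ a ^ k, t • (r • x) = 0 := by
    intro r hr
    have := hn r hr
    rw [← LinearMap.map_smul, Submodule.mkQ_apply, Submodule.Quotient.mk_eq_zero] at this
    exact this
  choose! k hk using h1
  have hx : x ∈ gam a M := by
    refine ⟨n + s.sup k, fun r hr => ?_⟩
    rw [pow_add] at hr
    refine Submodule.mul_induction_on hr ?_ ?_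
    · intro r hr t ht
      rw [← hs] at hr
      induction hr using Submodule.span_induction with
      | mem y hy =>
        rw [mul_comm, mul_smul]
        exact hk y (hs ▸ Submodule.subset_span hy) t
          (Ideal.pow_le_pow_right (Finset.le_sup hy) ht)
      | zero => simp
      | add y z _ _ h1 h2 => rw [add_mul, add_smul, h1, h2, add_zero]
      | smul c y _ h1 => rw [smul_eq_mul, mul_assoc, mul_smul, h1, smul_zero]
    · intro y z h1 h2
      rw [add_smul, h1, h2, add_zero]
  rw [Submodule.mem_bot, Submodule.mkQ_apply, Submodule.Quotient.mk_eq_zero]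
  exact hx

end B1

end

end LCx


namespace LCx

noncomputable section

open scoped Pointwise

section B2

variable {R : Type u} [CommRing R] (a : Ideal R) (i : ℕ)
variable {M : Type u} [AddCommGroup M] [Module R M]
  {N : Type u} [AddCommGroup N] [Module R N]
  {P : Type u} [AddCommGroup P] [Module R P]

lemma reg_exists [IsNoetherianRing R] [Module.Finite R M] (h : gam a M = ⊥) :
    ∃ x ∈ a, IsSMulRegular M x := by
  have h1 : Subsingleton ((R ⧸ a) →ₗ[R] M) := by
    refine subsingleton_of_forall_eq 0 fun f => ?_
    ext
    have : f (Submodule.Quotient.mk 1) ∈ gam a M := by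
      refine ⟨1, fun r hr => ?_⟩
      rw [pow_one] at hr
      rw [← f.map_smul, ← Submodule.Quotient.mk_smul]
      have : (Submodule.Quotient.mk (r • 1) : R ⧸ a) = 0 := by
        rw [Submodule.Quotient.mk_eq_zero]; simpa using hr
      rw [this, f.map_zero]
    rw [h] at this
    exact this
  obtain ⟨x, hx, hx'⟩ := IsSMulRegular.subsingleton_linearMap_iff.1 h1
  rw [Ideal.annihilator_quotient] at hx
  exact ⟨x, hx, hx'⟩

abbrev mulx (M : Type u) [AddCommGroup M] [Module R M] (x : R) : M →ₗ[R] M :=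
  x • LinearMap.id

lemma mulx_inj {x : R} (hx : IsSMulRegular M x) : Function.Injective (mulx M x) := hx

lemma mulx_exact (x : R) : Function.Exact (mulx M x) (x • (⊤ : Submodule R M)).mkQ := by
  intro y
  rw [Submodule.mkQ_apply, Submodule.Quotient.mk_eq_zero, Submodule.mem_smul_pointwise_iff_exists]
  simp

lemma map_mulx (x : R) (z : H a i M) : map a i (mulx M x) z = x • z := by
  rw [mulx, map_smul, map_id]; rfl

/-- kernel of x on torsion -/
lemma tors_inj {x : R} (hx : x ∈ a) (h : gam a M = ⊤) (hi : ∀ m : M, x • m = 0 → m = 0) :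
    Subsingleton M := by
  refine subsingleton_of_forall_eq 0 fun m => ?_
  obtain ⟨n, hn⟩ := (gam_eq_top_iff a).1 h m
  have := hn _ (Ideal.pow_mem_pow hx n)
  clear hn
  induction n with
  | zero => simpa using this
  | succ n ih =>
    apply ih
    apply hi
    rwa [smul_smul, ← pow_succ']

lemma gam_H : gam a (H a i M) = ⊤ := by
  rw [Submodule.eq_top_iff']; exact H_tors a i

lemma H_top : Subsingleton (H (⊤ : Ideal R) i M) := by
  refine subsingleton_of_forall_eq 0 fun m => ?_
  obtain ⟨n, hn⟩ := H_tors _ i m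
  simpa using hn 1 (by rw [Ideal.top_pow]; trivial)

variable [IsNoetherianRing R]

theorem H_vanish [IsLocalRing R] [Module.Finite R M] (n : ℕ)
    (hM : Module.supportDim R M < (n : WithBot ℕ∞)) (hi : n ≤ i) : Subsingleton (H a i M) := by
  by_cases ha : a = ⊤
  · subst ha; exact H_top i
  have ham : a ≤ IsLocalRing.maximalIdeal R := IsLocalRing.le_maximalIdeal ha
  induction n generalizing M i with
  | zero =>
    have : Subsingleton M := by
      rw [← Module.supportDim_eq_bot_iff_subsingleton R]
      by_contra hb
      obtain ⟨k, hk⟩ := WithBot.ne_bot_iff_exists.1 hb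
      rw [← hk] at hM
      have : (k : WithBot ℕ∞) < ((0 : ℕ∞) : WithBot ℕ∞) := hM
      rw [WithBot.coe_lt_coe] at this
      exact absurd this (by simp)
    exact H_sub_of_sub a i
  | succ n ih =>
    obtain ⟨i, rfl⟩ : ∃ j, i = j + 1 := ⟨i - 1, by omega⟩
    let M' := M ⧸ gam a M
    suffices Subsingleton (H a (i+1) M') from (map_mkQ_gam_bij a i (M := M)).1.subsingleton
    have hM' : Module.supportDim R M' < ((n + 1 : ℕ) : WithBot ℕ∞) :=
      lt_of_le_of_lt (Module.supportDim_le_of_surjective _ (gam a M).mkQ_surjective) hM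
    obtain ⟨x, hx, hreg⟩ := reg_exists a (gam_quot a (M := M))
    have h1 := Module.supportDim_quotSMulTop_succ_eq_supportDim hreg (ham hx)
    have h2 : Module.supportDim R (QuotSMulTop x M') < (n : WithBot ℕ∞) := by
      by_contra hc
      push Not at hc
      have : ((n + 1 : ℕ) : WithBot ℕ∞) ≤ Module.supportDim R M' := by
        rw [← h1]; push_cast; gcongr
      exact absurd hM' (not_lt.2 this)
    have h3 := ih i h2 (by omega)
    have h4 := ses_inj a i (mulx_inj hreg) (mulx_exact x) (Submodule.mkQ_surjective _) h3
    refine tors_inj a hx (gam_H a (i+1)) fun m hm => ?_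
    apply h4
    rw [map_mulx, hm, LinearMap.map_zero]

/-- P9 : every element comes from a finite submodule -/
theorem H_fg_elt (x : H a i M) : ∃ K : Submodule R M, K.FG ∧ ∃ y : H a i K,
    map a i K.subtype y = x := by
  induction i generalizing M with
  | zero =>
    have h1 : ev0 a M x ∈ gam a M := by rw [← ev0_range]; exact ⟨x, rfl⟩
    let K := Submodule.span R {ev0 a M x}
    have h2 : (⟨ev0 a M x, Submodule.mem_span_singleton_self _⟩ : K) ∈ gam a K := by
      obtain ⟨n, hn⟩ := h1
      exact ⟨n, fun r hr => Subtype.ext (hn r hr)⟩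
    rw [← ev0_range] at h2
    obtain ⟨y, hy⟩ := h2
    refine ⟨K, ⟨{ev0 a M x}, by simp [K]⟩, y, ev0_injective a ?_⟩
    rw [ev0_map, hy]; rfl
  | succ i ih =>
    obtain ⟨I, _, _, _, f, hf⟩ := exists_inj R M
    let g := (LinearMap.range f).mkQ
    have hg : Function.Surjective g := Submodule.mkQ_surjective _
    have hfg : Function.Exact f g := LinearMap.exact_map_mkQ_range f
    have h1 : Subsingleton (H a (i+1) I) := H_injective a i
    obtain ⟨y, rfl⟩ := ses_del_surj a i hf hfg hg h1 x
    obtain ⟨L, hL, z, rfl⟩ := ih y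
    obtain ⟨s, rfl⟩ := hL
    have hg2 := hg
    choose w hw using hg2
    classical
    -- lift of L to I
    let L' : Submodule R I := Submodule.span R ((s.image w : Finset I) : Set I)
    have hL'g : L'.map g = Submodule.span R (s : Set (I ⧸ LinearMap.range f)) := by
      rw [Submodule.map_span]
      congr 1
      ext t
      simp only [Finset.coe_image, Set.mem_image, exists_exists_and_eq_and]
      constructor
      · rintro ⟨t, ht, rfl⟩; rw [hw]; exact ht
      · intro ht; exact ⟨t, ht, hw t⟩
    have hL'fg : L'.FG := ⟨_, rfl⟩
    let K : Submodule R M := L'.comap f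
    have hKfg : K.FG := by
      have : IsNoetherian R L' := isNoetherian_of_fg_of_noetherian _ hL'fg
      have h3 : IsNoetherian R K := by
        refine isNoetherian_of_injective (f.restrict (p := K) (q := L') (fun m hm => hm)) ?_
        intro u v huv
        exact Subtype.ext (hf (congrArg Subtype.val huv))
      exact (Submodule.fg_top K).1 (h3.noetherian ⊤)
    let f' : K →ₗ[R] L' := f.restrict (fun m hm => hm)
    let g' : L' →ₗ[R] Submodule.span R (s : Set (I ⧸ LinearMap.range f)) :=
      g.restrict (fun m hm => hL'g ▸ Submodule.mem_map_of_mem hm)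
    have hf' : Function.Injective f' := fun u v huv => Subtype.ext (hf (congrArg Subtype.val huv))
    have hg' : Function.Surjective g' := by
      rintro ⟨t, ht⟩
      rw [← hL'g] at ht
      obtain ⟨t', ht', rfl⟩ := ht
      exact ⟨⟨t', ht'⟩, rfl⟩
    have hfg' : Function.Exact f' g' := by
      rintro ⟨t, ht⟩
      rw [Subtype.ext_iff]
      refine (hfg t).trans ?_
      constructor
      · rintro ⟨m, rfl⟩; exact ⟨⟨m, ht⟩, rfl⟩
      · rintro ⟨m, hm⟩; exact ⟨m.1, congrArg Subtype.val hm⟩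
    refine ⟨K, hKfg, del a i hf' hfg' hg' z, ?_⟩
    exact del_natural a i hf' hfg' hg' hf hfg (Submodule.mkQ_surjective _) K.subtype L'.subtype
      (Submodule.subtype _) rfl rfl z

theorem H_vanish_top [IsLocalRing R] (d : ℕ) (hd : ringKrullDim R ≤ (d : WithBot ℕ∞))
    (hi : d < i) : Subsingleton (H a i M) := by
  refine subsingleton_of_forall_eq 0 fun x => ?_
  obtain ⟨K, hK, y, rfl⟩ := H_fg_elt a i x
  have : Module.Finite R K := Module.Finite.iff_fg.2 hK
  have := H_vanish a i (M := K) (d+1) (lt_of_le_of_lt ((Module.supportDim_le_ringKrullDim R K).trans hd)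
    (by exact_mod_cast Nat.lt_succ_self d)) (by omega)
  rw [Subsingleton.elim y 0, LinearMap.map_zero]

end B2

end

end LCx


namespace LCx

noncomputable section

open scoped Pointwise

open TensorProduct

section B3

variable {R : Type u} [CommRing R] (a : Ideal R) (i : ℕ)
variable {M : Type u} [AddCommGroup M] [Module R M]
  {N : Type u} [AddCommGroup N] [Module R N]
  {P : Type u} [AddCommGroup P] [Module R P]

/-- theta as bilinear -/
def thB (M : Type u) [AddCommGroup M] [Module R M] : M →ₗ[R] H a i R →ₗ[R] H a i M :=
  LinearMap.mk₂ R (fun m y => map a i (LinearMap.toSpanSingleton R M m) y)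
    (fun m m' y => by rw [LinearMap.toSpanSingleton_add, map_add]; rfl)
    (fun c m y => by rw [LinearMap.toSpanSingleton_smul, map_smul]; rfl)
    (fun m y y' => LinearMap.map_add _ _ _)
    (fun c m y => LinearMap.map_smul _ _ _)

/-- theta -/
def th (M : Type u) [AddCommGroup M] [Module R M] : M ⊗[R] H a i R →ₗ[R] H a i M :=
  TensorProduct.lift (thB a i M)

lemma th_tmul (m : M) (y : H a i R) :
    th a i M (m ⊗ₜ y) = map a i (LinearMap.toSpanSingleton R M m) y := rfl

lemma th_nat (f : M →ₗ[R] N) (t : M ⊗[R] H a i R) :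
    th a i N (f.rTensor _ t) = map a i f (th a i M t) := by
  induction t with
  | zero => simp
  | add x y hx hy => rw [LinearMap.map_add, LinearMap.map_add, hx, hy, LinearMap.map_add,
      LinearMap.map_add]
  | tmul m y =>
    rw [LinearMap.rTensor_tmul, th_tmul, th_tmul, ← LinearMap.comp_apply, ← map_comp]
    congr 2
    ext; simp

lemma map_sum {ι : Type*} (s : Finset ι) (f : ι → M →ₗ[R] N) :
    map a i (∑ k ∈ s, f k) = ∑ k ∈ s, map a i (f k) := by
  classical
  induction s using Finset.induction_on with
  | empty => simp [map_zero']
  | insert k s hk ih => rw [Finset.sum_insert hk, Finset.sum_insert hk, map_add, ih]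

lemma th_fin_surj (n : ℕ) : Function.Surjective (th a i (Fin n → R)) := by
  intro x
  refine ⟨∑ k, (Pi.single k 1 : Fin n → R) ⊗ₜ map a i (LinearMap.proj k) x, ?_⟩
  rw [_root_.map_sum]
  have : (LinearMap.id : (Fin n → R) →ₗ[R] (Fin n → R)) =
      ∑ k, LinearMap.toSpanSingleton R (Fin n → R) (Pi.single k 1) ∘ₗ LinearMap.proj k := by
    apply LinearMap.ext
    intro v
    ext j
    simp [LinearMap.sum_apply, Finset.sum_apply, Pi.single_apply]
  conv_rhs => rw [← LinearMap.id_apply (R := R) x, ← map_id, this, map_sum]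
  simp only [LinearMap.sum_apply, th_tmul, map_comp, LinearMap.comp_apply]

lemma th_finsupp_inj (ι : Type u) : Function.Injective (th a i (ι →₀ R)) := by
  classical
  rw [injective_iff_map_eq_zero]
  intro t ht
  have key : ∀ (t : (ι →₀ R) ⊗[R] H a i R) (k : ι),
      TensorProduct.finsuppScalarLeft R (H a i R) ι t k =
      map a i (Finsupp.lapply k) (th a i _ t) := by
    intro t k
    induction t with
    | zero => simp
    | add x y hx hy => simp only [LinearEquiv.map_add, LinearMap.map_add, Finsupp.add_apply, hx, hy]
    | tmul m y =>
      rw [TensorProduct.finsuppScalarLeft_apply_tmul_apply, th_tmul, ← LinearMap.comp_apply, ← map_comp]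
      have : (Finsupp.lapply k ∘ₗ LinearMap.toSpanSingleton R (ι →₀ R) m : R →ₗ[R] R) =
        m k • LinearMap.id := by ext; simp
      rw [this, map_smul, map_id]; rfl
  apply (TensorProduct.finsuppScalarLeft R (H a i R) ι).injective
  rw [LinearEquiv.map_zero]
  ext k
  rw [key, ht, LinearMap.map_zero, Finsupp.zero_apply]

variable [IsNoetherianRing R] [IsLocalRing R] (d : ℕ)

lemma top_surj (hd : ringKrullDim R ≤ (d : WithBot ℕ∞)) (g : M →ₗ[R] N) (hg : Function.Surjective g) :
    Function.Surjective (map a d g) := by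
  have h : Function.Exact (LinearMap.ker g).subtype g := by
    intro x; simp
  exact ses_surj a d (Submodule.injective_subtype _) h hg (H_vanish_top a (d+1) d hd (by omega))

lemma th_surj (hd : ringKrullDim R ≤ (d : WithBot ℕ∞)) : Function.Surjective (th a d M) := by
  intro x
  obtain ⟨K, hK, y, rfl⟩ := H_fg_elt a d x
  have : Module.Finite R K := Module.Finite.iff_fg.2 hK
  obtain ⟨n, f, hf⟩ := Module.Finite.exists_fin' R K
  obtain ⟨z, rfl⟩ := top_surj a d hd f hf y
  obtain ⟨t, rfl⟩ := th_fin_surj a d n z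
  exact ⟨(K.subtype).rTensor _ (f.rTensor _ t), by rw [th_nat, th_nat]⟩

lemma th_bij (hd : ringKrullDim R ≤ (d : WithBot ℕ∞)) : Function.Bijective (th a d M) := by
  refine ⟨?_, th_surj a d hd⟩
  rw [injective_iff_map_eq_zero]
  intro t ht
  let g := Finsupp.linearCombination R (id : M → M)
  have hg : Function.Surjective g := Finsupp.linearCombination_id_surjective R M
  have h : Function.Exact (LinearMap.ker g).subtype g := by
    intro x; simp
  obtain ⟨t', rfl⟩ := LinearMap.rTensor_surjective (H a d R) hg t
  rw [th_nat] at ht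
  obtain ⟨y, hy⟩ := (exact_mid a d (Submodule.injective_subtype _) h hg _).1 ht
  obtain ⟨v, rfl⟩ := th_surj a d hd y
  rw [← th_nat] at hy
  have := th_finsupp_inj a d M hy
  rw [← this, ← LinearMap.comp_apply, ← LinearMap.rTensor_comp]
  have h0 : g ∘ₗ (LinearMap.ker g).subtype = 0 := by
    ext x; simp
  rw [h0, LinearMap.rTensor_zero, LinearMap.zero_apply]

/-- Annihilators -/
lemma top_ann (hd : ringKrullDim R ≤ (d : WithBot ℕ∞)) {r : R} (h : ∀ y : H a d R, r • y = 0) (x : H a d M) : r • x = 0 := by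
  obtain ⟨t, rfl⟩ := th_surj a d hd x
  induction t with
  | zero => simp
  | add x y hx hy => rw [LinearMap.map_add, smul_add, hx, hy, add_zero]
  | tmul m y => rw [th_tmul, ← LinearMap.map_smul, h, LinearMap.map_zero]

/-- nonvanishing of H(S ⊗ M) -/
lemma top_ff (hd : ringKrullDim R ≤ (d : WithBot ℕ∞)) (S : Type u) [CommRing S] [Algebra R S] [Module.FaithfullyFlat R S]
    (h : Subsingleton (H a d (S ⊗[R] M))) : Subsingleton (H a d M) := by
  have h1 : Subsingleton ((S ⊗[R] M) ⊗[R] H a d R) := (th_bij a d hd).1.subsingleton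
  have h2 : Subsingleton (S ⊗[R] (M ⊗[R] H a d R)) :=
    (TensorProduct.assoc R S M (H a d R)).symm.injective.subsingleton
  have h3 : Subsingleton (M ⊗[R] H a d R) := by
    by_contra hc
    rw [not_subsingleton_iff_nontrivial] at hc
    have := Module.FaithfullyFlat.lTensor_nontrivial R S (M ⊗[R] H a d R)
    exact not_subsingleton _ h2
  exact (th_surj a d hd).subsingleton

/-- if Q kills H^d(J) then H^d(J) → H^d(J/QJ) injective -/
lemma top_quot_inj (hd : ringKrullDim R ≤ (d : WithBot ℕ∞)) (Q : Ideal R) (h : ∀ r ∈ Q, ∀ x : H a d M, r • x = 0) :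
    Function.Injective (map a d (Q • (⊤ : Submodule R M)).mkQ) := by
  rw [injective_iff_map_eq_zero]
  intro x hx
  obtain ⟨y, rfl⟩ := (exact_mid a d (Submodule.injective_subtype _) (exact_sub_mkQ _)
    (Submodule.mkQ_surjective _) _).1 hx
  obtain ⟨t, rfl⟩ := th_surj a d hd y
  rw [← th_nat]
  clear hx
  have key : ∀ m ∈ Q • (⊤ : Submodule R M), ∀ y, thB a d M m y = 0 := by
    intro m hm y
    refine Submodule.smul_induction_on hm ?_ ?_
    · intro r hr m _
      rw [LinearMap.map_smul, LinearMap.smul_apply, h r hr]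
    · intro m m' h1 h2
      rw [LinearMap.map_add, LinearMap.add_apply, h1, h2, add_zero]
  induction t with
  | zero => simp
  | add x y hx hy => rw [LinearMap.map_add, LinearMap.map_add, hx, hy, add_zero]
  | tmul m y =>
    rw [LinearMap.rTensor_tmul]
    exact key m.1 m.2 y

end B3

end

end LCx


namespace LCx

noncomputable section

section C1

variable {R : Type u} [CommRing R]

lemma prim_reg [IsNoetherianRing R] {q p : Ideal R} (h : IsPrimarySubmodule q p) {s r : R}
    (hs : s ∉ p) (hsr : s * r ∈ q) : r ∈ q := by
  have h1 := biUnion_associatedPrimes_eq_compl_regular R (R ⧸ q)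
  unfold IsPrimarySubmodule at h
  rw [h] at h1
  have h2 : IsSMulRegular (R ⧸ q) s := by
    by_contra hc
    have : s ∈ ⋃ p' ∈ ({p} : Set (Ideal R)), (p' : Set R) := by rw [h1]; exact hc
    simp at this
    exact hs this
  rw [← Ideal.Quotient.eq_zero_iff_mem]
  apply h2
  change s • (Ideal.Quotient.mk q r) = s • 0
  rw [smul_zero, ← Ideal.Quotient.eq_zero_iff_mem.2 hsr]
  rfl

lemma prim_prime {q p : Ideal R} (h : IsPrimarySubmodule q p) : p.IsPrime := by
  have : p ∈ associatedPrimes R (R ⧸ q) := by rw [h]; rfl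
  exact this.isPrime

lemma prim_rad [IsNoetherianRing R] {q p : Ideal R} (h : IsPrimarySubmodule q p) :
    q.radical = p := by
  have hp := prim_prime h
  have hpa : p ∈ associatedPrimes R (R ⧸ q) := by rw [h]; rfl
  have hqp : q ≤ p := by
    have := hpa.annihilator_le
    rwa [Submodule.annihilator_top, Ideal.annihilator_quotient] at this
  apply le_antisymm
  · exact hp.radical_le_iff.2 hqp
  · rw [← Ideal.sInf_minimalPrimes]
    apply le_sInf
    intro J hJ
    have h2 := Module.associatedPrimes.minimalPrimes_annihilator_subset_associatedPrimes R (R ⧸ q)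
    rw [Ideal.annihilator_quotient] at h2
    have := h2 hJ
    rw [h] at this
    exact le_of_eq this.symm

variable (a : Ideal R) (i : ℕ)
variable {M : Type u} [AddCommGroup M] [Module R M]

lemma H_filt [IsNoetherianRing R] [hM : Module.Finite R M]
    (h : ∀ P ∈ Module.support R M, Subsingleton (H a i (R ⧸ P.asIdeal))) :
    Subsingleton (H a i M) := by
  revert h
  induction hM using IsNoetherianRing.induction_on_isQuotientEquivQuotientPrime R with
  | subsingleton N => intro _; exact H_sub_of_sub a i
  | quotient N p e =>
    intro h
    have := h p (by
      rw [e.support_eq, Module.support_eq_zeroLocus, Ideal.annihilator_quotient]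
      exact le_refl (α := Set R) _)
    exact (mapEquiv a i e).injective.subsingleton
  | exact N₁ N₂ N₃ f g hf hg hfg h1 h2 =>
    intro h
    exact ses_mid a i hf hfg hg (h1 fun P hP => h P (Module.support_subset_of_injective f hf hP))
      (h2 fun P hP => h P (Module.support_subset_of_surjective g hg hP))

variable [IsNoetherianRing R] [IsLocalRing R] (d : ℕ)

lemma top_quot_mono (hd : ringKrullDim R ≤ (d : WithBot ℕ∞)) {p P : Ideal R} (h : p ≤ P) (hp : Subsingleton (H a d (R ⧸ p))) :
    Subsingleton (H a d (R ⧸ P)) :=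
  (top_surj a d hd (Submodule.factor h) (Submodule.factor_surjective h)).subsingleton

/-- the easy inclusion -/
theorem easy_incl (hd : ringKrullDim R ≤ (d : WithBot ℕ∞)) (n : ℕ) (q p : Fin n → Ideal R) (hdec : (⨅ j, q j) = ⊥)
    (hrad : ∀ j, (q j).radical = p j) (r : R)
    (hr : ∀ j, ¬ Subsingleton (H a d (R ⧸ p j)) → r ∈ q j) (x : H a d R) : r • x = 0 := by
  let I : Ideal R := ⨅ j ∈ {j | ¬ Subsingleton (H a d (R ⧸ p j))}, q j
  have hI : ∀ m ∈ I, ∀ j, ¬ Subsingleton (H a d (R ⧸ p j)) → m ∈ q j := by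
    intro m hm j hj
    simp only [I, Submodule.mem_iInf] at hm
    exact hm j hj
  have hrI : r ∈ I := by
    simp only [I, Submodule.mem_iInf]
    exact hr
  have h1 : Subsingleton (H a d I) := by
    apply H_filt
    intro P hP
    rw [Module.mem_support_iff'] at hP
    obtain ⟨⟨m, hm⟩, hmP⟩ := hP
    by_contra hc
    have h2 : ∀ j, Subsingleton (H a d (R ⧸ p j)) → ∃ s, s ∉ P.asIdeal ∧ s ∈ q j := by
      intro j hj
      by_contra hc'
      push Not at hc'
      apply hc
      apply top_quot_mono a d hd (p := p j) _ hj
      rw [← hrad j]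
      refine P.2.radical_le_iff.2 fun s hs => ?_
      by_contra hsP
      exact hc' s hsP hs
    have h3 : ∀ j, ∃ s, s ∉ P.asIdeal ∧ s * m ∈ q j := by
      intro j
      by_cases hj : Subsingleton (H a d (R ⧸ p j))
      · obtain ⟨s, h1, h2⟩ := h2 j hj
        exact ⟨s, h1, Ideal.mul_mem_right _ _ h2⟩
      · exact ⟨1, P.2.one_notMem, Ideal.mul_mem_left _ _ (hI m hm j hj)⟩
    choose s hs hsm using h3
    apply hmP (∏ j, s j)
    · intro hc
      obtain ⟨j, -, hj⟩ := P.2.prod_mem_iff.1 hc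
      exact hs j hj
    · apply Subtype.ext
      have : (∏ j, s j) * m ∈ (⨅ j, q j) := by
        rw [Submodule.mem_iInf]
        intro j
        rw [← Finset.mul_prod_erase _ _ (Finset.mem_univ j), mul_comm (s j), mul_assoc]
        exact Ideal.mul_mem_left _ _ (hsm j)
      rw [hdec] at this
      exact this
  have h2 : Function.Injective (map a d I.mkQ) := by
    rw [injective_iff_map_eq_zero]
    intro x hx
    obtain ⟨y, rfl⟩ := (exact_mid a d (Submodule.injective_subtype I) (exact_sub_mkQ _)
      (Submodule.mkQ_surjective _) _).1 hx
    rw [Subsingleton.elim y 0, LinearMap.map_zero]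
  apply h2
  rw [LinearMap.map_zero, ← map_mulx, ← LinearMap.comp_apply, ← map_comp]
  have : I.mkQ ∘ₗ mulx R r = 0 := by
    ext
    simpa [Ideal.Quotient.eq_zero_iff_mem] using hrI
  rw [this, map_zero']; rfl

end C1

end

end LCx


namespace LCx

noncomputable section

open scoped Pointwise

open TensorProduct

section D1

variable {R : Type u} [CommRing R] (S : Type u) [CommRing S] [Algebra R S]

lemma inj_restrict [Module.Flat R S] (I : Type u) [AddCommGroup I] [Module R I] [Module S I]
    [IsScalarTower R S I] [Module.Injective S I] : Module.Injective R I := by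
  refine ⟨fun X Y _ _ _ _ f hf g => ?_⟩
  have h1 : Function.Injective (f.baseChange S) :=
    Module.Flat.lTensor_preserves_injective_linearMap f hf
  obtain ⟨h, hh⟩ := Module.Injective.out (f.baseChange S) h1 (g.liftBaseChange S)
  refine ⟨(h.restrictScalars R) ∘ₗ (TensorProduct.mk R S Y 1), fun x => ?_⟩
  have := hh (1 ⊗ₜ x)
  simpa using this

lemma gam_cmp (a : Ideal R) (I : Type u) [AddCommGroup I] [Module R I] [Module S I]
    [IsScalarTower R S I] (m : I) : m ∈ gam (a.map (algebraMap R S)) I ↔ m ∈ gam a I := by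
  rw [mem_gam, mem_gam]
  refine exists_congr fun n => ?_
  rw [← Ideal.map_pow]
  constructor
  · intro h r hr
    rw [← algebraMap_smul S]
    exact h _ (Ideal.mem_map_of_mem _ hr)
  · intro h r hr
    induction hr using Submodule.span_induction with
    | mem x hx =>
      obtain ⟨x, hx, rfl⟩ := hx
      rw [algebraMap_smul]
      exact h x hx
    | zero => simp
    | add x y _ _ hx hy => rw [add_smul, hx, hy, add_zero]
    | smul c x _ hx => rw [smul_eq_mul, mul_smul, hx, smul_zero]

/-- comparison of surjections -/
lemma cmp_surj {A B A' B' : Type u} [AddCommGroup A] [AddCommGroup B] [Module S A] [Module S B]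
    [AddCommGroup A'] [AddCommGroup B'] [Module R A'] [Module R B']
    (p : A →ₗ[S] B) (hp : Function.Surjective p) (p' : A' →ₗ[R] B') (hp' : Function.Surjective p')
    (e : A ≃+ A') (he : ∀ (r : R) x, e (algebraMap R S r • x) = r • e x)
    (hk : ∀ x, p x = 0 ↔ p' (e x) = 0) :
    ∃ e' : B ≃+ B', ∀ (r : R) x, e' (algebraMap R S r • x) = r • e' x := by
  have hk2 : ∀ x y, p x = p y ↔ p' (e x) = p' (e y) := by
    intro x y
    rw [← sub_eq_zero, ← LinearMap.map_sub, hk, e.map_sub, LinearMap.map_sub, sub_eq_zero]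
  choose s hs using hp
  let φ : B →+ B' :=
    { toFun := fun b => p' (e (s b))
      map_zero' := by
        rw [← hk, hs]
      map_add' := by
        intro x y
        rw [← LinearMap.map_add, ← e.map_add, ← hk2, hs, LinearMap.map_add, hs, hs] }
  have hφ : ∀ x, φ (p x) = p' (e x) := fun x => (hk2 _ _).1 (hs _)
  refine ⟨AddEquiv.ofBijective φ ⟨?_, ?_⟩, ?_⟩
  · intro x y hxy
    have := (hk2 _ _).2 hxy
    rwa [hs, hs] at this
  · intro y
    obtain ⟨y, rfl⟩ := hp' y
    obtain ⟨x, rfl⟩ := e.surjective y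
    exact ⟨p x, hφ x⟩
  · intro r x
    change φ _ = r • φ _
    conv_lhs => rw [← hs x, ← LinearMap.map_smul, hφ, he, LinearMap.map_smul]
    rfl

variable (a : Ideal R) 

lemma cmp_zero (M : Type u) [AddCommGroup M] [Module R M] [Module S M]
    [IsScalarTower R S M] : ∃ e : H (a.map (algebraMap R S)) 0 M ≃+ H a 0 M,
    (∀ x, ev0 a M (e x) = ev0 _ M x) ∧ ∀ (r : R) x, e (algebraMap R S r • x) = r • e x := by
  have h1 : ∀ x : H (a.map (algebraMap R S)) 0 M, ∃ y : H a 0 M, ev0 a M y = ev0 _ M x := by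
    intro x
    have : ev0 _ M x ∈ gam (a.map (algebraMap R S)) M := by rw [← ev0_range]; exact ⟨x, rfl⟩
    rw [gam_cmp, ← ev0_range] at this
    exact this
  choose φ hφ using h1
  let ψ : H (a.map (algebraMap R S)) 0 M →+ H a 0 M :=
    { toFun := φ
      map_zero' := ev0_injective a (by rw [hφ, LinearMap.map_zero, LinearMap.map_zero])
      map_add' := fun x y => ev0_injective a (by
        rw [hφ, LinearMap.map_add, LinearMap.map_add, hφ, hφ]) }
  refine ⟨AddEquiv.ofBijective ψ ⟨?_, ?_⟩, hφ, ?_⟩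
  · intro x y hxy
    apply ev0_injective
    rw [← hφ, ← hφ]
    exact congrArg _ hxy
  · intro y
    have : ev0 _ M y ∈ gam a M := by rw [← ev0_range]; exact ⟨y, rfl⟩
    rw [← gam_cmp S, ← ev0_range] at this
    obtain ⟨x, hx⟩ := this
    exact ⟨x, ev0_injective a ((hφ x).trans hx)⟩
  · intro r x
    apply ev0_injective
    change ev0 a M (φ _) = ev0 a M (r • φ _)
    rw [hφ, LinearMap.map_smul, LinearMap.map_smul, hφ, algebraMap_smul]

theorem cmp [Module.Flat R S] (i : ℕ) (M : Type u) [AddCommGroup M] [Module R M] [Module S M]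
    [IsScalarTower R S M] : ∃ e : H (a.map (algebraMap R S)) i M ≃+ H a i M,
    ∀ (r : R) x, e (algebraMap R S r • x) = r • e x := by
  induction i generalizing M with
  | zero => obtain ⟨e, -, h⟩ := cmp_zero S a M; exact ⟨e, h⟩
  | succ i ih =>
    obtain ⟨I, _, mSI, hI, f, hf⟩ := exists_inj S M
    let _ : Module R I := Module.compHom I (algebraMap R S)
    have _hs : IsScalarTower R S I := IsScalarTower.of_algebraMap_smul fun r x => rfl
    have hIR : Module.Injective R I := inj_restrict S I
    let g := (LinearMap.range f).mkQ
    have hg : Function.Surjective g := Submodule.mkQ_surjective _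
    have hfg : Function.Exact f g := LinearMap.exact_map_mkQ_range f
    let f' : M →ₗ[R] I := f.restrictScalars R
    let g' : I →ₗ[R] (I ⧸ LinearMap.range f) := g.restrictScalars R
    have hf' : Function.Injective f' := hf
    have hg' : Function.Surjective g' := hg
    have hfg' : Function.Exact f' g' := hfg
    have v1 : Subsingleton (H (a.map (algebraMap R S)) (i+1) I) := H_injective _ i
    have v2 : Subsingleton (H a (i+1) I) := H_injective _ i
    have s1 := ses_del_surj _ i hf hfg hg v1
    have s2 := ses_del_surj _ i hf' hfg' hg' v2
    rcases i with _ | i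
    · obtain ⟨e, he, her⟩ := cmp_zero S a (I ⧸ LinearMap.range f)
      refine cmp_surj S _ s1 _ s2 e her fun x => ?_
      rw [(exact_del _ 0 hf hfg hg x), (exact_del _ 0 hf' hfg' hg' (e x))]
      obtain ⟨eI, heI, -⟩ := cmp_zero S a I
      constructor
      · rintro ⟨w, rfl⟩
        refine ⟨eI w, ev0_injective a ?_⟩
        rw [ev0_map, heI, he, ev0_map]; rfl
      · rintro ⟨w, hw⟩
        refine ⟨eI.symm w, ev0_injective _ ?_⟩
        rw [ev0_map, ← he, ← hw, ev0_map, ← heI, AddEquiv.apply_symm_apply]; rfl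
    · obtain ⟨e, her⟩ := ih (I ⧸ LinearMap.range f)
      have i1 := ses_del_inj (a.map (algebraMap R S)) (i+1) hf hfg hg (H_injective _ i)
      have i2 := ses_del_inj a (i+1) hf' hfg' hg' (H_injective _ i)
      refine cmp_surj S _ s1 _ s2 e her fun x => ?_
      rw [map_eq_zero_iff _ i1, map_eq_zero_iff _ i2, map_eq_zero_iff _ e.injective]

end D1

end

end LCx


namespace LCx

noncomputable section

section D2

open IsLocalRing

variable (R : Type u) [CommRing R] [IsNoetherianRing R] [IsLocalRing R]

abbrev Cmp := AdicCompletion (maximalIdeal R) R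

lemma cmp_surj_of {A : Type u} [CommRing A] (J : Ideal A) (hJ : J.FG) (φ : A →+* R)
    (hφ : Function.Surjective φ) (hm : J.map φ = maximalIdeal R) :
    ∃ F : AdicCompletion J A →+* Cmp R, Function.Surjective F := by
  have hle : ∀ n, J ^ n ≤ (maximalIdeal R ^ n).comap φ := fun n => by
    rw [← Ideal.map_le_iff_le_comap, Ideal.map_pow, hm]
  let f : (n : ℕ) → AdicCompletion J A →+* R ⧸ (maximalIdeal R) ^ n := fun n =>
    (Ideal.quotientMap _ φ (hle n)).comp (AdicCompletion.evalₐ J n : _ →+* _)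
  have hf : ∀ {m n : ℕ} (h : m ≤ n), (Ideal.Quotient.factorPow _ h).comp (f n) = f m := by
    intro m n h
    ext x
    obtain ⟨y, rfl⟩ := AdicCompletion.mk_surjective J A x
    simp only [f, RingHom.comp_apply, RingHom.coe_coe, AdicCompletion.evalₐ_mk]
    have h2 : (Ideal.Quotient.mk (J ^ m)) (y.1 n) = Ideal.Quotient.mk (J ^ m) (y.1 m) := 
      AdicCompletion.Ideal.mk_eq_mk _ h y
    have h3 := congrArg (Ideal.quotientMap _ φ (hle m)) h2
    simpa using h3
  let F := AdicCompletion.liftRingHom (maximalIdeal R) f hf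
  have hF : F.comp (algebraMap A (AdicCompletion J A)) = (algebraMap R (Cmp R)).comp φ := by
    refine RingHom.ext fun x => ?_
    refine AdicCompletion.ext_evalₐ fun n => ?_
    simp [F, f]
  refine ⟨F, ?_⟩
  have h1 : (J.map (algebraMap A (AdicCompletion J A))).map F = maximalIdeal (Cmp R) := by
    rw [Ideal.map_map, hF, ← Ideal.map_map, hm, AdicCompletion.maximalIdeal_eq_map]
  have := AdicCompletion.isAdicComplete_self J hJ
  have : IsHausdorff ((J.map (algebraMap A (AdicCompletion J A))).map F) (Cmp R) := by
    rw [h1]; infer_instance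
  refine surjective_of_mk_map_comp_surjective (I := J.map (algebraMap A (AdicCompletion J A))) F ?_
  intro y
  obtain ⟨y, rfl⟩ := Ideal.Quotient.mk_surjective y
  obtain ⟨z, hz⟩ := (AdicCompletion.residueField_map_bijective R).2 (residue _ y)
  obtain ⟨z, rfl⟩ := residue_surjective z
  obtain ⟨t, rfl⟩ := hφ z
  refine ⟨algebraMap _ _ t, ?_⟩
  have h2 : F (algebraMap _ _ t) = algebraMap R (Cmp R) (φ t) := RingHom.congr_fun hF t
  rw [RingHom.comp_apply, h2, Ideal.Quotient.eq, h1]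
  rw [ResidueField.map_residue] at hz
  exact (Ideal.Quotient.eq).1 hz

instance cmp_noeth : IsNoetherianRing (Cmp R) := by
  obtain ⟨s, hs⟩ := (maximalIdeal R).fg_of_isNoetherianRing
  have h := cmp_surj_of R (A := MvPolynomial s R) (MvPolynomial.idealOfVars s R)
    (MvPolynomial.idealOfVars_fg _ _) (MvPolynomial.aeval (fun i : s => (i : R))).toRingHom
    (fun r => ⟨MvPolynomial.C r, by simp⟩) (by
      rw [MvPolynomial.idealOfVars, Ideal.map_span, ← hs, ← Set.range_comp]
      congr 1
      ext; simp)
  obtain ⟨F, hF⟩ := h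
  let e := MvPowerSeries.toAdicCompletionAlgEquiv s R
  exact isNoetherianRing_of_surjective _ _ (F.comp e.toRingEquiv.toRingHom) (hF.comp e.surjective)

instance cmp_flat : Module.Flat R (Cmp R) := AdicCompletion.flat_of_isNoetherian _

instance cmp_ff : Module.FaithfullyFlat R (Cmp R) := Module.FaithfullyFlat.of_flat_of_isLocalHom

lemma cmp_dim (d : ℕ) (hd : ringKrullDim R ≤ (d : WithBot ℕ∞)) :
    ringKrullDim (Cmp R) ≤ (d : WithBot ℕ∞) := by
  rw [← maximalIdeal_height_eq_ringKrullDim] at hd ⊢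
  have hd : (maximalIdeal R).height ≤ (d : ℕ∞) := by exact_mod_cast hd
  suffices (maximalIdeal (Cmp R)).height ≤ (d : ℕ∞) by exact_mod_cast this
  obtain ⟨s, hs, hc⟩ := Ideal.exists_finset_card_eq_height_of_isNoetherianRing (maximalIdeal R)
  rw [← hc] at hd
  classical
  have h1 : maximalIdeal (Cmp R) ∈ (Ideal.span
      ((s.image (algebraMap R (Cmp R)) : Finset (Cmp R)) : Set (Cmp R))).minimalPrimes := by
    rw [Finset.coe_image, ← Ideal.map_span]
    refine ⟨⟨inferInstance, ?_⟩, ?_⟩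
    · rw [AdicCompletion.maximalIdeal_eq_map]
      exact Ideal.map_mono hs.1.2
    · rintro Q ⟨hQ, hQ2⟩ -
      rw [AdicCompletion.maximalIdeal_eq_map, Ideal.map_le_iff_le_comap]
      exact hs.2 ⟨inferInstance, Ideal.map_le_iff_le_comap.1 hQ2⟩
        (le_maximalIdeal (Ideal.IsPrime.ne_top inferInstance))
  refine (Ideal.height_le_card_of_mem_minimalPrimes_span_finset h1).trans ?_
  exact (Nat.cast_le.2 Finset.card_image_le).trans hd

end D2

end

end LCx


namespace LCx

noncomputable section

section D3

open IsLocalRing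

variable {S : Type u} [CommRing S]

lemma fin_precomplete (I : Ideal S) [IsPrecomplete I S] (M : Type u) [AddCommGroup M] [Module S M]
    [Module.Finite S M] : IsPrecomplete I M := by
  rw [← AdicCompletion.of_surjective_iff]
  intro x
  obtain ⟨t, rfl⟩ := AdicCompletion.ofTensorProduct_surjective_of_finite I M x
  induction t using TensorProduct.induction_on with
  | zero => exact ⟨0, by simp⟩
  | tmul r m =>
    obtain ⟨r, rfl⟩ := AdicCompletion.of_surjective I S r
    refine ⟨r • m, ?_⟩
    rw [AdicCompletion.ofTensorProduct_tmul]
    rw [LinearMap.map_smul]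
    ext n
    rw [AdicCompletion.val_smul_apply]
    simp only [AdicCompletion.of_apply]
    rfl
  | add x y hx hy =>
    obtain ⟨x', hx⟩ := hx
    obtain ⟨y', hy⟩ := hy
    exact ⟨x' + y', by rw [LinearMap.map_add, LinearMap.map_add, hx, hy]⟩

lemma nak (I : Ideal S) [IsPrecomplete I S] (K : Type u) [AddCommGroup K] [Module S K]
    [IsHausdorff I K] [h : Module.Finite S (K ⧸ (I • ⊤ : Submodule S K))] : Module.Finite S K := by
  obtain ⟨n, f, hf⟩ := Module.Finite.exists_fin' S (K ⧸ (I • ⊤ : Submodule S K))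
  obtain ⟨g, hg⟩ := Module.projective_lifting_property
    (Submodule.mkQ (I • ⊤ : Submodule S K)) f (Submodule.mkQ_surjective _)
  have := fin_precomplete I (ULift.{u} (Fin n → S))
  have h2 := surjective_of_mkQ_comp_surjective (I := I)
    (f := g ∘ₗ (ULift.moduleEquiv : ULift.{u} (Fin n → S) ≃ₗ[S] _).toLinearMap) (by
    rw [← LinearMap.comp_assoc, hg]
    exact hf.comp (LinearEquiv.surjective _))
  exact Module.Finite.of_surjective _ h2

end D3

section D4

variable {S : Type u} [CommRing S]

/-- existence of an injective hull, with essentiality stated elementwise -/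
lemma exists_hull (k : Type u) [AddCommGroup k] [Module S k] :
    ∃ (E : Type u) (_ : AddCommGroup E) (_ : Module S E) (j : k →ₗ[S] E),
      Function.Injective j ∧ Module.Injective S E ∧
      ∀ x : E, x ≠ 0 → ∃ s : S, s • x ≠ 0 ∧ s • x ∈ LinearMap.range j := by
  obtain ⟨I, _, _, hI, ι, hι⟩ := exists_inj S k
  set K := LinearMap.range ι with hK
  obtain ⟨E, hKE, hE⟩ := zorn_le_nonempty₀ {L : Submodule S I |
      ∀ x ∈ L, x ≠ 0 → ∃ s : S, s • x ≠ 0 ∧ s • x ∈ K} (by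
    intro c hc hch y hy
    refine ⟨sSup c, ?_, fun z hz => le_sSup hz⟩
    intro x hx hx0
    rw [Submodule.mem_sSup_of_directed ⟨y, hy⟩ hch.directedOn] at hx
    obtain ⟨L, hL, hx⟩ := hx
    exact hc hL x hx hx0) K (fun x hx hx0 => ⟨1, by simpa using hx0, by simpa using hx⟩)
  obtain ⟨C, -, hC⟩ := zorn_le_nonempty₀ {C : Submodule S I | Disjoint C E} (by
    intro c hc hch y hy
    refine ⟨sSup c, ?_, fun z hz => le_sSup hz⟩
    exact (DirectedOn.disjoint_sSup_left hch.directedOn).2 fun b hb => hc hb) ⊥ disjoint_bot_left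
  have hC1 : Disjoint C E := hC.prop
  have hC2 : ∀ x, x ∉ C → ∃ s : S, ∃ e ∈ E, e ≠ 0 ∧ s • x - e ∈ C := by
    intro x hx
    have h1 : ¬ Disjoint (C ⊔ Submodule.span S {x}) E := fun h => by
      have := hC.le_of_ge h le_sup_left
      exact hx (this (Submodule.mem_sup_right (Submodule.mem_span_singleton_self x)))
    rw [Submodule.disjoint_def] at h1
    push Not at h1
    obtain ⟨e, he1, he2, he3⟩ := h1
    obtain ⟨c, hc, z, hz, rfl⟩ := Submodule.mem_sup.1 he1
    obtain ⟨s, rfl⟩ := Submodule.mem_span_singleton.1 hz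
    exact ⟨s, _, he2, he3, by simpa using hc⟩
  let π := C.mkQ ∘ₗ E.subtype
  have hπ : Function.Injective π := by
    rw [← LinearMap.ker_eq_bot, LinearMap.ker_eq_bot']
    intro e he
    have : (e : I) ∈ C := by simpa [π] using he
    exact Subtype.ext ((Submodule.disjoint_def.1 hC1) _ this e.2)
  obtain ⟨g, hg⟩ := hI.out π hπ E.subtype
  have hg2 : ∀ e ∈ E, g (C.mkQ e) = e := fun e he => hg ⟨e, he⟩
  have hgE : LinearMap.range g = E := by
    refine (hE.eq_of_le ?_ ?_).symm
    · rintro _ ⟨z, rfl⟩ hz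
      obtain ⟨x, rfl⟩ := C.mkQ_surjective z
      have hx : x ∉ C := fun h => hz (by
        rw [show C.mkQ x = 0 by simpa using h, LinearMap.map_zero])
      obtain ⟨s, e, he, he0, hse⟩ := hC2 x hx
      have h1 : s • g (C.mkQ x) = e := by
        rw [← LinearMap.map_smul, ← LinearMap.map_smul, ← hg2 e he]
        congr 1
        rw [← sub_eq_zero, ← LinearMap.map_sub]
        exact (Submodule.Quotient.mk_eq_zero C).2 hse
      obtain ⟨t, ht, ht2⟩ := hE.prop e he he0
      refine ⟨t * s, ?_, ?_⟩ <;> rw [mul_smul, h1] <;> assumption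
    · intro e he
      exact ⟨_, hg2 e he⟩
  let ρ : I →ₗ[S] E := LinearMap.codRestrict E (g ∘ₗ C.mkQ) (fun x => by
    rw [← hgE]; exact ⟨_, rfl⟩)
  have hρ : ∀ e : E, ρ e = e := fun e => Subtype.ext (hg2 e e.2)
  refine ⟨E, inferInstance, inferInstance, LinearMap.codRestrict E ι (fun x => hKE ⟨x, rfl⟩),
    ?_, ⟨?_⟩, ?_⟩
  · intro x y hxy
    exact hι (congrArg Subtype.val hxy)
  · intro X Y _ _ _ _ f hf φ
    obtain ⟨h, hh⟩ := hI.out f hf (E.subtype ∘ₗ φ)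
    refine ⟨ρ ∘ₗ h, fun x => ?_⟩
    rw [LinearMap.comp_apply, hh]
    exact hρ _
  · intro x hx
    obtain ⟨s, hs, t, ht⟩ := hE.prop x x.2 (by simpa using hx)
    exact ⟨s, fun h => hs (congrArg Subtype.val h), t, Subtype.ext ht⟩

end D4

end

end LCx


namespace LCx

noncomputable section

section D4

open IsLocalRing

variable {S : Type u} [CommRing S]

lemma dual_ext {N A E : Type u} [AddCommGroup N] [Module S N] [AddCommGroup A] [Module S A]
    [AddCommGroup E] [Module S E] (hE : Module.Injective S E) (δ : N →ₗ[S] A) (φ : N →ₗ[S] E)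
    (h : LinearMap.ker δ ≤ LinearMap.ker φ) : ∃ Φ : A →ₗ[S] E, ∀ y, Φ (δ y) = φ y := by
  obtain ⟨Φ, hΦ⟩ := hE.out ((LinearMap.ker δ).liftQ δ le_rfl)
    (LinearMap.ker_eq_bot.1 (Submodule.ker_liftQ_eq_bot _ _ _ le_rfl))
    ((LinearMap.ker δ).liftQ φ h)
  exact ⟨Φ, fun y => by simpa using hΦ (Submodule.Quotient.mk y)⟩

structure IsHull (S : Type u) [CommRing S] [IsLocalRing S] (E : Type u) [AddCommGroup E]
    [Module S E] : Prop where
  inj : Module.Injective S E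
  soc : ∃ L : Submodule S E, L.FG ∧ ∀ x : E, (∀ r ∈ maximalIdeal S, r • x = 0) → x ∈ L
  cog : ∀ (N : Type u) [AddCommGroup N] [Module S N] (y : N), y ≠ 0 → ∃ φ : N →ₗ[S] E, φ y ≠ 0

variable [IsLocalRing S]

lemma exists_isHull : ∃ (E : Type u) (_ : AddCommGroup E) (_ : Module S E), IsHull S E := by
  obtain ⟨E, _, _, j, hj, hE, hs⟩ := exists_hull (S := S) (S ⧸ maximalIdeal S)
  refine ⟨E, _, _, hE, ⟨LinearMap.range j, ?_, ?_⟩, ?_⟩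
  · rw [LinearMap.range_eq_map]
    exact Module.Finite.fg_top.map j
  · intro x hx
    by_cases h0 : x = 0
    · rw [h0]; exact Submodule.zero_mem _
    obtain ⟨s, hs1, hs2⟩ := hs x h0
    have : IsUnit s := by
      by_contra h
      exact hs1 (hx s ((mem_maximalIdeal s).2 h))
    obtain ⟨u, rfl⟩ := this
    have := (LinearMap.range j).smul_mem (↑u⁻¹ : S) hs2
    simpa [smul_smul] using this
  · intro N _ _ y hy
    have h1 : LinearMap.ker (LinearMap.toSpanSingleton S N y) ≤
        LinearMap.ker (j ∘ₗ (maximalIdeal S).mkQ) := by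
      intro r hr
      have hr : r • y = 0 := by simpa using hr
      have : r ∈ maximalIdeal S := by
        rw [mem_maximalIdeal]
        rintro ⟨u, rfl⟩
        apply hy
        have := congrArg (fun z => (↑u⁻¹ : S) • z) hr
        simpa [smul_smul] using this
      have h2 : (maximalIdeal S).mkQ r = 0 := (Submodule.Quotient.mk_eq_zero _).2 this
      rw [LinearMap.mem_ker, LinearMap.comp_apply, h2, LinearMap.map_zero]
    obtain ⟨Φ, hΦ⟩ := dual_ext hE _ _ h1
    refine ⟨Φ, fun h => ?_⟩
    have h3 := hΦ 1
    rw [LinearMap.toSpanSingleton_apply, one_smul, h, LinearMap.comp_apply] at h3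
    have h4 := hj (h3.symm.trans (LinearMap.map_zero j).symm)
    have h5 : (1 : S) ∈ maximalIdeal S := (Submodule.Quotient.mk_eq_zero _).1 h4
    exact (Ideal.ne_top_iff_one _).1 (Ideal.IsPrime.ne_top inferInstance) h5

variable {E : Type u} [AddCommGroup E] [Module S E]

variable {N G : Type u} [AddCommGroup N] [Module S N] [AddCommGroup G] [Module S G]

lemma dual_ann (hE : IsHull S E) (r : S) (h : ∀ φ : N →ₗ[S] E, r • φ = 0) (y : N) : r • y = 0 := by
  by_contra hy
  obtain ⟨φ, hφ⟩ := hE.cog N _ hy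
  apply hφ
  have := LinearMap.congr_fun (h φ) y
  simpa using this

lemma dual_haus (h : gam (maximalIdeal S) N = ⊤) : IsHausdorff (maximalIdeal S) (N →ₗ[S] E) := by
  refine ⟨fun φ hφ => LinearMap.ext fun y => ?_⟩
  obtain ⟨n, hn⟩ := (mem_gam _).1 (h ▸ Submodule.mem_top : y ∈ gam (maximalIdeal S) N)
  have h1 : φ ∈ (maximalIdeal S ^ n • ⊤ : Submodule S (N →ₗ[S] E)) := by
    simpa using SModEq.zero.1 (hφ n)
  have h2 : ∀ ψ ∈ (maximalIdeal S ^ n • ⊤ : Submodule S (N →ₗ[S] E)), ψ y = 0 := by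
    intro ψ hψ
    induction hψ using Submodule.smul_induction_on' with
    | smul r hr ψ _ => rw [LinearMap.smul_apply, ← LinearMap.map_smul, hn r hr, LinearMap.map_zero]
    | add a _ b _ ha hb => rw [LinearMap.add_apply, ha, hb, add_zero]
  exact h2 φ h1

/-- a functional vanishing on `0 :_N 𝔟` lies in `𝔟 Hom(N, E)` -/
lemma dual_mem (hE : IsHull S E) (b : Ideal S) (hb : b.FG) (φ : N →ₗ[S] E)
    (h : ∀ y, (∀ r ∈ b, r • y = 0) → φ y = 0) : φ ∈ (b • ⊤ : Submodule S (N →ₗ[S] E)) := by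
  classical
  obtain ⟨s, rfl⟩ := hb
  let δ : N →ₗ[S] (s → N) := LinearMap.pi fun r => (r : S) • LinearMap.id
  obtain ⟨Φ, hΦ⟩ := dual_ext hE.inj δ φ (by
    intro y hy
    refine h y fun r hr => ?_
    have h1 : ∀ r ∈ s, r • y = 0 := fun r hr => congrFun hy ⟨r, hr⟩
    induction hr using Submodule.span_induction with
    | mem x hx => exact h1 x hx
    | zero => simp
    | add x y _ _ hx hy => rw [add_smul, hx, hy, add_zero]
    | smul c x _ hx => rw [smul_eq_mul, mul_smul, hx, smul_zero])
  have h2 : φ = ∑ r : s, (r : S) • (Φ ∘ₗ LinearMap.single S (fun _ => N) r) := by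
    ext y
    rw [← hΦ, LinearMap.sum_apply]
    conv_lhs => rw [← Finset.univ_sum_single (δ y), _root_.map_sum]
    refine Finset.sum_congr rfl fun r _ => ?_
    rw [LinearMap.smul_apply, LinearMap.comp_apply, ← LinearMap.map_smul, ← LinearMap.map_smul]
    rfl
  rw [h2]
  exact Submodule.sum_mem _ fun r _ => Submodule.smul_mem_smul (Ideal.subset_span r.2) trivial

variable [IsNoetherianRing S]

/-- if the elements of `0 :_N 𝔟` come from `G`, then `K(N)/𝔟K(N)` is a quotient of a submodule of
`K(G)` -/
lemma dual_quot (hE : IsHull S E) (b : Ideal S) (π : G →ₗ[S] N) (hπ : ∀ y, (∀ r ∈ b, r • y = 0) → ∃ g, π g = y) :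
    ∃ (Q : Submodule S (G →ₗ[S] E)) (f : Q →ₗ[S] ((N →ₗ[S] E) ⧸ (b • ⊤ : Submodule S (N →ₗ[S] E)))),
      Function.Surjective f := by
  let ρ : (N →ₗ[S] E) →ₗ[S] (G →ₗ[S] E) := LinearMap.lcomp S E π
  have hk : LinearMap.ker ρ ≤ (b • ⊤ : Submodule S (N →ₗ[S] E)) := by
    intro φ hφ
    refine dual_mem hE b (IsNoetherian.noetherian b) φ fun y hy => ?_
    obtain ⟨g, rfl⟩ := hπ y hy
    exact LinearMap.congr_fun hφ g
  refine ⟨LinearMap.range ρ, (Submodule.factor hk) ∘ₗ ρ.quotKerEquivRange.symm.toLinearMap, ?_⟩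
  exact (Submodule.factor_surjective hk).comp (LinearEquiv.surjective _)

lemma dual_fin_quot (hE : IsHull S E) (b : Ideal S) (π : G →ₗ[S] N)
    (hπ : ∀ y, (∀ r ∈ b, r • y = 0) → ∃ g, π g = y) [Module.Finite S (G →ₗ[S] E)] :
    Module.Finite S ((N →ₗ[S] E) ⧸ (b • ⊤ : Submodule S (N →ₗ[S] E))) := by
  obtain ⟨Q, f, hf⟩ := dual_quot hE b π hπ
  exact Module.Finite.of_surjective f hf

lemma dual_dim_quot (hE : IsHull S E) (b : Ideal S) (π : G →ₗ[S] N)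
    (hπ : ∀ y, (∀ r ∈ b, r • y = 0) → ∃ g, π g = y) :
    Module.supportDim S ((N →ₗ[S] E) ⧸ (b • ⊤ : Submodule S (N →ₗ[S] E))) ≤
      Module.supportDim S (G →ₗ[S] E) := by
  obtain ⟨Q, f, hf⟩ := dual_quot hE b π hπ
  exact (Module.supportDim_le_of_surjective f hf).trans
    (Module.supportDim_le_of_injective Q.subtype Q.injective_subtype)

/-- duals of finite modules killed by `𝔫` -/
lemma dual_fin_soc (hE : IsHull S E) [Module.Finite S N] (h : ∀ r ∈ maximalIdeal S, ∀ y : N, r • y = 0) :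
    Module.Finite S (N →ₗ[S] E) := by
  obtain ⟨L, hL, hL2⟩ := hE.soc
  obtain ⟨k, p, hp⟩ := Module.Finite.exists_fin' S N
  have : Module.Finite S L := Module.Finite.iff_fg.2 hL
  let f : (N →ₗ[S] E) →ₗ[S] (Fin k → L) :=
    { toFun := fun φ i => ⟨φ (p (Pi.single i 1)), hL2 _ fun r hr => by
        rw [← LinearMap.map_smul, h r hr, LinearMap.map_zero]⟩
      map_add' := fun _ _ => rfl
      map_smul' := fun _ _ => rfl }
  refine Module.Finite.of_injective f ?_
  intro φ ψ hφ
  have h1 : φ ∘ₗ p = ψ ∘ₗ p := by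
    refine LinearMap.pi_ext' fun i => LinearMap.ext_ring ?_
    exact congrArg Subtype.val (congrFun hφ i)
  ext y
  obtain ⟨z, rfl⟩ := hp y
  exact LinearMap.congr_fun h1 z

variable [IsAdicComplete (maximalIdeal S) S]

lemma dual_fin_step (hE : IsHull S E) (h : gam (maximalIdeal S) N = ⊤) (b : Ideal S) (hb : b ≤ maximalIdeal S)
    (π : G →ₗ[S] N) (hπ : ∀ y, (∀ r ∈ b, r • y = 0) → ∃ g, π g = y)
    [Module.Finite S (G →ₗ[S] E)] : Module.Finite S (N →ₗ[S] E) := by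
  have h1 := dual_fin_quot hE b π hπ
  have h2 : (b • ⊤ : Submodule S (N →ₗ[S] E)) ≤ maximalIdeal S • ⊤ := Submodule.smul_mono_left hb
  have := Module.Finite.of_surjective (Submodule.factor h2) (Submodule.factor_surjective h2)
  have := dual_haus (E := E) h
  exact nak (maximalIdeal S) (N →ₗ[S] E)

lemma dual_fin_len (hE : IsHull S E) [Module.Finite S N] (h : gam (maximalIdeal S) N = ⊤) :
    Module.Finite S (N →ₗ[S] E) := by
  let T : Submodule S N :=
    { carrier := {y | ∀ r ∈ maximalIdeal S, r • y = 0}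
      zero_mem' := fun r _ => smul_zero r
      add_mem' := fun hx hy r hr => by rw [smul_add, hx r hr, hy r hr, add_zero]
      smul_mem' := fun c x hx r hr => by rw [smul_comm, hx r hr, smul_zero] }
  have : Module.Finite S (T →ₗ[S] E) := dual_fin_soc hE (fun r hr y => Subtype.ext (y.2 r hr))
  exact dual_fin_step hE h (maximalIdeal S) le_rfl T.subtype (fun y hy => ⟨⟨y, hy⟩, rfl⟩)

end D4

end

end LCx


namespace LCx

noncomputable section

open scoped Pointwise

section D5

open IsLocalRing

set_option linter.unusedSectionVars false
variable {S : Type u} [CommRing S] [IsNoetherianRing S]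

lemma gam_of_rad (a b n : Ideal S) {N : Type u} [AddCommGroup N] [Module S N]
    (h : n ≤ (a ⊔ b).radical) (ha : gam a N = ⊤) (hb : ∀ r ∈ b, ∀ y : N, r • y = 0) :
    gam n N = ⊤ := by
  rw [gam_eq_top_iff] at ha ⊢
  intro y
  obtain ⟨k, hk⟩ := ha y
  obtain ⟨m, hm⟩ := Ideal.exists_pow_le_of_le_radical_of_fg h (IsNoetherian.noetherian n)
  refine ⟨m * (k + 1), fun r hr => ?_⟩
  have h1 : n ^ (m * (k + 1)) ≤ a ^ k ⊔ b := by
    rw [pow_mul]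
    refine (Ideal.pow_right_mono hm _).trans ?_
    simpa using Ideal.sup_pow_add_le_pow_sup_pow (I := a) (J := b) (n := k) (m := 1)
  obtain ⟨s, hs, t, ht, rfl⟩ := Submodule.mem_sup.1 (h1 hr)
  rw [add_smul, hk s hs, hb t ht, add_zero]

lemma gam_mem_of_pow (n : Ideal S) {N : Type u} [AddCommGroup N] [Module S N] (y : N) (j : ℕ)
    (h : ∀ r ∈ n ^ j, r • y ∈ gam n N) : y ∈ gam n N := by
  have h1 : (gam n N).mkQ y ∈ gam n (N ⧸ gam n N) := by
    rw [mem_gam]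
    refine ⟨j, fun r hr => ?_⟩
    rw [← LinearMap.map_smul]
    exact (Submodule.Quotient.mk_eq_zero _).2 (h r hr)
  rw [gam_quot] at h1
  exact (Submodule.Quotient.mk_eq_zero _).1 ((Submodule.mem_bot _).1 h1)

/-- `𝔫`-torsion passes from `0 :_N x` to `N` if `N` is `x`-torsion -/
lemma tors_step (a n : Ideal S) {x : S} (hx : x ∈ a) {N G : Type u} [AddCommGroup N] [Module S N]
    [AddCommGroup G] [Module S G] (ha : gam a N = ⊤) (π : G →ₗ[S] N)
    (hπ : ∀ y, x • y = 0 → ∃ g, π g = y) (hG : gam n G = ⊤) : gam n N = ⊤ := by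
  have key : ∀ (k : ℕ) (y : N), x ^ k • y = 0 → y ∈ gam n N := by
    intro k
    induction k with
    | zero => intro y hy; rw [pow_zero, one_smul] at hy; rw [hy]; exact Submodule.zero_mem _
    | succ k ih =>
      intro y hy
      rw [pow_succ', mul_smul] at hy
      obtain ⟨g, hg⟩ := hπ _ hy
      obtain ⟨j, hj⟩ := (gam_eq_top_iff n).1 hG g
      refine gam_mem_of_pow n y j fun r hr => ih _ ?_
      rw [smul_comm, ← hg, ← LinearMap.map_smul, hj r hr, LinearMap.map_zero]
  rw [Submodule.eq_top_iff']
  intro y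
  obtain ⟨k, hk⟩ := (gam_eq_top_iff a).1 ha y
  exact key k y (hk _ (Ideal.pow_mem_pow hx k))

variable [IsLocalRing S]

lemma del_range (a : Ideal S) (i : ℕ) {M : Type u} [AddCommGroup M] [Module S M] {x : S}
    (hreg : IsSMulRegular M x) (y : H a (i+1) M) (hy : x • y = 0) :
    ∃ g, del a i (mulx_inj hreg) (mulx_exact x) (Submodule.mkQ_surjective _) g = y := by
  have := exact_del' a i (mulx_inj hreg) (mulx_exact x) (Submodule.mkQ_surjective _)
  refine (this y).1 ?_
  rw [map_mulx, hy]

lemma rad_of_dim {M : Type u} [AddCommGroup M] [Module S M] [Module.Finite S M]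
    (h : Module.supportDim S M < ((1 : ℕ) : WithBot ℕ∞)) :
    maximalIdeal S ≤ (Module.annihilator S M).radical := by
  rw [Ideal.radical_eq_sInf]
  refine le_sInf fun P hP => ?_
  obtain ⟨hP1, hP2⟩ := hP
  by_contra hlt
  have hP3 : P < maximalIdeal S :=
    lt_of_le_of_ne (le_maximalIdeal hP2.ne_top) (fun h => hlt h.ge)
  have h1 : (⟨P, hP2⟩ : PrimeSpectrum S) ∈ Module.support S M := by
    rw [Module.mem_support_iff_of_finite]; exact hP1
  have h2 : (⟨maximalIdeal S, inferInstance⟩ : PrimeSpectrum S) ∈ Module.support S M := by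
    rw [Module.mem_support_iff_of_finite]; exact hP1.trans hP3.le
  let q : LTSeries (Module.support S M) := RelSeries.fromListIsChain
    [⟨_, h1⟩, ⟨_, h2⟩] (by simp) (by simpa using (show (⟨P, hP2⟩ : PrimeSpectrum S) < ⟨maximalIdeal S, inferInstance⟩ from hP3))
  have h3 : ((q.length : ℕ) : WithBot ℕ∞) ≤ Module.supportDim S M :=
    Order.LTSeries.length_le_krullDim q
  have h4 : q.length = 1 := by simp [q]
  rw [h4] at h3
  exact absurd h (not_lt.2 h3)

lemma dim_of_rad {M : Type u} [AddCommGroup M] [Module S M] [Module.Finite S M]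
    (h : maximalIdeal S ≤ (Module.annihilator S M).radical) :
    Module.supportDim S M ≤ ((0 : ℕ) : WithBot ℕ∞) := by
  have : Subsingleton (Module.support S M) := by
    refine ⟨fun P Q => ?_⟩
    have key : ∀ P : Module.support S M, P.1.asIdeal = maximalIdeal S := by
      rintro ⟨P, hP⟩
      rw [Module.mem_support_iff_of_finite] at hP
      exact le_antisymm (le_maximalIdeal P.2.ne_top)
        (h.trans ((Ideal.IsPrime.radical_le_iff P.2).2 hP))
    exact Subtype.ext (PrimeSpectrum.ext ((key P).trans (key Q).symm))
  exact Order.krullDim_nonpos_of_subsingleton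

lemma ann_dual {E : Type u} [AddCommGroup E] [Module S E] (hE : IsHull S E)
    {N : Type u} [AddCommGroup N] [Module S N] :
    Module.annihilator S (N →ₗ[S] E) = Module.annihilator S N := by
  ext r
  rw [Module.mem_annihilator, Module.mem_annihilator]
  constructor
  · intro h; exact dual_ann hE r h
  · intro h φ
    ext y
    rw [LinearMap.smul_apply, ← LinearMap.map_smul, h, LinearMap.map_zero, LinearMap.zero_apply]

variable {E : Type u} [AddCommGroup E] [Module S E] (hE : IsHull S E) (a : Ideal S)

/-- finiteness and torsion properties of the dual -/
structure PF (E : Type u) [AddCommGroup E] [Module S E] (a : Ideal S)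
    (N : Type u) [AddCommGroup N] [Module S N] : Prop where
  tors : gam (maximalIdeal S) N = ⊤
  fin : Module.Finite S (N →ₗ[S] E)
  rad : maximalIdeal S ≤ (a ⊔ Module.annihilator S N).radical

structure PS (E : Type u) [AddCommGroup E] [Module S E] (i : ℕ)
    (N : Type u) [AddCommGroup N] [Module S N] : Prop where
  tors : gam (maximalIdeal S) N = ⊤
  fin : Module.Finite S (N →ₗ[S] E)
  dim : Module.supportDim S (N →ₗ[S] E) ≤ (i : WithBot ℕ∞)

lemma PF.congr {N N' : Type u} [AddCommGroup N] [Module S N] [AddCommGroup N'] [Module S N']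
    (e : N ≃ₗ[S] N') (h : PF E a N) : PF E a N' := by
  have := h.fin
  refine ⟨gam_top_of_surj _ e.toLinearMap e.surjective h.tors, ?_, ?_⟩
  · exact Module.Finite.equiv (LinearEquiv.congrLeft E S e)
  · rw [← e.annihilator_eq]; exact h.rad

lemma PS.congr {i : ℕ} {N N' : Type u} [AddCommGroup N] [Module S N] [AddCommGroup N'] [Module S N']
    (e : N ≃ₗ[S] N') (h : PS (S := S) E i N) : PS (S := S) E i N' := by
  have := h.fin
  refine ⟨gam_top_of_surj _ e.toLinearMap e.surjective h.tors, ?_, ?_⟩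
  · exact Module.Finite.equiv (LinearEquiv.congrLeft E S e)
  · rw [← Module.supportDim_eq_of_equiv (LinearEquiv.congrLeft E S e)]; exact h.dim

variable [IsAdicComplete (maximalIdeal S) S]

lemma ann_le_H0 (hE : IsHull S E) (a : Ideal S) {M : Type u} [AddCommGroup M] [Module S M] :
    Module.annihilator S M ≤ Module.annihilator S (H a 0 M) :=
  LinearMap.annihilator_le_of_injective (ev0 a M) (ev0_injective a)

theorem claimF (hE : IsHull S E) (a : Ideal S) (ha : a ≤ maximalIdeal S) (d : ℕ) (M : Type u) [AddCommGroup M] [Module S M]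
    [Module.Finite S M]
    (hM : Module.supportDim S M < ((d + 1 : ℕ) : WithBot ℕ∞)) : PF E a (H a d M) := by
  induction d generalizing M with
  | zero =>
    have h1 := rad_of_dim hM
    have h2 : Module.Finite S (H a 0 M) := Module.Finite.of_injective (ev0 a M) (ev0_injective a)
    have h3 : maximalIdeal S ≤ (a ⊔ Module.annihilator S (H a 0 M)).radical :=
      h1.trans (Ideal.radical_mono ((ann_le_H0 hE a).trans le_sup_right))
    have h4 : gam (maximalIdeal S) (H a 0 M) = ⊤ :=
      gam_of_rad a _ _ h3 (gam_H a 0) (fun r hr => Module.mem_annihilator.1 hr)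
    exact ⟨h4, dual_fin_len hE h4, h3⟩
  | succ d ih =>
    let M' := M ⧸ gam a M
    suffices PF E a (H a (d+1) M') from
      this.congr a (LinearEquiv.ofBijective _ (map_mkQ_gam_bij a d (M := M))).symm
    have hM' : Module.supportDim S M' < ((d + 1 + 1 : ℕ) : WithBot ℕ∞) :=
      lt_of_le_of_lt (Module.supportDim_le_of_surjective _ (gam a M).mkQ_surjective) hM
    obtain ⟨x, hx, hreg⟩ := reg_exists a (gam_quot a (M := M))
    have h1 := Module.supportDim_quotSMulTop_succ_eq_supportDim hreg (ha hx)
    have h2 : Module.supportDim S (QuotSMulTop x M') < ((d + 1 : ℕ) : WithBot ℕ∞) := by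
      by_contra hc
      push Not at hc
      have : ((d + 1 + 1 : ℕ) : WithBot ℕ∞) ≤ Module.supportDim S M' := by
        rw [← h1]; push_cast at hc ⊢; gcongr
      exact absurd hM' (not_lt.2 this)
    have h3 := ih (QuotSMulTop x M') h2
    let π := del a d (mulx_inj hreg) (mulx_exact x) (Submodule.mkQ_surjective _)
    have hπ : ∀ y, x • y = 0 → ∃ g, π g = y := del_range a d hreg
    have hπ' : ∀ y, (∀ r ∈ Ideal.span {x}, r • y = 0) → ∃ g, π g = y :=
      fun y hy => hπ y (hy x (Ideal.mem_span_singleton_self x))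
    have t1 := tors_step a (maximalIdeal S) hx (gam_H a (d+1)) π hπ h3.tors
    have := h3.fin
    have t2 := dual_fin_step hE t1 (Ideal.span {x})
      ((Ideal.span_singleton_le_iff_mem _).2 (ha hx)) π hπ'
    refine ⟨t1, t2, ?_⟩
    rw [Ideal.radical_eq_sInf]
    refine le_sInf fun P hP => ?_
    obtain ⟨hP1, hP2⟩ := hP
    refine h3.rad.trans ((Ideal.IsPrime.radical_le_iff hP2).2 (sup_le (le_sup_left.trans hP1) ?_))
    obtain ⟨Q, f, hf⟩ := dual_quot hE (Ideal.span {x}) π hπ'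
    have s1 : (⟨P, hP2⟩ : PrimeSpectrum S) ∈ Module.support S (H a (d+1) M' →ₗ[S] E) := by
      rw [Module.mem_support_iff_of_finite, ann_dual hE]; exact le_sup_right.trans hP1
    have s2 : (⟨P, hP2⟩ : PrimeSpectrum S) ∈ PrimeSpectrum.zeroLocus (Ideal.span {x} : Set S) := by
      rw [PrimeSpectrum.mem_zeroLocus]
      exact (Ideal.span_singleton_le_iff_mem _).2 (hP1 (Ideal.mem_sup_left hx))
    have s3 := (Module.support_quotient (M := H a (d+1) M' →ₗ[S] E) (Ideal.span {x})).symm ▸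
      (Set.mem_inter s1 s2)
    have s4 := Module.support_subset_of_injective Q.subtype Q.injective_subtype
      (Module.support_subset_of_surjective f hf s3)
    rw [Module.mem_support_iff_of_finite, ann_dual hE] at s4
    exact s4

theorem claimS (hE : IsHull S E) (a : Ideal S) (ha : a ≤ maximalIdeal S) (i : ℕ) (M : Type u) [AddCommGroup M] [Module S M]
    [Module.Finite S M] (hM : maximalIdeal S ≤ (a ⊔ Module.annihilator S M).radical) :
    PS (S := S) E i (H a i M) := by
  induction i generalizing M with
  | zero =>
    have h2 : Module.Finite S (H a 0 M) := Module.Finite.of_injective (ev0 a M) (ev0_injective a)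
    have h3 : maximalIdeal S ≤ (a ⊔ Module.annihilator S (H a 0 M)).radical :=
      hM.trans (Ideal.radical_mono (sup_le_sup_left (ann_le_H0 hE a) _))
    have h4 : gam (maximalIdeal S) (H a 0 M) = ⊤ :=
      gam_of_rad a _ _ h3 (gam_H a 0) (fun r hr => Module.mem_annihilator.1 hr)
    have h5 := dual_fin_len hE h4
    refine ⟨h4, h5, dim_of_rad ?_⟩
    rw [ann_dual hE]
    obtain ⟨n, hn⟩ := gam_killed_of_fg _ h4
    intro r hr
    exact ⟨n, Module.mem_annihilator.2 (hn _ (Ideal.pow_mem_pow hr n))⟩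
  | succ i ih =>
    let M' := M ⧸ gam a M
    suffices PS (S := S) E (i+1) (H a (i+1) M') from
      this.congr (LinearEquiv.ofBijective _ (map_mkQ_gam_bij a i (M := M))).symm
    have hM' : maximalIdeal S ≤ (a ⊔ Module.annihilator S M').radical :=
      hM.trans (Ideal.radical_mono (sup_le_sup_left (LinearMap.annihilator_le_of_surjective
        (gam a M).mkQ (gam a M).mkQ_surjective) _))
    obtain ⟨x, hx, hreg⟩ := reg_exists a (gam_quot a (M := M))
    have h2 : maximalIdeal S ≤ (a ⊔ Module.annihilator S (QuotSMulTop x M')).radical :=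
      hM'.trans (Ideal.radical_mono (sup_le_sup_left (LinearMap.annihilator_le_of_surjective
        (Submodule.mkQ _) (Submodule.mkQ_surjective _)) _))
    have h3 := ih (QuotSMulTop x M') h2
    let π := del a i (mulx_inj hreg) (mulx_exact x) (Submodule.mkQ_surjective _)
    have hπ : ∀ y, x • y = 0 → ∃ g, π g = y := del_range a i hreg
    have hπ' : ∀ y, (∀ r ∈ Ideal.span {x}, r • y = 0) → ∃ g, π g = y :=
      fun y hy => hπ y (hy x (Ideal.mem_span_singleton_self x))
    have t1 := tors_step a (maximalIdeal S) hx (gam_H a (i+1)) π hπ h3.tors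
    have := h3.fin
    have t2 := dual_fin_step hE t1 (Ideal.span {x})
      ((Ideal.span_singleton_le_iff_mem _).2 (ha hx)) π hπ'
    refine ⟨t1, t2, ?_⟩
    refine (Module.supportDim_le_supportDim_quotSMulTop_succ (ha hx)).trans ?_
    have s1 := (dual_dim_quot hE (Ideal.span {x}) π hπ').trans h3.dim
    rw [Submodule.ideal_span_singleton_smul] at s1
    push_cast
    gcongr

end D5

end

end LCx


namespace LCx

noncomputable section

open scoped Pointwise
open TensorProduct

section D6

open IsLocalRing

lemma exists_hom_quot {S : Type u} [CommRing S] {J : Type u} [AddCommGroup J] [Module S J]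
    [Module.Finite S J] (P : PrimeSpectrum S) (hP : P ∈ Module.support S J) :
    ∃ f : J →ₗ[S] S ⧸ P.asIdeal, f ≠ 0 := by
  rw [Module.mem_support_iff_nontrivial_residueField_tensorProduct] at hP
  obtain ⟨v, hv⟩ := exists_ne (0 : P.asIdeal.ResidueField ⊗[S] J)
  obtain ⟨φ, hφ⟩ := Module.Projective.exists_dual_ne_zero P.asIdeal.ResidueField hv
  let g : J →ₗ[S] P.asIdeal.ResidueField :=
    (φ.restrictScalars S) ∘ₗ (TensorProduct.mk S P.asIdeal.ResidueField J 1)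
  have hg : g ≠ 0 := by
    intro h0
    apply hφ
    clear hφ hv
    induction v with
    | zero => simp
    | add x y hx hy => rw [LinearMap.map_add, hx, hy, add_zero]
    | tmul c x =>
      have h1 : g x = 0 := by rw [h0]; rfl
      have h2 : c ⊗ₜ[S] x = c • ((1 : P.asIdeal.ResidueField) ⊗ₜ[S] x) := by
        rw [TensorProduct.smul_tmul', smul_eq_mul, mul_one]
      have h3 : φ ((1 : P.asIdeal.ResidueField) ⊗ₜ[S] x) = 0 := h1
      rw [h2, LinearMap.map_smul, h3, smul_zero]
  classical
  obtain ⟨T, hT⟩ := (Module.Finite.fg_top : (⊤ : Submodule S J).FG)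
  obtain ⟨b, hb⟩ := IsLocalization.exist_integer_multiples_of_finset
    (nonZeroDivisors (S ⧸ P.asIdeal)) (T.image g)
  obtain ⟨b', hb'⟩ := Ideal.Quotient.mk_surjective (b : S ⧸ P.asIdeal)
  let ι : (S ⧸ P.asIdeal) →ₗ[S] P.asIdeal.ResidueField :=
    (IsScalarTower.toAlgHom S (S ⧸ P.asIdeal) P.asIdeal.ResidueField).toLinearMap
  have hι : Function.Injective ι := IsFractionRing.injective (S ⧸ P.asIdeal) P.asIdeal.ResidueField
  have hbs : ∀ c : P.asIdeal.ResidueField, b' • c = (b : S ⧸ P.asIdeal) • c := by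
    intro c
    rw [← hb']
    exact (IsScalarTower.algebraMap_smul (S ⧸ P.asIdeal) b' c).symm
  have hr : ∀ x : J, (b' • g) x ∈ LinearMap.range ι := by
    have : (⊤ : Submodule S J) ≤ (LinearMap.range ι).comap (b' • g) := by
      rw [← hT, Submodule.span_le]
      intro t ht
      obtain ⟨y, hy⟩ := hb (g t) (Finset.mem_image_of_mem _ ht)
      refine ⟨y, ?_⟩
      change algebraMap _ _ y = b' • g t
      rw [hy, hbs]
    exact fun x => this trivial
  let e := LinearEquiv.ofInjective ι hι
  refine ⟨e.symm.toLinearMap ∘ₗ (b' • g).codRestrict _ hr, fun h0 => hg ?_⟩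
  ext x
  have h1 : e.symm ((b' • g).codRestrict _ hr x) = 0 := LinearMap.congr_fun h0 x
  rw [LinearEquiv.map_eq_zero_iff] at h1
  have h2 : b' • g x = 0 := congrArg Subtype.val h1
  rw [hbs, Algebra.smul_def, mul_eq_zero] at h2
  rcases h2 with h2 | h2
  · exact absurd ((map_eq_zero_iff _ (IsFractionRing.injective (S ⧸ P.asIdeal) P.asIdeal.ResidueField)).1 h2)
      (nonZeroDivisors.ne_zero b.2)
  · exact h2

variable {S : Type u} [CommRing S] [IsNoetherianRing S] [IsLocalRing S]

lemma dim_quot_le {M : Type u} [AddCommGroup M] [Module S M] [Module.Finite S M] (Q : Ideal S)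
    (h : Q ≤ Module.annihilator S M) : Module.supportDim S M ≤ ringKrullDim (S ⧸ Q) := by
  rw [Module.supportDim_eq_ringKrullDim_quotient_annihilator]
  exact ringKrullDim_le_of_surjective (Ideal.Quotient.factor h) (Ideal.Quotient.factor_surjective h)

lemma quot_van (b : Ideal S) (d : ℕ) (hd : ringKrullDim S ≤ (d : WithBot ℕ∞)) (P : Ideal S)
    [P.IsPrime] (C : Submodule S (S ⧸ P)) (hC : C ≠ ⊥) :
    Subsingleton (H b d ((S ⧸ P) ⧸ C)) := by
  obtain ⟨c, hc, hc0⟩ := (Submodule.ne_bot_iff C).1 hC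
  obtain ⟨c', rfl⟩ := Ideal.Quotient.mk_surjective c
  by_cases hu : IsUnit c'
  · have : C = ⊤ := by
      rw [eq_top_iff]
      intro x _
      obtain ⟨x', rfl⟩ := Ideal.Quotient.mk_surjective x
      obtain ⟨u, hu⟩ := hu.exists_right_inv
      have h := C.smul_mem (x' * u) hc
      have h2 : (x' * u) • (Ideal.Quotient.mk P c') = Ideal.Quotient.mk P (x' * (c' * u)) := by
        rw [Algebra.smul_def, Ideal.Quotient.algebraMap_eq, ← _root_.map_mul]; ring_nf
      rwa [h2, hu, mul_one] at h
    subst this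
    have : Subsingleton ((S ⧸ P) ⧸ (⊤ : Submodule S (S ⧸ P))) :=
      Submodule.Quotient.subsingleton_iff.2 rfl
    exact H_sub_of_sub b d
  · have hreg : IsSMulRegular (S ⧸ P) c' := by
      rw [isSMulRegular_iff_right_eq_zero_of_smul]
      intro x hx
      rw [Algebra.smul_def, Ideal.Quotient.algebraMap_eq, mul_eq_zero] at hx
      exact hx.resolve_left hc0
    have hd1 := Module.supportDim_quotSMulTop_succ_eq_supportDim hreg ((mem_maximalIdeal _).2 hu)
    have hle : c' • (⊤ : Submodule S (S ⧸ P)) ≤ C := by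
      rintro _ ⟨x, -, rfl⟩
      obtain ⟨x', rfl⟩ := Ideal.Quotient.mk_surjective x
      have h := C.smul_mem x' hc
      change c' • (Ideal.Quotient.mk P x') ∈ C
      rw [Algebra.smul_def, Ideal.Quotient.algebraMap_eq] at h ⊢
      rwa [mul_comm]
    have h2 : Module.supportDim S ((S ⧸ P) ⧸ C) ≤ Module.supportDim S (QuotSMulTop c' (S ⧸ P)) :=
      Module.supportDim_le_of_surjective (Submodule.factor hle) (Submodule.factor_surjective hle)
    have h3 : Module.supportDim S ((S ⧸ P) ⧸ C) + 1 ≤ d :=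
      (add_le_add_left h2 1).trans (hd1.le.trans ((Module.supportDim_le_ringKrullDim S _).trans hd))
    refine H_vanish b d d ?_ le_rfl
    generalize Module.supportDim S ((S ⧸ P) ⧸ C) = x at h3 ⊢
    induction x with
    | bot => exact WithBot.bot_lt_coe _
    | coe x =>
      induction x with
      | top => exact absurd h3 (by
          rw [not_le]; exact WithBot.coe_lt_coe.2 (by simp))
      | coe x => 
        have h4 : x + 1 ≤ d := by exact_mod_cast h3
        exact_mod_cast Nat.lt_of_succ_le h4

variable [IsAdicComplete (maximalIdeal S) S]

theorem stepB (b : Ideal S) (d : ℕ) (hd : ringKrullDim S ≤ (d : WithBot ℕ∞)) (r : S)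
    (hr : ∀ x : H b d S, r • x = 0) (P : Ideal S) [hP : P.IsPrime] (hrP : ∀ s, s * r = 0 → s ∈ P) :
    Subsingleton (H b d (S ⧸ P)) := by
  by_cases hb : b = ⊤
  · subst hb; exact H_top d
  have hbm := le_maximalIdeal hb
  obtain ⟨E, _, _, hE⟩ := exists_isHull (S := S)
  let J : Ideal S := Module.annihilator S (H b d S)
  have hF := (claimF hE b hbm d S (by
    rw [Module.supportDim_self_eq_ringKrullDim]
    exact lt_of_le_of_lt hd (by exact_mod_cast Nat.lt_succ_self d))).rad
  have hz : ∀ y : H b d J, map b d J.subtype y = 0 := by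
    intro y
    obtain ⟨t, rfl⟩ := th_surj b d hd y
    induction t with
    | zero => simp
    | add x y hx hy => rw [LinearMap.map_add, LinearMap.map_add, hx, hy, add_zero]
    | tmul m y =>
      rw [th_tmul, ← LinearMap.comp_apply, ← map_comp]
      have : J.subtype ∘ₗ LinearMap.toSpanSingleton S J m = mulx S (m : S) := by
        ext; simp [mulx]
      rw [this, map_mulx]
      exact Module.mem_annihilator.1 m.2 y
  have hJ : Subsingleton (H b d J) := by
    cases d with
    | zero =>
      refine subsingleton_of_forall_eq 0 fun y => ?_
      exact map_zero_injective b J.injective_subtype (by rw [hz, LinearMap.map_zero])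
    | succ e =>
      have hS := claimS hE b hbm e (S ⧸ J) (by rw [Ideal.annihilator_quotient]; exact hF)
      let Q : Ideal S := Module.annihilator S (H b e (S ⧸ J))
      have hfin := hS.fin
      have hQd : ringKrullDim (S ⧸ Q) ≤ e := by
        have := hS.dim
        rw [Module.supportDim_eq_ringKrullDim_quotient_annihilator, ann_dual hE] at this
        exact this
      have hQ : ∀ q ∈ Q, ∀ x : H b (e+1) J, q • x = 0 := by
        intro q hq x
        obtain ⟨w, rfl⟩ := (exact_del' b e J.injective_subtype (exact_sub_mkQ J)
          J.mkQ_surjective x).1 (hz x)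
        rw [← LinearMap.map_smul]
        have : q • w = 0 := Module.mem_annihilator.1 hq w
        rw [this, LinearMap.map_zero]
      have hi := top_quot_inj b (e+1) hd (M := J) Q hQ
      have hv : Subsingleton (H b (e+1) (J ⧸ (Q • (⊤ : Submodule S J)))) := by
        refine H_vanish b (e+1) (e+1) (lt_of_le_of_lt ((dim_quot_le Q ?_).trans hQd) ?_) le_rfl
        · intro q hq
          rw [Module.mem_annihilator]
          intro x
          obtain ⟨x, rfl⟩ := Submodule.mkQ_surjective _ x
          rw [← LinearMap.map_smul]
          exact (Submodule.Quotient.mk_eq_zero _).2 (Submodule.smul_mem_smul hq trivial)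
        · exact_mod_cast Nat.lt_succ_self e
      exact hi.subsingleton
  have hrJ : r ∈ J := Module.mem_annihilator.2 hr
  have hsup : (⟨P, hP⟩ : PrimeSpectrum S) ∈ Module.support S J := by
    rw [Module.mem_support_iff_of_finite]
    intro s hs
    apply hrP
    have := Module.mem_annihilator.1 hs ⟨r, hrJ⟩
    exact congrArg Subtype.val this
  obtain ⟨f, hf⟩ := exists_hom_quot _ hsup
  refine ses_mid b d (LinearMap.range f).injective_subtype (exact_sub_mkQ _)
    (LinearMap.range f).mkQ_surjective ?_ ?_
  · have := top_surj b d hd f.rangeRestrict f.surjective_rangeRestrict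
    exact this.subsingleton
  · refine quot_van b d hd P _ ?_
    rwa [Ne, LinearMap.range_eq_bot]

end D6

section D7

open IsLocalRing

variable {R : Type u} [CommRing R] [IsNoetherianRing R] [IsLocalRing R]

lemma flat_ann {S : Type u} [CommRing S] [Algebra R S] [Module.Flat R S] (r : R) (p : Ideal R)
    (hp : ∀ s, s * r = 0 → s ∈ p) (s : S) (hs : s * algebraMap R S r = 0) :
    s ∈ p.map (algebraMap R S) := by
  let A : Submodule R R := LinearMap.ker (LinearMap.toSpanSingleton R R r)
  have hex : Function.Exact A.subtype (LinearMap.toSpanSingleton R R r) := by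
    intro x; simp [A]
  have h1 := Module.Flat.lTensor_exact S hex
  obtain ⟨t, ht⟩ := (h1 (s ⊗ₜ 1)).1 (by
    rw [LinearMap.lTensor_tmul]
    apply (TensorProduct.rid R S).injective
    simp only [LinearMap.toSpanSingleton_apply, TensorProduct.rid_tmul, _root_.map_zero, one_smul]
    rw [Algebra.smul_def, mul_comm]; exact hs)
  have h2 : ∀ t : S ⊗[R] A, TensorProduct.rid R S (A.subtype.lTensor S t) ∈
      p.map (algebraMap R S) := by
    intro t
    induction t with
    | zero => simp
    | add x y hx hy => rw [_root_.map_add, _root_.map_add]; exact add_mem hx hy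
    | tmul x y =>
      rw [LinearMap.lTensor_tmul, TensorProduct.rid_tmul, Algebra.smul_def]
      refine Ideal.mul_mem_right _ _ (Ideal.mem_map_of_mem _ (hp _ ?_))
      have := y.2
      rwa [LinearMap.mem_ker, LinearMap.toSpanSingleton_apply] at this
  have h3 := h2 t
  rw [ht, TensorProduct.rid_tmul, one_smul] at h3
  exact h3

theorem stepC (a : Ideal R) (d : ℕ) (hd : ringKrullDim R ≤ (d : WithBot ℕ∞)) (r : R)
    (hr : ∀ x : H a d R, r • x = 0) (p : Ideal R) (hrp : ∀ s, s * r = 0 → s ∈ p) :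
    Subsingleton (H a d (R ⧸ p)) := by
  let S := Cmp R
  have hdS : ringKrullDim S ≤ (d : WithBot ℕ∞) := cmp_dim R d hd
  have := cmp_noeth R
  refine top_ff a d hd S ?_
  obtain ⟨e, he⟩ := cmp S a d (S ⊗[R] (R ⧸ p))
  refine @Equiv.subsingleton _ _ e.symm.toEquiv ?_
  obtain ⟨e', he'⟩ := cmp S a d S
  have hr' : ∀ x : H (a.map (algebraMap R S)) d S, algebraMap R S r • x = 0 := by
    intro x
    apply e'.injective
    rw [he', top_ann a d hd hr, _root_.map_zero]
  refine H_filt _ d fun P hP => ?_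
  refine stepB _ d hdS (algebraMap R S r) hr' P.asIdeal (hP := P.isPrime) fun s hs => ?_
  rw [Module.mem_support_iff_of_finite] at hP
  apply hP
  have h1 := flat_ann r p hrp s hs
  refine (Ideal.map_le_iff_le_comap.2 ?_) h1
  intro c hc
  rw [Ideal.mem_comap, Module.mem_annihilator]
  intro t
  rw [IsScalarTower.algebraMap_smul]
  induction t with
  | zero => simp
  | add x y hx hy => rw [smul_add, hx, hy, add_zero]
  | tmul x y =>
    rw [← TensorProduct.tmul_smul]
    obtain ⟨y, rfl⟩ := Ideal.Quotient.mk_surjective y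
    rw [Algebra.smul_def, Ideal.Quotient.algebraMap_eq, Ideal.Quotient.eq_zero_iff_mem.2 hc,
      zero_mul, TensorProduct.tmul_zero]

lemma cohDim_iff (a : Ideal R) (d : ℕ) (hd : ringKrullDim R ≤ (d : WithBot ℕ∞))
    (M : Type u) [AddCommGroup M] [Module R M] :
    cohDim a M = ((d : ℕ∞) : WithBot ℕ∞) ↔ ¬ Subsingleton (H a d M) := by
  have hiff : ∀ i, LCNonzero a i M ↔ ¬ Subsingleton (H a i M) := fun i => by
    rw [not_subsingleton_iff_nontrivial]
    exact (eqLC a i M).toEquiv.nontrivial_congr.symm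
  have hle : ∀ i, LCNonzero a i M → i ≤ d := by
    intro i hi
    by_contra hc
    exact (hiff i).1 hi (H_vanish_top a i d hd (by omega))
  constructor
  · intro h hs
    have h1 : ∀ i, LCNonzero a i M → i < d := fun i hi => lt_of_le_of_ne (hle i hi)
      (by rintro rfl; exact (hiff _).1 hi hs)
    cases d with
    | zero =>
      have : cohDim a M ≤ ⊥ := sSup_le (by
        rintro _ ⟨i, rfl, hi⟩; exact absurd (h1 i hi) (by omega))
      rw [h, le_bot_iff] at this
      exact WithBot.coe_ne_bot this
    | succ e =>
      have : cohDim a M ≤ ((e : ℕ∞) : WithBot ℕ∞) := sSup_le (by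
        rintro _ ⟨i, rfl, hi⟩
        have := h1 i hi
        have : i ≤ e := by omega
        exact_mod_cast this)
      rw [h] at this
      have : e + 1 ≤ e := by exact_mod_cast this
      omega
  · intro h
    refine le_antisymm (sSup_le ?_) (le_sSup ⟨d, rfl, (hiff d).2 h⟩)
    rintro _ ⟨i, rfl, hi⟩
    have := hle i hi
    exact_mod_cast this

end D7

end

end LCx

theorem stmt_13 {R : Type u} [CommRing R] [IsNoetherianRing R] [IsLocalRing R] (𝔞 : Ideal R)
    (d : ℕ) (hd : ringKrullDim R = (d : WithBot ℕ∞)) (htop : LCNonzero 𝔞 d R)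
    (n : ℕ) (q : Fin n → Ideal R) (p : Fin n → Ideal R)
    (hdec : (⨅ j, q j) = ⊥) (hprim : ∀ j, IsPrimarySubmodule (q j) (p j))
    (hdist : Function.Injective p)
    (hred : ∀ j, (⨅ k ∈ ({j}ᶜ : Set (Fin n)), q k) ≠ ⊥) :
    Module.annihilator R ((localCohomology 𝔞 d).obj (ModuleCat.of R R)) =
      ⨅ j ∈ {j : Fin n | cohDim 𝔞 (R ⧸ p j) = ((d : ℕ∞) : WithBot ℕ∞)}, q j := by
  rw [← (LCx.eqLC 𝔞 d R).annihilator_eq]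
  ext r
  simp only [Ideal.mem_iInf, Set.mem_ofPred_eq, LCx.cohDim_iff 𝔞 d hd.le, Module.mem_annihilator]
  constructor
  · intro hr j hj
    by_contra hc
    refine hj (LCx.stepC 𝔞 d hd.le r hr (p j) fun s hs => ?_)
    by_contra hsp
    exact hc (LCx.prim_reg (hprim j) hsp (by rw [hs]; exact zero_mem _))
  · intro hr x
    exact LCx.easy_incl 𝔞 d hd.le n q p hdec (fun j => LCx.prim_rad (hprim j)) r hr x
end

section
/- Let (R, 𝔪) be a local Noetherian ring, 𝔞 an ideal, M a nonzero finitely generated R-module of dimension d with H^d_𝔞(M) ≠ 0. Then Rad(Ann_R(H^d_𝔞(M))) = ∩ {𝔭 : 𝔭 ∈ Ass_R(M), cd(𝔞, R/𝔭) = d}. -/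
open CategoryTheory

universe u

namespace LC
open Opposite Limits

variable {R : Type u} [CommRing R]

/-- the contravariant hom functor, viewed as a functor to the opposite category. -/
noncomputable abbrev homF (Y : ModuleCat.{u} R) : ModuleCat.{u} R ⥤ (ModuleCat.{u} R)ᵒᵖ :=
  ((linearYoneda R (ModuleCat.{u} R)).obj Y).rightOp

noncomputable abbrev homK {X : ModuleCat.{u} R} (P : ProjectiveResolution X) (Y : ModuleCat.{u} R) :
    ChainComplex (ModuleCat.{u} R)ᵒᵖ ℕ :=
  ((homF Y).mapHomologicalComplex _).obj P.complex

/-- the Ext module in terms of a projective resolution. -/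
noncomputable def isoH {X : ModuleCat.{u} R} (P : ProjectiveResolution X) (Y : ModuleCat.{u} R) (n : ℕ) :
    ((homF Y).leftDerived n).obj X ≅ (homK P Y).homology n := P.isoLeftDerivedObj (homF Y) n

/-- `f` is a cocycle representing the Ext class `x`. -/
def Rep {X : ModuleCat.{u} R} (P : ProjectiveResolution X) {Y : ModuleCat.{u} R} {n : ℕ}
    (x : (((Ext R (ModuleCat.{u} R) n).obj (op X)).obj Y : ModuleCat.{u} R))
    (f : P.complex.X n ⟶ Y) : Prop :=
  ∃ z : (unop ((homK P Y).opcycles n) : ModuleCat.{u} R),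
    ((homK P Y).pOpcycles n).unop.hom z = f ∧
    ((isoH P Y n).hom ≫ (homK P Y).homologyι n).unop.hom z = x

variable {X : ModuleCat.{u} R} {P : ProjectiveResolution X} {Y : ModuleCat.{u} R} {n : ℕ}
  {x x' : (((Ext R (ModuleCat.{u} R) n).obj (op X)).obj Y : ModuleCat.{u} R)}
  {f f' : P.complex.X n ⟶ Y}

lemma Rep.add (h : Rep P x f) (h' : Rep P x' f') : Rep P (x + x') (f + f') := by
  obtain ⟨z, hz, hz'⟩ := h
  obtain ⟨w, hw, hw'⟩ := h'
  exact ⟨z + w, by rw [map_add, hz, hw]; rfl, by rw [map_add, hz', hw']; rfl⟩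

lemma Rep.smul (r : R) (h : Rep P x f) : Rep P (r • x) (r • f) := by
  obtain ⟨z, hz, hz'⟩ := h
  exact ⟨r • z, by rw [map_smul, hz]; rfl, by rw [map_smul, hz']; rfl⟩

lemma Rep.zero : Rep P (0 : (((Ext R (ModuleCat.{u} R) n).obj (op X)).obj Y : ModuleCat.{u} R))
    (0 : P.complex.X n ⟶ Y) := ⟨0, by rw [map_zero]; rfl, by rw [map_zero]; rfl⟩

lemma Rep.unique (h : Rep P x f) (h' : Rep P x' f) : x = x' := by
  obtain ⟨z, hz, hz'⟩ := h
  obtain ⟨w, hw, hw'⟩ := h'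
  have : Function.Injective ((homK P Y).pOpcycles n).unop.hom := by
    rw [← ModuleCat.mono_iff_injective]; infer_instance
  have : z = w := this (hz.trans hw.symm)
  rw [← hz', ← hw', this]

lemma Rep.exists_rep (P : ProjectiveResolution X)
    (x : (((Ext R (ModuleCat.{u} R) n).obj (op X)).obj Y : ModuleCat.{u} R)) : ∃ f, Rep P x f := by
  have : Function.Surjective
      ((isoH P Y n).hom ≫ (homK P Y).homologyι n).unop.hom := by
    rw [← ModuleCat.epi_iff_surjective]; infer_instance
  obtain ⟨z, hz⟩ := this x
  exact ⟨_, z, rfl, hz⟩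

lemma Rep.cocycle (h : Rep P x f) : P.complex.d (n+1) n ≫ f = 0 := by
  obtain ⟨z, rfl, hz'⟩ := h
  have := (homK P Y).d_pOpcycles (n+1) n
  have := congr($(this).unop.hom z)
  exact this

lemma Rep.of_cocycle (hf : P.complex.d (n+1) n ≫ f = 0) : ∃ x, Rep P (x : (((Ext R (ModuleCat.{u} R) n).obj (op X)).obj Y : ModuleCat.{u} R)) f := by
  have h := ShortComplex.exact_of_g_is_cokernel (ShortComplex.mk _ _ ((homK P Y).d_pOpcycles (n+1) n)) ((homK P Y).opcyclesIsCokernel (n+1) n (by simp))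
  have h2 := h.unop
  rw [ShortComplex.moduleCat_exact_iff] at h2
  obtain ⟨z, hz⟩ := h2 f hf
  exact ⟨_, z, hz, rfl⟩

lemma Rep.zero_iff : Rep P (0 : (((Ext R (ModuleCat.{u} R) n).obj (op X)).obj Y : ModuleCat.{u} R)) f ↔
    ∃ g : P.complex.X (n-1) ⟶ Y, f = P.complex.d n (n-1) ≫ g := by
  have hn : (ComplexShape.down ℕ).next n = n - 1 := by
    cases n <;> simp
  have h := (ShortComplex.exact_of_f_is_kernel (ShortComplex.mk _ _ ((homK P Y).homologyι_comp_fromOpcycles n (n-1))) ((homK P Y).homologyIsKernel n (n-1) hn)).unop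
  rw [ShortComplex.moduleCat_exact_iff] at h
  constructor
  · rintro ⟨z, hz, hz'⟩
    have e : ((homK P Y).homologyι n).unop.hom z = 0 := by
      have : Function.Injective (isoH P Y n).hom.unop.hom := by
        rw [← ModuleCat.mono_iff_injective]; infer_instance
      apply this
      rw [map_zero]
      exact hz'
    obtain ⟨g, hg⟩ := h z e
    refine ⟨g, ?_⟩
    rw [← hz, ← hg]
    have := (homK P Y).p_fromOpcycles n (n-1)
    exact congr($(this).unop.hom g)
  · rintro ⟨g, rfl⟩
    refine ⟨((homK P Y).fromOpcycles n (n-1)).unop.hom g, ?_, ?_⟩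
    · have := (homK P Y).p_fromOpcycles n (n-1)
      exact congr($(this).unop.hom g)
    · have := (homK P Y).homologyι_comp_fromOpcycles n (n-1)
      have := congr((isoH P Y n).hom.unop.hom ($(this).unop.hom g))
      refine Eq.trans this (map_zero _)

lemma Rep.mapX {X' : ModuleCat.{u} R} {Q : ProjectiveResolution X'} (u : X' ⟶ X)
    (φ : Q.complex ⟶ P.complex) (comm : φ.f 0 ≫ P.π.f 0 = Q.π.f 0 ≫ u) (h : Rep P x f) :
    Rep Q ((((Ext R (ModuleCat.{u} R) n).map u.op).app Y).hom x) (φ.f n ≫ f) := by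
  obtain ⟨z, rfl, rfl⟩ := h
  have e1 := HomologicalComplex.p_opcyclesMap (((homF Y).mapHomologicalComplex _).map φ) n
  have e2 : ((homF Y).leftDerived n).map u ≫ (isoH P Y n).hom = (isoH Q Y n).hom ≫
      HomologicalComplex.homologyMap (((homF Y).mapHomologicalComplex _).map φ) n :=
    ProjectiveResolution.isoLeftDerivedObj_hom_naturality u Q P φ comm (homF Y) n
  have e3 := HomologicalComplex.homologyι_naturality (((homF Y).mapHomologicalComplex _).map φ) n
  refine ⟨(HomologicalComplex.opcyclesMap (((homF Y).mapHomologicalComplex _).map φ) n).unop.hom z, ?_, ?_⟩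
  · exact congr($(e1).unop.hom z)
  · have e4 : ((isoH Q Y n).hom ≫ (homK Q Y).homologyι n) ≫ HomologicalComplex.opcyclesMap (((homF Y).mapHomologicalComplex _).map φ) n = ((homF Y).leftDerived n).map u ≫ ((isoH P Y n).hom ≫ (homK P Y).homologyι n) := by
      rw [Category.assoc, ← e3, ← Category.assoc, ← Category.assoc, e2]
    exact congr($(e4).unop.hom z)

lemma Rep.mapY {Y' : ModuleCat.{u} R} (g : Y ⟶ Y') (h : Rep P x f) :
    Rep P ((((Ext R (ModuleCat.{u} R) n).obj (op X)).map g).hom x) (f ≫ g) := by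
  obtain ⟨z, rfl, rfl⟩ := h
  let α : homF Y' ⟶ homF Y := NatTrans.rightOp ((linearYoneda R (ModuleCat.{u} R)).map g)
  let φ : homK P Y' ⟶ homK P Y := (NatTrans.mapHomologicalComplex α _).app P.complex
  have e1 := HomologicalComplex.p_opcyclesMap φ n
  have e2 : (NatTrans.leftDerived α n).app X = (isoH P Y' n).hom ≫
      HomologicalComplex.homologyMap φ n ≫ (isoH P Y n).inv :=
    ProjectiveResolution.leftDerived_app_eq α P n
  have e3 := HomologicalComplex.homologyι_naturality φ n
  refine ⟨(HomologicalComplex.opcyclesMap φ n).unop.hom z, ?_, ?_⟩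
  · exact congr($(e1).unop.hom z)
  · have e4 : ((isoH P Y' n).hom ≫ (homK P Y').homologyι n) ≫ HomologicalComplex.opcyclesMap φ n = (NatTrans.leftDerived α n).app X ≫ ((isoH P Y n).hom ≫ (homK P Y).homologyι n) := by
      rw [Category.assoc, ← e3, e2]
      simp [φ]
    exact congr($(e4).unop.hom z)



section LCpart
open localCohomology

variable (𝔞 : Ideal R)

noncomputable abbrev XX (t : ℕ) : ModuleCat.{u} R := ModuleCat.of R (R ⧸ 𝔞 ^ t)
noncomputable abbrev PP (t : ℕ) : ProjectiveResolution (XX 𝔞 t) := projectiveResolution _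
noncomputable abbrev dg (i : ℕ) : (ℕᵒᵖ)ᵒᵖ ⥤ ModuleCat.{u} R ⥤ ModuleCat.{u} R :=
  diagram (idealPowersDiagram 𝔞) i
noncomputable abbrev HH (i : ℕ) (M : ModuleCat.{u} R) : ModuleCat.{u} R := (localCohomology 𝔞 i).obj M

noncomputable def trX {t s : ℕ} (h : t ≤ s) : XX 𝔞 s ⟶ XX 𝔞 t :=
  (ringModIdeals (idealPowersDiagram 𝔞)).map (homOfLE h).op

noncomputable def trP {t s : ℕ} (h : t ≤ s) : (PP 𝔞 s).complex ⟶ (PP 𝔞 t).complex :=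
  ProjectiveResolution.lift (trX 𝔞 h) _ _

noncomputable def lcι (t i : ℕ) (M : ModuleCat.{u} R) :
    ((Ext R (ModuleCat.{u} R) i).obj (op (XX 𝔞 t))).obj M ⟶ HH 𝔞 i M :=
  (colimit.ι (dg 𝔞 i) (op (op t))).app M

lemma lcι_trans {t s : ℕ} (h : t ≤ s) (i : ℕ) (M : ModuleCat.{u} R) :
    ((Ext R (ModuleCat.{u} R) i).map (trX 𝔞 h).op).app M ≫ lcι 𝔞 s i M = lcι 𝔞 t i M :=
  congr(NatTrans.app $(colimit.w (dg 𝔞 i) (homOfLE h).op.op) M)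

lemma lcι_nat (t i : ℕ) {M N : ModuleCat.{u} R} (g : M ⟶ N) :
    ((Ext R (ModuleCat.{u} R) i).obj (op (XX 𝔞 t))).map g ≫ lcι 𝔞 t i N =
      lcι 𝔞 t i M ≫ (localCohomology 𝔞 i).map g :=
  (colimit.ι (dg 𝔞 i) (op (op t))).naturality g

noncomputable def isColim (i : ℕ) (M : ModuleCat.{u} R) :
    IsColimit (((evaluation _ _).obj M).mapCocone (colimit.cocone (dg 𝔞 i))) :=
  isColimitOfPreserves ((evaluation _ (ModuleCat.{u} R)).obj M) (colimit.isColimit (dg 𝔞 i))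

instance : PreservesFilteredColimitsOfSize.{0, 0} (forget (ModuleCat.{u} R)) :=
  preservesSmallestFilteredColimits_of_preservesFilteredColimits.{u, u} _

lemma lcι_surj {i : ℕ} {M : ModuleCat.{u} R} (x : HH 𝔞 i M) : ∃ t y, (lcι 𝔞 t i M).hom y = x := by
  obtain ⟨j, y, h⟩ := Concrete.isColimit_exists_rep _ (isColim 𝔞 i M) x
  exact ⟨j.unop.unop, y, h⟩

lemma lcι_zero {i t : ℕ} {M : ModuleCat.{u} R}
    (y : (((Ext R (ModuleCat.{u} R) i).obj (op (XX 𝔞 t))).obj M : ModuleCat.{u} R))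
    (h : (lcι 𝔞 t i M).hom y = 0) :
    ∃ s, ∃ hs : t ≤ s, (((Ext R (ModuleCat.{u} R) i).map (trX 𝔞 hs).op).app M).hom y = 0 := by
  have h2 : (lcι 𝔞 t i M).hom y = (lcι 𝔞 t i M).hom 0 := by rw [h, map_zero]
  obtain ⟨k, f, g, e⟩ := Concrete.isColimit_exists_of_rep_eq (dg 𝔞 i ⋙ (evaluation _ _).obj M)
    (isColim 𝔞 i M) (i := op (op t)) (j := op (op t)) y 0 h2
  refine ⟨k.unop.unop, leOfHom f.unop.unop, ?_⟩
  have : g = f := Subsingleton.elim _ _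
  subst this
  exact e.trans (map_zero _)

variable {𝔞}
/-- the cocycle `f` represents the local cohomology class `x`. -/
def RepL {i : ℕ} {M : ModuleCat.{u} R} (x : HH 𝔞 i M) (t : ℕ) (f : (PP 𝔞 t).complex.X i ⟶ M) : Prop :=
  ∃ y, Rep (PP 𝔞 t) y f ∧ (lcι 𝔞 t i M).hom y = x

variable {i t : ℕ} {M : ModuleCat.{u} R} {x x' : HH 𝔞 i M} {f f' : (PP 𝔞 t).complex.X i ⟶ M}

lemma RepL.add (h : RepL x t f) (h' : RepL x' t f') : RepL (x + x') t (f + f') := by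
  obtain ⟨y, hy, rfl⟩ := h
  obtain ⟨y', hy', rfl⟩ := h'
  exact ⟨y + y', hy.add hy', map_add _ _ _⟩

lemma RepL.smul (r : R) (h : RepL x t f) : RepL (r • x) t (r • f) := by
  obtain ⟨y, hy, rfl⟩ := h
  exact ⟨_, hy.smul r, map_smul _ _ _⟩

lemma RepL.zero : RepL (0 : HH 𝔞 i M) t 0 := ⟨0, Rep.zero, map_zero _⟩

lemma RepL.unique (h : RepL x t f) (h' : RepL x' t f) : x = x' := by
  obtain ⟨y, hy, rfl⟩ := h
  obtain ⟨y', hy', rfl⟩ := h'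
  rw [hy.unique hy']

lemma RepL.exists_rep (x : HH 𝔞 i M) : ∃ t f, RepL x t f := by
  obtain ⟨t, y, rfl⟩ := lcι_surj 𝔞 x
  obtain ⟨f, hf⟩ := Rep.exists_rep (PP 𝔞 t) y
  exact ⟨t, f, y, hf, rfl⟩

lemma RepL.cocycle (h : RepL x t f) : (PP 𝔞 t).complex.d (i+1) i ≫ f = 0 := by
  obtain ⟨y, hy, rfl⟩ := h
  exact hy.cocycle

lemma RepL.of_cocycle (hf : (PP 𝔞 t).complex.d (i+1) i ≫ f = 0) : ∃ x : HH 𝔞 i M, RepL x t f := by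
  obtain ⟨y, hy⟩ := Rep.of_cocycle hf
  exact ⟨_, y, hy, rfl⟩

lemma trP_comm {t s : ℕ} (h : t ≤ s) : (trP 𝔞 h).f 0 ≫ (PP 𝔞 t).π.f 0 = (PP 𝔞 s).π.f 0 ≫ trX 𝔞 h :=
  ProjectiveResolution.lift_commutes_zero _ _ _

lemma RepL.trans {s : ℕ} (hs : t ≤ s) (h : RepL x t f) : RepL x s ((trP 𝔞 hs).f i ≫ f) := by
  obtain ⟨y, hy, rfl⟩ := h
  exact ⟨_, hy.mapX (trX 𝔞 hs) (trP 𝔞 hs) (trP_comm hs), congr(($(lcι_trans 𝔞 hs i M)).hom y)⟩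

lemma RepL.map {N : ModuleCat.{u} R} (g : M ⟶ N) (h : RepL x t f) :
    RepL (((localCohomology 𝔞 i).map g).hom x) t (f ≫ g) := by
  obtain ⟨y, hy, rfl⟩ := h
  exact ⟨_, hy.mapY g, congr(($(lcι_nat 𝔞 t i g)).hom y)⟩

lemma RepL.of_zero (h : RepL (0 : HH 𝔞 i M) t f) : ∃ s, ∃ hs : t ≤ s,
    ∃ g : (PP 𝔞 s).complex.X (i-1) ⟶ M, (trP 𝔞 hs).f i ≫ f = (PP 𝔞 s).complex.d i (i-1) ≫ g := by
  obtain ⟨y, hy, h0⟩ := h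
  obtain ⟨s, hs, e⟩ := lcι_zero 𝔞 y h0
  have := hy.mapX (trX 𝔞 hs) (trP 𝔞 hs) (trP_comm hs)
  rw [e] at this
  exact ⟨s, hs, Rep.zero_iff.1 this⟩

lemma RepL.eq_zero {g : (PP 𝔞 t).complex.X (i-1) ⟶ M} (h : RepL x t ((PP 𝔞 t).complex.d i (i-1) ≫ g)) :
    x = 0 := by
  have : Rep (PP 𝔞 t) 0 ((PP 𝔞 t).complex.d i (i-1) ≫ g) := Rep.zero_iff.2 ⟨g, rfl⟩
  exact h.unique ⟨_, this, map_zero _⟩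

lemma smul_id_comm {A B : ModuleCat.{u} R} (r : R) (a : A ⟶ B) :
    (r • 𝟙 A) ≫ a = a ≫ (r • 𝟙 B) := by simp

lemma RepL.torsion (h : RepL x t f) (r : R) (hr : r ∈ 𝔞 ^ t) : r • x = 0 := by
  obtain ⟨y, hy, rfl⟩ := h
  have hz : r • (𝟙 (XX 𝔞 t)) = 0 := by
    refine ModuleCat.hom_ext (LinearMap.ext fun z => ?_)
    obtain ⟨z, rfl⟩ := Ideal.Quotient.mk_surjective z
    change r • (Ideal.Quotient.mk (𝔞^t) z) = 0
    rw [Algebra.smul_def]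
    change Ideal.Quotient.mk (𝔞^t) r * _ = 0
    rw [Ideal.Quotient.eq_zero_iff_mem.2 hr, zero_mul]
  have h1 := hy.mapX (r • (𝟙 (XX 𝔞 t))) (r • 𝟙 _) (smul_id_comm r _)
  have h2 := hy.mapX (Q := PP 𝔞 t) (r • (𝟙 (XX 𝔞 t))) 0 (by
    rw [hz]; exact zero_comp.trans comp_zero.symm)
  have h3 := hy.smul r
  have e : r • f = (r • 𝟙 (PP 𝔞 t).complex : (PP 𝔞 t).complex ⟶ (PP 𝔞 t).complex).f i ≫ f := by
    simp
  rw [e] at h3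
  have e1 := h1.unique h3
  have e2 := h2.unique (x' := 0) (by simpa using Rep.zero)
  rw [← map_smul, ← e1, e2, map_zero]



lemma H_exact {S : ShortComplex (ModuleCat.{u} R)} (hS : S.ShortExact) (x : HH 𝔞 i S.X₂)
    (hx : ((localCohomology 𝔞 i).map S.g).hom x = 0) :
    ∃ y, ((localCohomology 𝔞 i).map S.f).hom y = x := by
  have := hS.mono_f
  have := hS.epi_g
  obtain ⟨t, f, hf⟩ := RepL.exists_rep x
  have h1 := hf.map S.g
  rw [hx] at h1
  obtain ⟨s, hs, g, hg⟩ := h1.of_zero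
  have hf' := hf.trans hs
  let g' := Projective.factorThru g S.g
  have hg' : g' ≫ S.g = g := Projective.factorThru_comp _ _
  have hb : RepL (0 : HH 𝔞 i S.X₂) s ((PP 𝔞 s).complex.d i (i-1) ≫ g') := by
    obtain ⟨w, hw⟩ := RepL.of_cocycle (𝔞 := 𝔞) (i := i) (t := s) (M := S.X₂) (f := (PP 𝔞 s).complex.d i (i-1) ≫ g') (by simp)
    have := hw.eq_zero
    rwa [this] at hw
  have h2 := hf'.add (hb.smul (-1))
  rw [smul_zero, add_zero] at h2
  have h3 : ((trP 𝔞 hs).f i ≫ f + (-1 : R) • (PP 𝔞 s).complex.d i (i-1) ≫ g') ≫ S.g = 0 := by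
    rw [Preadditive.add_comp, Linear.smul_comp, Category.assoc, hg, Category.assoc, hg']
    simp
  let k := hS.exact.lift _ h3
  have hk : k ≫ S.f = _ := hS.exact.lift_f _ h3
  obtain ⟨y, hy⟩ := RepL.of_cocycle (𝔞 := 𝔞) (i := i) (t := s) (f := k) (by
    rw [← cancel_mono S.f, Category.assoc, hk, h2.cocycle, zero_comp])
  refine ⟨y, ?_⟩
  have h4 := hy.map S.f
  rw [hk] at h4
  exact h4.unique h2

lemma H_surj {S : ShortComplex (ModuleCat.{u} R)} (hS : S.ShortExact)
    (h : Subsingleton (HH 𝔞 (i+1) S.X₁)) :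
    Function.Surjective ((localCohomology 𝔞 i).map S.g).hom := by
  have := hS.mono_f
  have := hS.epi_g
  intro x
  obtain ⟨t, f, hf⟩ := RepL.exists_rep x
  let f' := Projective.factorThru f S.g
  have hf' : f' ≫ S.g = f := Projective.factorThru_comp _ _
  have h1 : ((PP 𝔞 t).complex.d (i+1) i ≫ f') ≫ S.g = 0 := by
    rw [Category.assoc, hf', hf.cocycle]
  let k := hS.exact.lift _ h1
  have hk : k ≫ S.f = _ := hS.exact.lift_f _ h1
  obtain ⟨y, hy⟩ := RepL.of_cocycle (𝔞 := 𝔞) (i := i+1) (t := t) (f := k) (by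
    rw [← cancel_mono S.f, Category.assoc, hk]; simp)
  rw [Subsingleton.elim y 0] at hy
  obtain ⟨s, hs, g, hg⟩ := hy.of_zero
  change (PP 𝔞 s).complex.X i ⟶ _ at g
  change _ = (PP 𝔞 s).complex.d (i+1) i ≫ g at hg
  obtain ⟨w, hw⟩ := RepL.of_cocycle (𝔞 := 𝔞) (i := i) (t := s)
      (f := (trP 𝔞 hs).f i ≫ f' - g ≫ S.f) (by
    rw [Preadditive.comp_sub, ← Category.assoc _ g, ← hg, Category.assoc _ k, hk]
    simp)
  refine ⟨w, ?_⟩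
  have h2 := hw.map S.g
  have h3 : ((trP 𝔞 hs).f i ≫ f' - g ≫ S.f) ≫ S.g = (trP 𝔞 hs).f i ≫ f := by
    simp [hf']
  rw [h3] at h2
  exact h2.unique (hf.trans hs)

lemma H_inj {S : ShortComplex (ModuleCat.{u} R)} (hS : S.ShortExact)
    (h : Function.Surjective ((localCohomology 𝔞 i).map S.g).hom) :
    Function.Injective ((localCohomology 𝔞 (i+1)).map S.f).hom := by
  have := hS.mono_f
  have := hS.epi_g
  rw [injective_iff_map_eq_zero]
  intro x hx
  obtain ⟨t, f, hf⟩ := RepL.exists_rep x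
  have h1 := hf.map S.f
  rw [hx] at h1
  obtain ⟨s, hs, g, hg⟩ := h1.of_zero
  change (PP 𝔞 s).complex.X i ⟶ _ at g
  change _ = (PP 𝔞 s).complex.d (i+1) i ≫ g at hg
  obtain ⟨c, hc⟩ := RepL.of_cocycle (𝔞 := 𝔞) (i := i) (t := s) (f := g ≫ S.g) (by
    rw [← Category.assoc, ← hg]; simp)
  obtain ⟨b, rfl⟩ := h c
  obtain ⟨t', b', hb⟩ := RepL.exists_rep b
  have hc1 := hc.trans (le_max_left s t')
  have hb1 := hb.trans (le_max_right s t')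
  have h2 := (hb1.map S.g).smul (-1)
  have h3 := hc1.add h2
  rw [neg_smul, one_smul, add_neg_cancel] at h3
  obtain ⟨s2, hs2, e, he⟩ := h3.of_zero
  let e' := Projective.factorThru e S.g
  have he' : e' ≫ S.g = e := Projective.factorThru_comp _ _
  let G := (trP 𝔞 hs2).f i ≫ ((trP 𝔞 (le_max_left s t')).f i ≫ g + (-1 : R) • ((trP 𝔞 (le_max_right s t')).f i ≫ b')) - (PP 𝔞 s2).complex.d i (i-1) ≫ e'
  have hG : G ≫ S.g = 0 := by
    simp only [G, Preadditive.sub_comp, Category.assoc, he', ← he, Preadditive.add_comp, Linear.smul_comp, sub_self]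
  let k := hS.exact.lift _ hG
  have hk : k ≫ S.f = _ := hS.exact.lift_f _ hG
  have h5 := ((hf.trans hs).trans (le_max_left s t')).trans hs2
  have h6 : (trP 𝔞 hs2).f (i+1) ≫ (trP 𝔞 (le_max_left s t')).f (i+1) ≫ (trP 𝔞 hs).f (i+1) ≫ f = (PP 𝔞 s2).complex.d (i+1) i ≫ k := by
    rw [← cancel_mono S.f]
    have hbc := (hb1.trans hs2).cocycle
    simp only [Category.assoc, hk, G] at hg ⊢
    rw [hg]
    simp [hbc]
  rw [h6] at h5
  exact RepL.eq_zero (i := i+1) (g := k) h5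

lemma H_injective (E : ModuleCat.{u} R) [Injective E] : Subsingleton (HH 𝔞 (i+1) E) := by
  refine subsingleton_of_forall_eq 0 fun x => ?_
  obtain ⟨t, f, hf⟩ := RepL.exists_rep x
  have hex := (PP 𝔞 t).exact_succ i
  have : ∃ g, (PP 𝔞 t).complex.d (i+1) i ≫ g = f := ⟨hex.descToInjective f hf.cocycle, hex.comp_descToInjective _ _⟩
  obtain ⟨g, rfl⟩ := this
  exact RepL.eq_zero (i := i+1) (g := g) hf

lemma H_torsion (x : HH 𝔞 i M) : ∃ t, ∀ r ∈ 𝔞 ^ t, r • x = 0 := by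
  obtain ⟨t, f, hf⟩ := RepL.exists_rep x
  exact ⟨t, fun r hr => hf.torsion r hr⟩

lemma H_smul (r : R) (x : HH 𝔞 i M) :
    ((localCohomology 𝔞 i).map (r • 𝟙 M)).hom x = r • x := by
  obtain ⟨t, f, hf⟩ := RepL.exists_rep x
  have h1 := hf.map (r • 𝟙 M)
  rw [Linear.comp_smul, Category.comp_id] at h1
  exact h1.unique (hf.smul r)

lemma H_zero [Subsingleton M] : Subsingleton (HH 𝔞 i M) := by
  refine subsingleton_of_forall_eq 0 fun x => ?_
  obtain ⟨t, f, hf⟩ := RepL.exists_rep x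
  have : f = 0 := ModuleCat.hom_ext (LinearMap.ext fun z => Subsingleton.elim _ _)
  rw [this] at hf
  exact hf.unique RepL.zero

/-- degree zero: torsion epimorphism. -/
lemma H0_surj {N : ModuleCat.{u} R} (g : M ⟶ N) (hg : Function.Surjective g.hom)
    (hM : ∀ m : M, ∃ k, ∀ r ∈ 𝔞 ^ k, r • m = 0) :
    Function.Surjective ((localCohomology 𝔞 0).map g).hom := by
  intro x
  obtain ⟨t, f, hf⟩ := RepL.exists_rep x
  -- `f` factors through `R / 𝔞 ^ t`
  have hex := (PP 𝔞 t).exact₀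
  have hepi : Epi ((PP 𝔞 t).π.f 0) := inferInstance
  let f1 : XX 𝔞 t ⟶ N := hex.desc f hf.cocycle
  have hf1 : (PP 𝔞 t).π.f 0 ≫ f1 = f := hex.g_desc _ _
  obtain ⟨m, hm⟩ := hg (f1.hom (Ideal.Quotient.mk _ 1))
  obtain ⟨k, hk⟩ := hM m
  let s := max t k
  let h2 : XX 𝔞 s ⟶ M := ModuleCat.ofHom ((𝔞 ^ s).liftQ (LinearMap.toSpanSingleton R M m) (by
    intro r hr
    exact hk r (Ideal.pow_le_pow_right (le_max_right _ _) hr)))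
  have e : h2 ≫ g = trX 𝔞 (le_max_left t k) ≫ f1 := by
    refine ModuleCat.hom_ext (LinearMap.ext fun z => ?_)
    obtain ⟨z, rfl⟩ := Ideal.Quotient.mk_surjective z
    change g.hom (z • m) = f1.hom (Ideal.Quotient.mk _ z)
    rw [map_smul, hm, ← map_smul]
    congr 1
    change Ideal.Quotient.mk _ (z * 1) = _
    rw [mul_one]
  obtain ⟨y, hy⟩ := RepL.of_cocycle (𝔞 := 𝔞) (i := 0) (t := s) (f := (PP 𝔞 s).π.f 0 ≫ h2) (by
    exact (Category.assoc _ _ _).symm.trans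
      (congr($((PP 𝔞 s).complex_d_comp_π_f_zero) ≫ h2).trans zero_comp))
  refine ⟨y, ?_⟩
  have h3 := hy.map g
  have h4 := hf.trans (le_max_left t k)
  have e2 : (trP 𝔞 (le_max_left t k)).f 0 ≫ f = ((PP 𝔞 s).π.f 0 ≫ h2) ≫ g := by
    rw [← hf1, ← Category.assoc, trP_comm]
    exact congr((PP 𝔞 s).π.f 0 ≫ $e).symm
  rw [e2] at h4
  exact h3.unique h4

end LCpart


section vanishing
open localCohomology

variable (𝔞 : Ideal R)

noncomputable abbrev Hm (i : ℕ) (M : Type u) [AddCommGroup M] [Module R M] : ModuleCat.{u} R :=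
  HH 𝔞 i (ModuleCat.of R M)

noncomputable def Hmap (i : ℕ) {M N : Type u} [AddCommGroup M] [Module R M] [AddCommGroup N] [Module R N]
    (f : M →ₗ[R] N) : Hm 𝔞 i M →ₗ[R] Hm 𝔞 i N :=
  ((localCohomology 𝔞 i).map (ModuleCat.ofHom f)).hom

section ses
variable {A B C : Type u} [AddCommGroup A] [Module R A] [AddCommGroup B] [Module R B]
  [AddCommGroup C] [Module R C] {f : A →ₗ[R] B} {g : B →ₗ[R] C} {i : ℕ}

lemma ses (hf : Function.Injective f) (hg : Function.Surjective g) (h : Function.Exact f g) :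
    (ModuleCat.shortComplexOfCompEqZero f g h.linearMap_comp_eq_zero).ShortExact :=
  ModuleCat.shortComplex_shortExact _ h hf hg

lemma Hm_exact (hf : Function.Injective f) (hg : Function.Surjective g) (h : Function.Exact f g)
    (x : Hm 𝔞 i B) (hx : Hmap 𝔞 i g x = 0) : ∃ y, Hmap 𝔞 i f y = x :=
  H_exact (ses hf hg h) x hx

lemma Hm_surj (hf : Function.Injective f) (hg : Function.Surjective g) (h : Function.Exact f g)
    (hA : Subsingleton (Hm 𝔞 (i+1) A)) : Function.Surjective (Hmap 𝔞 i g) :=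
  H_surj (ses hf hg h) hA

lemma Hm_inj (hf : Function.Injective f) (hg : Function.Surjective g) (h : Function.Exact f g)
    (hA : Function.Surjective (Hmap 𝔞 i g)) : Function.Injective (Hmap 𝔞 (i+1) f) :=
  H_inj (ses hf hg h) hA

lemma Hm_mid (hf : Function.Injective f) (hg : Function.Surjective g) (h : Function.Exact f g)
    (hA : Subsingleton (Hm 𝔞 i A)) (hC : Subsingleton (Hm 𝔞 i C)) : Subsingleton (Hm 𝔞 i B) := by
  refine subsingleton_of_forall_eq 0 fun x => ?_
  obtain ⟨y, rfl⟩ := Hm_exact 𝔞 hf hg h x (Subsingleton.elim _ _)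
  rw [Subsingleton.elim y 0, map_zero]

lemma Hmap_lsmul (r : R) (x : Hm 𝔞 i A) : Hmap 𝔞 i (LinearMap.lsmul R A r) x = r • x :=
  H_smul r x

end ses

/-- the `𝔞`-torsion submodule. -/
def Gam (M : Type u) [AddCommGroup M] [Module R M] : Submodule R M where
  carrier := {m | ∃ k, ∀ r ∈ 𝔞 ^ k, r • m = 0}
  add_mem' := by
    rintro a b ⟨k, hk⟩ ⟨l, hl⟩
    refine ⟨max k l, fun r hr => ?_⟩
    rw [smul_add, hk r (Ideal.pow_le_pow_right (le_max_left _ _) hr),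
      hl r (Ideal.pow_le_pow_right (le_max_right _ _) hr), add_zero]
  zero_mem' := ⟨0, fun r _ => smul_zero r⟩
  smul_mem' := by
    rintro c a ⟨k, hk⟩
    exact ⟨k, fun r hr => by rw [smul_comm, hk r hr, smul_zero]⟩

variable {M : Type u} [AddCommGroup M] [Module R M]

lemma mem_Gam {m : M} : m ∈ Gam 𝔞 M ↔ ∃ k, ∀ r ∈ 𝔞 ^ k, r • m = 0 := Iff.rfl

lemma Gam_uniform {N : Submodule R M} (hN : N.FG) (h : N ≤ Gam 𝔞 M) :
    ∃ k, ∀ n ∈ N, ∀ r ∈ 𝔞 ^ k, r • n = 0 := by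
  obtain ⟨S, rfl⟩ := hN
  have h1 : ∀ n ∈ S, ∃ k, ∀ r ∈ 𝔞 ^ k, r • n = 0 := fun n hn => h (Submodule.subset_span hn)
  choose! k hk using h1
  refine ⟨S.sup k, fun n hn r hr => ?_⟩
  induction hn using Submodule.span_induction with
  | mem x hx => exact hk x hx r (Ideal.pow_le_pow_right (Finset.le_sup hx) hr)
  | zero => exact smul_zero r
  | add x y _ _ hx hy => rw [smul_add, hx, hy, add_zero]
  | smul a x _ hx => rw [smul_comm, hx, smul_zero]

lemma Gam_injective [IsNoetherianRing R] [Module.Injective R M] : Module.Injective R (Gam 𝔞 M) := by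
  refine Module.Baer.injective fun I g => ?_
  -- uniform exponent
  obtain ⟨t, ht⟩ := Gam_uniform 𝔞 (N := LinearMap.range ((Gam 𝔞 M).subtype ∘ₗ g))
    (by rw [LinearMap.range_eq_map]; exact (Module.Finite.fg_top).map _)
    (by rintro _ ⟨x, rfl⟩; exact (g x).2)
  obtain ⟨k, hk⟩ := Ideal.exists_pow_inf_eq_pow_smul 𝔞 (I : Submodule R R)
  let s := t + k
  let q : I →ₗ[R] R ⧸ 𝔞 ^ s := (Submodule.mkQ (𝔞 ^ s)) ∘ₗ (Submodule.subtype I)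
  let g0 : I →ₗ[R] M := (Gam 𝔞 M).subtype ∘ₗ g
  have hker : LinearMap.ker q ≤ LinearMap.ker g0 := by
    rintro ⟨x, hx⟩ hxq
    have hx1 : x ∈ 𝔞 ^ s := by
      have : (Submodule.mkQ (𝔞 ^ s)) x = 0 := hxq
      rwa [Submodule.mkQ_apply, Submodule.Quotient.mk_eq_zero] at this
    have hx2 : x ∈ 𝔞 ^ s • (⊤ : Submodule R R) ⊓ I := ⟨by simpa using hx1, hx⟩
    rw [hk s (Nat.le_add_left _ _), Nat.add_sub_cancel] at hx2
    have hx3 : x ∈ 𝔞 ^ t • (I : Submodule R R) := Submodule.smul_mono le_rfl inf_le_right hx2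
    have key : ∀ y ∈ 𝔞 ^ t • (I : Submodule R R), ∃ hy : y ∈ I, g0 ⟨y, hy⟩ = 0 := by
      intro y hy
      refine Submodule.smul_induction_on hy ?_ ?_
      · intro r hr n hn
        refine ⟨I.smul_mem r hn, ?_⟩
        have : (⟨r • n, I.smul_mem r hn⟩ : I) = r • ⟨n, hn⟩ := rfl
        rw [this, map_smul]
        exact ht _ ⟨_, rfl⟩ r hr
      · rintro a b ⟨ha, ha'⟩ ⟨hb, hb'⟩
        refine ⟨I.add_mem ha hb, ?_⟩
        have : (⟨a + b, I.add_mem ha hb⟩ : I) = ⟨a, ha⟩ + ⟨b, hb⟩ := rfl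
        rw [this, map_add, ha', hb', add_zero]
    exact (key x hx3).2
  let j := (LinearMap.ker q).liftQ q le_rfl
  have hj : Function.Injective j := LinearMap.ker_eq_bot.1 (Submodule.ker_liftQ_eq_bot _ _ _ le_rfl)
  obtain ⟨h, hh⟩ := Module.Injective.out j hj ((LinearMap.ker q).liftQ g0 hker)
  have hmem : h (Submodule.Quotient.mk 1) ∈ Gam 𝔞 M := by
    refine ⟨s, fun r hr => ?_⟩
    rw [← map_smul, ← Submodule.Quotient.mk_smul, smul_eq_mul, mul_one,
      (Submodule.Quotient.mk_eq_zero _).2 hr, map_zero]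
  refine ⟨LinearMap.toSpanSingleton R _ ⟨_, hmem⟩, fun x mem => ?_⟩
  apply Subtype.ext
  have := hh (Submodule.Quotient.mk ⟨x, mem⟩)
  change h (Submodule.Quotient.mk x) = ((g ⟨x, mem⟩ : Gam 𝔞 M) : M) at this
  rw [← this]
  change x • h (Submodule.Quotient.mk 1) = _
  rw [← map_smul, ← Submodule.Quotient.mk_smul, smul_eq_mul, mul_one]

lemma exists_torsion_injective [IsNoetherianRing R] (N : Type u) [AddCommGroup N] [Module R N]
    (hN : Gam 𝔞 N = ⊤) : ∃ (J : Type u) (_ : AddCommGroup J) (_ : Module R J),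
      Injective (ModuleCat.of R J) ∧ Gam 𝔞 J = ⊤ ∧ ∃ f : N →ₗ[R] J, Function.Injective f := by
  let E := Injective.under (ModuleCat.of R N)
  have hE : Injective (ModuleCat.of R E) := inferInstanceAs (Injective (Injective.under _))
  have : Module.Injective R E := Module.injective_module_of_injective_object R E
  have hJ := Gam_injective 𝔞 (M := E)
  let ι : N →ₗ[R] E := (Injective.ι (ModuleCat.of R N)).hom
  have hι : Function.Injective ι := (ModuleCat.mono_iff_injective _).1 (inferInstance : Mono (Injective.ι (ModuleCat.of R N)))
  refine ⟨Gam 𝔞 E, inferInstance, inferInstance, Module.injective_object_of_injective_module R _, ?_, ?_⟩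
  · rw [eq_top_iff]
    rintro ⟨x, k, hk⟩ -
    exact ⟨k, fun r hr => Subtype.ext (hk r hr)⟩
  · refine ⟨ι.codRestrict _ fun n => ?_, fun a b hab => hι congr(($hab : E))⟩
    obtain ⟨k, hk⟩ : n ∈ Gam 𝔞 N := by rw [hN]; trivial
    exact ⟨k, fun r hr => by rw [← map_smul, hk r hr, map_zero]⟩

lemma Gam_quot {N : Submodule R M} (hM : Gam 𝔞 M = ⊤) : Gam 𝔞 (M ⧸ N) = ⊤ := by
  rw [eq_top_iff]
  intro x _
  obtain ⟨x, rfl⟩ := Submodule.mkQ_surjective N x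
  obtain ⟨k, hk⟩ : x ∈ Gam 𝔞 M := by rw [hM]; trivial
  exact ⟨k, fun r hr => by rw [← map_smul, hk r hr, map_zero]⟩

lemma torsion_vanish [IsNoetherianRing R] (i : ℕ) : ∀ (N : Type u) [AddCommGroup N] [Module R N],
    Gam 𝔞 N = ⊤ → Subsingleton (Hm 𝔞 (i+1) N) := by
  induction i with
  | zero =>
    intro N _ _ hN
    obtain ⟨J, _, _, hJ, hJt, f, hf⟩ := exists_torsion_injective 𝔞 N hN
    have := Hm_inj 𝔞 (i := 0) hf (Submodule.mkQ_surjective _) (LinearMap.exact_map_mkQ_range f)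
      (H0_surj (ModuleCat.ofHom _) (Submodule.mkQ_surjective _) (fun m => by
        have : m ∈ Gam 𝔞 J := by rw [hJt]; trivial
        exact this))
    have h2 : Subsingleton (Hm 𝔞 (0+1) J) := H_injective _
    exact this.subsingleton
  | succ i ih =>
    intro N _ _ hN
    obtain ⟨J, _, _, hJ, hJt, f, hf⟩ := exists_torsion_injective 𝔞 N hN
    have h1 := ih (J ⧸ LinearMap.range f) (Gam_quot 𝔞 hJt)
    have := Hm_inj 𝔞 (i := i+1) hf (Submodule.mkQ_surjective _) (LinearMap.exact_map_mkQ_range f)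
      (Function.surjective_to_subsingleton _)
    have h2 : Subsingleton (Hm 𝔞 (i+1+1) J) := H_injective _
    exact this.subsingleton

open scoped Pointwise in
/-- Grothendieck vanishing. -/
theorem vanish [IsNoetherianRing R] [IsLocalRing R] (i : ℕ) : ∀ (N : Type u) [AddCommGroup N] [Module R N]
    [Module.Finite R N], Module.supportDim R N < (i : ℕ) → Subsingleton (Hm 𝔞 i N) := by
  induction i with
  | zero =>
    intro N _ _ _ h
    have : Subsingleton N := by
      rw [← Module.supportDim_eq_bot_iff_subsingleton R N]
      rcases h' : Module.supportDim R N with _ | a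
      · rfl
      · rw [h'] at h
        exact absurd (WithBot.coe_lt_coe.1 h) (by simp)
    exact H_zero
  | succ i ih =>
    intro N _ _ _ h
    by_cases ha : 𝔞 = ⊤
    · refine subsingleton_of_forall_eq 0 fun x => ?_
      obtain ⟨t, ht⟩ := H_torsion x
      rw [← one_smul R x]
      exact ht 1 (by rw [ha, Ideal.top_pow]; trivial)
    have hG : Gam 𝔞 (Gam 𝔞 N) = ⊤ := by
      rw [eq_top_iff]
      rintro ⟨x, k, hk⟩ -
      exact ⟨k, fun r hr => Subtype.ext (hk r hr)⟩
    refine Hm_mid 𝔞 (Gam 𝔞 N).injective_subtype (Submodule.mkQ_surjective (Gam 𝔞 N))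
      (LinearMap.exact_subtype_mkQ _) (torsion_vanish 𝔞 i _ hG) ?_
    have hdim : Module.supportDim R (N ⧸ Gam 𝔞 N) < ((i + 1 : ℕ) : WithBot ℕ∞) :=
      (Module.supportDim_le_of_surjective _ (Submodule.mkQ_surjective (Gam 𝔞 N))).trans_lt h
    -- no torsion in the quotient
    have hhom : Subsingleton ((R ⧸ 𝔞) →ₗ[R] (N ⧸ Gam 𝔞 N)) := by
      refine subsingleton_of_forall_eq 0 fun φ => ?_
      obtain ⟨y, hy⟩ := Submodule.mkQ_surjective (Gam 𝔞 N) (φ (Submodule.Quotient.mk 1))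
      obtain ⟨K, hK⟩ := Gam_uniform 𝔞 (N := Gam 𝔞 N) (IsNoetherian.noetherian _) le_rfl
      have hy0 : y ∈ Gam 𝔞 N := by
        refine ⟨K + 1, fun r hr => ?_⟩
        rw [pow_succ] at hr
        refine Submodule.mul_induction_on hr ?_ ?_
        · intro m hm n hn
          rw [mul_smul]
          refine hK _ ?_ m hm
          rw [← Submodule.Quotient.mk_eq_zero, Submodule.Quotient.mk_smul]
          change n • (Submodule.mkQ (Gam 𝔞 N)) y = 0
          rw [hy, ← map_smul, ← Submodule.Quotient.mk_smul, smul_eq_mul, mul_one,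
            (Submodule.Quotient.mk_eq_zero _).2 hn, map_zero]
        · intro a b h1 h2
          rw [add_smul, h1, h2, add_zero]
      ext
      change φ (Submodule.Quotient.mk 1) = 0
      rw [← hy, Submodule.mkQ_apply, (Submodule.Quotient.mk_eq_zero _).2 hy0]
    obtain ⟨r, hr, hreg⟩ := IsSMulRegular.subsingleton_linearMap_iff.1 hhom
    rw [Ideal.annihilator_quotient] at hr
    by_cases hnt : Subsingleton (N ⧸ Gam 𝔞 N)
    · exact H_zero
    have hnt := not_subsingleton_iff_nontrivial.1 hnt
    have hrm : r ∈ IsLocalRing.maximalIdeal R := IsLocalRing.le_maximalIdeal ha hr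
    have hq := Module.supportDim_quotSMulTop_succ_eq_supportDim hreg hrm
    have hq2 : Module.supportDim R (QuotSMulTop r (N ⧸ Gam 𝔞 N)) < (i : ℕ) := by
      by_contra hcon
      rw [not_lt] at hcon
      have := add_le_add_left hcon 1
      rw [hq] at this
      exact absurd hdim (not_lt.2 (by exact_mod_cast this))
    have h1 := ih _ hq2
    have hinj := Hm_inj 𝔞 (i := i) (f := LinearMap.lsmul R (N ⧸ Gam 𝔞 N) r)
      (g := (r • (⊤ : Submodule R (N ⧸ Gam 𝔞 N))).mkQ) hreg (Submodule.mkQ_surjective _)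
      (LinearMap.exact_lsmul_mkQ_smul_top _ r) (fun y => ⟨0, h1.elim _ _⟩)
    refine subsingleton_of_forall_eq 0 fun x => ?_
    obtain ⟨t, ht⟩ := H_torsion x
    have hx : r ^ t • x = 0 := ht _ (Ideal.pow_mem_pow hr t)
    have hreg' : IsSMulRegular (Hm 𝔞 (i+1) (N ⧸ Gam 𝔞 N)) r := by
      intro a b hab
      apply hinj
      rw [Hmap_lsmul, Hmap_lsmul]
      exact hab
    refine (hreg'.pow t) ?_
    change r ^ t • x = r ^ t • 0
    rw [hx, smul_zero]

end vanishing


section final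

set_option linter.unusedSectionVars false

variable [IsNoetherianRing R] [IsLocalRing R] (𝔞 : Ideal R)

lemma lt_of_succ_le {x : WithBot ℕ∞} {d : ℕ} (h : x + 1 ≤ ((d : ℕ) : WithBot ℕ∞)) :
    x < ((d : ℕ) : WithBot ℕ∞) := by
  by_contra hcon
  rw [not_lt] at hcon
  have h1 := (add_le_add_left hcon 1).trans h
  have h2 : d + 1 ≤ d := by exact_mod_cast h1
  omega

lemma dim_drop {p : Ideal R} [hp : p.IsPrime] {d : ℕ}
    (hd : Module.supportDim R (R ⧸ p) ≤ ((d : ℕ) : WithBot ℕ∞)) {r : R} (hr : r ∉ p) :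
    Module.supportDim R (QuotSMulTop r (R ⧸ p)) < ((d : ℕ) : WithBot ℕ∞) := by
  refine lt_of_succ_le ((Module.supportDim_quotSMulTop_succ_le_of_notMem_minimalPrimes ?_).trans hd)
  rw [Ideal.annihilator_quotient, Ideal.minimalPrimes_eq_subsingleton_self]
  rintro q rfl
  exact hr

open scoped Pointwise in
lemma dim_drop' {p : Ideal R} [hp : p.IsPrime] {d : ℕ}
    (hd : Module.supportDim R (R ⧸ p) ≤ ((d : ℕ) : WithBot ℕ∞)) {J : Submodule R (R ⧸ p)}
    (hJ : J ≠ ⊥) :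
    Module.supportDim R ((R ⧸ p) ⧸ J) < ((d : ℕ) : WithBot ℕ∞) := by
  obtain ⟨x, hx, hx0⟩ := Submodule.exists_mem_ne_zero_of_ne_bot hJ
  obtain ⟨r, rfl⟩ := Submodule.mkQ_surjective p x
  have hr : r ∉ p := fun h => hx0 ((Submodule.Quotient.mk_eq_zero _).2 h)
  have hle : r • (⊤ : Submodule R (R ⧸ p)) ≤ J := by
    rintro y hy
    obtain ⟨z, -, rfl⟩ := (Submodule.mem_smul_pointwise_iff_exists _ _ _).1 hy
    obtain ⟨s, rfl⟩ := Submodule.mkQ_surjective p z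
    rw [← map_smul, smul_eq_mul, mul_comm, ← smul_eq_mul, map_smul]
    exact J.smul_mem _ hx
  exact (Module.supportDim_le_of_surjective (Submodule.factor hle)
    (Submodule.factor_surjective hle)).trans_lt (dim_drop hd hr)

open scoped Pointwise in
lemma part1 {M : Type u} [AddCommGroup M] [Module R M] [Module.Finite R M] {d : ℕ}
    (hd : Module.supportDim R M ≤ ((d : ℕ) : WithBot ℕ∞)) {p : Ideal R} (hp : p.IsPrime)
    (hann : Module.annihilator R M ≤ p)
    (hpd : Module.supportDim R (R ⧸ p) ≤ ((d : ℕ) : WithBot ℕ∞))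
    (hne : Nontrivial (Hm 𝔞 d (R ⧸ p))) {r : R}
    (hr : ∀ x : Hm 𝔞 d M, r • x = 0) : r ∈ p := by
  by_contra hrp
  have hreg : ∀ s, s ∉ p → IsSMulRegular (R ⧸ p) s := by
    intro s hs a b hab
    change s • a = s • b at hab
    rw [← sub_eq_zero, ← smul_sub] at hab
    rw [← sub_eq_zero]
    obtain ⟨c, hc⟩ := Submodule.mkQ_surjective p (a - b)
    rw [← hc, ← map_smul, Submodule.mkQ_apply, Submodule.Quotient.mk_eq_zero, smul_eq_mul] at hab
    rw [← hc, Submodule.mkQ_apply, Submodule.Quotient.mk_eq_zero]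
    exact (hp.mem_or_mem hab).resolve_left hs
  -- a nonzero map
  have hhom : ¬ Subsingleton (M →ₗ[R] (R ⧸ p)) := by
    rw [IsSMulRegular.subsingleton_linearMap_iff]
    rintro ⟨s, hs, hsreg⟩
    have h1 : (Submodule.mkQ p) 1 = 0 := hsreg (by
      change s • (Submodule.mkQ p) 1 = s • 0
      rw [← map_smul, smul_eq_mul, mul_one, smul_zero]
      exact (Submodule.Quotient.mk_eq_zero _).2 (hann hs))
    exact hp.ne_top ((Ideal.eq_top_iff_one _).2 ((Submodule.Quotient.mk_eq_zero _).1 h1))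
  rw [not_subsingleton_iff_nontrivial] at hhom
  obtain ⟨φ, hφ⟩ := exists_ne (0 : M →ₗ[R] (R ⧸ p))
  have hJ : LinearMap.range φ ≠ ⊥ := fun h => hφ (LinearMap.range_eq_bot.1 h)
  have hkill : ∀ x : Hm 𝔞 d (R ⧸ p), r • x = 0 := by
    intro x
    have hv := vanish 𝔞 d _ (dim_drop' hpd hJ)
    obtain ⟨y, rfl⟩ := Hm_exact 𝔞 (LinearMap.range φ).injective_subtype
      (Submodule.mkQ_surjective (LinearMap.range φ)) (LinearMap.exact_subtype_mkQ _) x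
      (hv.elim _ _)
    have hker : Subsingleton (Hm 𝔞 (d + 1) (LinearMap.ker φ)) := by
      refine vanish 𝔞 (d + 1) _ (((Module.supportDim_le_of_injective _
        (LinearMap.ker φ).injective_subtype).trans hd).trans_lt ?_)
      exact_mod_cast Nat.lt_succ_self d
    obtain ⟨z, rfl⟩ := Hm_surj 𝔞 (f := (LinearMap.ker φ).subtype) (g := φ.rangeRestrict)
      (LinearMap.ker φ).injective_subtype φ.surjective_rangeRestrict
      (by
        intro m
        constructor
        · intro hm
          exact ⟨⟨m, congrArg Subtype.val hm⟩, rfl⟩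
        · rintro ⟨n, rfl⟩
          exact Subtype.ext n.2) hker y
    rw [← map_smul, ← map_smul, hr z, map_zero, map_zero]
  obtain ⟨x, hx⟩ := exists_ne (0 : Hm 𝔞 d (R ⧸ p))
  have hv := vanish 𝔞 d _ (dim_drop hpd hrp)
  obtain ⟨y, hy⟩ := Hm_exact 𝔞 (f := LinearMap.lsmul R (R ⧸ p) r)
      (g := (r • (⊤ : Submodule R (R ⧸ p))).mkQ) (hreg r hrp) (Submodule.mkQ_surjective _)
      (LinearMap.exact_lsmul_mkQ_smul_top _ r) x (hv.elim _ _)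
  rw [Hmap_lsmul, hkill] at hy
  exact hx hy.symm

lemma Hmap_comp (i : ℕ) {A B C : Type u} [AddCommGroup A] [Module R A] [AddCommGroup B] [Module R B]
    [AddCommGroup C] [Module R C] (f : A →ₗ[R] B) (g : B →ₗ[R] C) (x : Hm 𝔞 i A) :
    Hmap 𝔞 i g (Hmap 𝔞 i f x) = Hmap 𝔞 i (g ∘ₗ f) x := by
  have := (localCohomology 𝔞 i).map_comp (ModuleCat.ofHom f) (ModuleCat.ofHom g)
  exact (congrArg (fun h => h.hom x) this).symm

lemma Hmap_id (i : ℕ) {A : Type u} [AddCommGroup A] [Module R A] (x : Hm 𝔞 i A) :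
    Hmap 𝔞 i (LinearMap.id : A →ₗ[R] A) x = x := by
  have := (localCohomology 𝔞 i).map_id (ModuleCat.of R A)
  exact congrArg (fun h => h.hom x) this

lemma Hmap_zero (i : ℕ) {A B : Type u} [AddCommGroup A] [Module R A] [AddCommGroup B] [Module R B]
    (x : Hm 𝔞 i A) : Hmap 𝔞 i (0 : A →ₗ[R] B) x = 0 := by
  have h : (0 : A →ₗ[R] B) = (0 : PUnit.{u+1} →ₗ[R] B) ∘ₗ (0 : A →ₗ[R] PUnit.{u+1}) := by
    ext; simp
  rw [h, ← Hmap_comp]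
  have : Subsingleton (Hm 𝔞 i PUnit.{u+1}) := H_zero
  rw [Subsingleton.elim (Hmap 𝔞 i (0 : A →ₗ[R] PUnit.{u+1}) x) 0, map_zero]

lemma part2 (d : ℕ) (r : R) {M : Type u} [AddCommGroup M] [Module R M] (hM : Module.Finite R M) :
    (∀ p ∈ Module.support R M, Nontrivial (Hm 𝔞 d (R ⧸ p.asIdeal)) → r ∈ p.asIdeal) →
      ∃ k : ℕ, ∀ x : Hm 𝔞 d M, r ^ k • x = 0 := by
  induction hM using IsNoetherianRing.induction_on_isQuotientEquivQuotientPrime R with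
  | subsingleton N =>
    intro _
    have : Subsingleton (Hm 𝔞 d N) := H_zero
    exact ⟨0, fun x => Subsingleton.elim _ _⟩
  | quotient N p e =>
    intro h
    have hp : p ∈ Module.support R N := by
      rw [e.support_eq, Module.support_eq_zeroLocus, Ideal.annihilator_quotient]
      exact fun x hx => hx
    have hinj : ∀ x : Hm 𝔞 d N, Hmap 𝔞 d e.symm.toLinearMap (Hmap 𝔞 d e.toLinearMap x) = x := by
      intro x
      rw [Hmap_comp]
      have : e.symm.toLinearMap ∘ₗ e.toLinearMap = LinearMap.id := by ext; simp
      rw [this, Hmap_id]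
    by_cases hnt : Nontrivial (Hm 𝔞 d (R ⧸ p.asIdeal))
    · refine ⟨1, fun x => ?_⟩
      rw [pow_one, ← Hmap_lsmul]
      have : LinearMap.lsmul R N r = 0 := by
        ext n
        apply e.injective
        obtain ⟨c, hc⟩ := Submodule.mkQ_surjective p.asIdeal (e n)
        change e (r • n) = e 0
        rw [map_smul, map_zero, ← hc, ← map_smul]
        exact (Submodule.Quotient.mk_eq_zero _).2 (p.asIdeal.mul_mem_right c (h p hp hnt))
      rw [this, Hmap_zero]
    · rw [not_nontrivial_iff_subsingleton] at hnt
      refine ⟨0, fun x => ?_⟩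
      rw [← hinj x, hnt.elim (Hmap 𝔞 d e.toLinearMap x) 0, map_zero, smul_zero]
  | exact N₁ N₂ N₃ f g hf hg hfg h₁ h₃ =>
    intro h
    obtain ⟨k, hk⟩ := h₁ fun p hp => h p (Module.support_subset_of_injective f hf hp)
    obtain ⟨l, hl⟩ := h₃ fun p hp => h p (Module.support_subset_of_surjective g hg hp)
    refine ⟨k + l, fun x => ?_⟩
    obtain ⟨y, hy⟩ := Hm_exact 𝔞 hf hg hfg (r ^ l • x) (by rw [map_smul, hl])
    rw [pow_add, mul_smul, ← hy, ← map_smul, hk, map_zero]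

end final

end LC

open LC in
/-- Over a local ring, with `dim M = d` and `H^d_𝔞(M) ≠ 0`,
`Rad(Ann_R(H^d_𝔞(M))) = ⋂ {p ∈ Ass_R M : cd(𝔞, R/p) = d}`. -/
theorem stmt_14 {R : Type u} [CommRing R] [IsNoetherianRing R] [IsLocalRing R] (𝔞 : Ideal R)
    (M : Type u) [AddCommGroup M] [Module R M] [Module.Finite R M] [Nontrivial M]
    (d : ℕ) (hd : modDim R M = (d : ℕ∞)) (htop : LCNonzero 𝔞 d M) :
    (Module.annihilator R ((localCohomology 𝔞 d).obj (ModuleCat.of R M))).radical =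
      sInf {p ∈ associatedPrimes R M | cohDim 𝔞 (R ⧸ p) = ((d : ℕ∞) : WithBot ℕ∞)} := by
  have hdim : Module.supportDim R M = ((d : ℕ) : WithBot ℕ∞) := by
    rw [Module.supportDim_eq_ringKrullDim_quotient_annihilator]
    exact hd
  have hdim' : Module.supportDim R (R ⧸ Module.annihilator R M) = ((d : ℕ) : WithBot ℕ∞) := by
    rw [Module.supportDim_quotient_eq_ringKrullDim]
    exact hd
  have hle : ∀ q : Ideal R, Module.annihilator R M ≤ q →
      Module.supportDim R (R ⧸ q) ≤ ((d : ℕ) : WithBot ℕ∞) := fun q hq =>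
    (Module.supportDim_le_of_surjective (Submodule.factor hq)
      (Submodule.factor_surjective hq)).trans hdim'.le
  have hbig : ∀ q : Ideal R, Module.annihilator R M ≤ q → ∀ i, LCNonzero 𝔞 i (R ⧸ q) → i ≤ d := by
    intro q hq i hi
    by_contra hcon
    have := vanish 𝔞 i (R ⧸ q) ((hle q hq).trans_lt (by exact_mod_cast not_le.1 hcon))
    exact not_subsingleton_iff_nontrivial.2 hi this
  have hcd : ∀ q : Ideal R, Module.annihilator R M ≤ q →
      (cohDim 𝔞 (R ⧸ q) = ((d : ℕ∞) : WithBot ℕ∞) ↔ LCNonzero 𝔞 d (R ⧸ q)) := by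
    intro q hq
    constructor
    · intro h
      by_contra hcon
      have hlt : ∀ i, LCNonzero 𝔞 i (R ⧸ q) → i < d := fun i hi =>
        lt_of_le_of_ne (hbig q hq i hi) (by rintro rfl; exact hcon hi)
      unfold cohDim at h
      rcases d with _ | d
      · have : {n : WithBot ℕ∞ | ∃ i : ℕ, n = (i : ℕ∞) ∧ LCNonzero 𝔞 i (R ⧸ q)} = ∅ := by
          ext n
          simp only [Set.mem_ofPred_eq, Set.mem_empty_iff_false, iff_false]
          rintro ⟨i, -, hi⟩
          exact absurd (hlt i hi) (by omega)
        rw [this, sSup_empty] at h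
        exact WithBot.bot_ne_coe h
      · have : sSup {n : WithBot ℕ∞ | ∃ i : ℕ, n = (i : ℕ∞) ∧ LCNonzero 𝔞 i (R ⧸ q)}
            ≤ ((d : ℕ∞) : WithBot ℕ∞) := by
          refine sSup_le ?_
          rintro n ⟨i, rfl, hi⟩
          exact_mod_cast Nat.lt_succ_iff.1 (hlt i hi)
        rw [h] at this
        have h2 : d + 1 ≤ d := by exact_mod_cast this
        omega
    · intro h
      refine le_antisymm (sSup_le ?_) (le_sSup ⟨d, rfl, h⟩)
      rintro n ⟨i, rfl, hi⟩
      exact_mod_cast hbig q hq i hi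
  apply le_antisymm
  · refine le_sInf ?_
    rintro p ⟨hp, hpd⟩ r ⟨n, hn⟩
    have hann : Module.annihilator R M ≤ p := by
      rw [← Submodule.annihilator_top]
      exact hp.annihilator_le
    rw [Module.mem_annihilator] at hn
    exact hp.isPrime.mem_of_pow_mem n
      (part1 𝔞 hdim.le hp.isPrime hann (hle p hann) ((hcd p hann).1 hpd) hn)
  · intro r hr
    rw [Ideal.mem_sInf] at hr
    obtain ⟨k, hk⟩ := part2 𝔞 d r (M := M) inferInstance (by
      intro p hp hnt
      rw [Module.support_eq_zeroLocus] at hp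
      have hp : Module.annihilator R M ≤ p.asIdeal := hp
      refine hr ⟨Module.associatedPrimes.minimalPrimes_annihilator_subset_associatedPrimes R M
        ⟨⟨p.isPrime, hp⟩, ?_⟩, (hcd _ hp).2 hnt⟩
      rintro q ⟨hq, hq2⟩ hqp
      by_contra hnle
      obtain ⟨s, hsp, hsq⟩ := SetLike.not_le_iff_exists.1 hnle
      let J := LinearMap.ker (Submodule.factor hqp)
      have hJ : J ≠ ⊥ := by
        intro hJ
        have h1 : (Submodule.mkQ q s) ∈ J := (Submodule.Quotient.mk_eq_zero _).2 hsp
        rw [hJ, Submodule.mem_bot] at h1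
        exact hsq ((Submodule.Quotient.mk_eq_zero _).1 h1)
      have h1 := dim_drop' (hle q hq2) hJ
      have h2 := Module.supportDim_le_of_surjective
        ((Submodule.factor hqp).quotKerEquivOfSurjective (Submodule.factor_surjective hqp)).toLinearMap
        (LinearEquiv.surjective _)
      have h3 := vanish 𝔞 d (R ⧸ p.asIdeal) (h2.trans_lt h1)
      exact not_subsingleton_iff_nontrivial.2 hnt h3)
    exact ⟨k, Module.mem_annihilator.2 hk⟩
end
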